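/- arXiv:1004.3145 — 2 statements merged into one kernel-verified Lean document; each statement's English description precedes it below -/
import Mathlib

section
/- (Additive kinematic formula for SO(n)) For every 0 ≤ i ≤ n and all nonempty compact convex sets K, L ⊆ ℝⁿ, ∫_{SO(n)} μ_i(K + gL) dg = [2n-i, n-i] · Σ_{k+l=i, k,l ≥ 0} [2n-i, n-k]^{-1} μ_k(K) μ_l(L), where K + gL is the Minkowski sum, the integral is with respect to the Haar probability measure on SO(n), and [m, j] = C(m,j) ω_m/(ω_j ω_{m-j}) are the flag coefficients. -/
open MeasureTheory Metric Set
open scoped Pointwise ENNReal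

noncomputable section

/-- Euclidean `n`-space. -/
abbrev En (n : ℕ) := EuclideanSpace ℝ (Fin n)

instance matrixMeasurableSpace (n : ℕ) : MeasurableSpace (Matrix (Fin n) (Fin n) ℝ) :=
  inferInstanceAs (MeasurableSpace ((Fin n) → (Fin n) → ℝ))

/-- The special orthogonal group `SO(n)`, as the subgroup of the (real) unitary group
consisting of matrices of determinant one. -/
def SO (n : ℕ) : Subgroup (Matrix.unitaryGroup (Fin n) ℝ) where
  carrier := {g | Matrix.det (g : Matrix (Fin n) (Fin n) ℝ) = 1}
  one_mem' := by simp
  mul_mem' := by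
    intro a b ha hb
    simp only [Set.mem_setOf_eq] at *
    rw [MulMemClass.coe_mul, Matrix.det_mul, ha, hb, mul_one]
  inv_mem' := by
    intro a ha
    simp only [Set.mem_setOf_eq] at *
    have h : ((a⁻¹ * a : Matrix.unitaryGroup (Fin n) ℝ) : Matrix (Fin n) (Fin n) ℝ) = 1 := by
      rw [inv_mul_cancel]; rfl
    have h2 := congrArg Matrix.det h
    rw [MulMemClass.coe_mul, Matrix.det_mul, ha, mul_one, Matrix.det_one] at h2
    exact h2

/-- The linear action of an element of `SO(n)` on `ℝⁿ`. -/
def soAct {n : ℕ} (g : SO n) : En n →ₗ[ℝ] En n :=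
  Matrix.toEuclideanLin ((g : Matrix.unitaryGroup (Fin n) ℝ) : Matrix (Fin n) (Fin n) ℝ)

variable {V : Type*} [NormedAddCommGroup V] [NormedSpace ℝ V]

/-- `μ` is a valuation: additivity on unions of convex bodies whose union is again convex. -/
def IsValuation (μ : ConvexBody V → ℝ) : Prop :=
  ∀ K L M N : ConvexBody V,
    (M : Set V) = (K : Set V) ∪ (L : Set V) → (N : Set V) = (K : Set V) ∩ (L : Set V) →
      μ M + μ N = μ K + μ L

/-- `μ` is translation invariant. -/
def IsTranslationInvariant (μ : ConvexBody V → ℝ) : Prop :=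
  ∀ (x : V) (K L : ConvexBody V), (L : Set V) = x +ᵥ (K : Set V) → μ L = μ K

/-- `μ` is homogeneous of degree `k`. -/
def IsHomogeneousVal (k : ℕ) (μ : ConvexBody V → ℝ) : Prop :=
  ∀ (t : ℝ), 0 ≤ t → ∀ K L : ConvexBody V,
    (L : Set V) = t • (K : Set V) → μ L = t ^ k * μ K

/-- `μ` is an even valuation. -/
def IsEvenVal (μ : ConvexBody V → ℝ) : Prop :=
  ∀ K L : ConvexBody V, (L : Set V) = -(K : Set V) → μ L = μ K

/-- `μ` is invariant under the action of `SO(n)`. -/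
def IsSOInvariant (n : ℕ) (μ : ConvexBody (En n) → ℝ) : Prop :=
  ∀ (g : SO n) (K L : ConvexBody (En n)),
    (L : Set (En n)) = (soAct g) '' (K : Set (En n)) → μ L = μ K

/-- `ω k`, the volume of the `k`-dimensional Euclidean unit ball. -/
def ballVol (k : ℕ) : ℝ := (volume (Metric.closedBall (0 : EuclideanSpace ℝ (Fin k)) 1)).toReal

/-- The flag coefficient `[m, j] = C(m,j) ω_m / (ω_j ω_{m-j})`. -/
def flagCoeff (m j : ℕ) : ℝ := (m.choose j : ℝ) * ballVol m / (ballVol j * ballVol (m - j))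

/-- A family `μ_0, …, μ_n` satisfies the Steiner formula
`vol_n(K + tB) = ∑_{k=0}^n μ_{n-k}(K) ω_k t^k`;
this characterizes the intrinsic volumes. -/
def SteinerFamily (n : ℕ) (μ : Fin (n+1) → ConvexBody (En n) → ℝ) : Prop :=
  ∀ (K : ConvexBody (En n)) (t : ℝ), 0 ≤ t →
    (volume ((K : Set (En n)) + t • Metric.closedBall (0 : En n) 1)).toReal
      = ∑ k : Fin (n+1), μ k.rev K * ballVol (k : ℕ) * t ^ (k : ℕ)

/-- The image of a convex body under a linear map of a finite-dimensional space. -/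
def mapBody {W : Type*} [NormedAddCommGroup W] [NormedSpace ℝ W] [FiniteDimensional ℝ W]
    (f : W →ₗ[ℝ] W) (K : ConvexBody W) : ConvexBody W :=
  ⟨f '' (K : Set W), K.convex.linear_image f,
    K.isCompact.image f.continuous_of_finiteDimensional, K.nonempty.image f⟩

/-! ### Metric projection onto a convex body -/

namespace AKF

variable {n : ℕ}

theorem exists_proj (K : ConvexBody (En n)) (u : En n) :
    ∃ v ∈ (K : Set (En n)), ∀ y ∈ (K : Set (En n)), inner ℝ (u - v) (y - v) ≤ 0 := by
  obtain ⟨v, hv, h⟩ := exists_norm_eq_iInf_of_complete_convex K.nonempty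
    K.isCompact.isComplete K.convex u
  exact ⟨v, hv, (norm_eq_iInf_iff_real_inner_le_zero K.convex hv).1 h⟩

/-- nearest point map -/
def proj (K : ConvexBody (En n)) (u : En n) : En n := (exists_proj K u).choose

theorem proj_mem (K : ConvexBody (En n)) (u : En n) : proj K u ∈ (K : Set (En n)) :=
  (exists_proj K u).choose_spec.1

theorem proj_inner (K : ConvexBody (En n)) (u : En n) {y : En n} (hy : y ∈ (K : Set (En n))) :
    inner ℝ (u - proj K u) (y - proj K u) ≤ 0 :=
  (exists_proj K u).choose_spec.2 y hy

theorem proj_unique (K : ConvexBody (En n)) (u x : En n) (hx : x ∈ (K : Set (En n)))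
    (h : ∀ y ∈ (K : Set (En n)), inner ℝ (u - x) (y - x) ≤ 0) : proj K u = x := by
  have h1 := h _ (proj_mem K u)
  have h2 := proj_inner K u hx
  have h3 : inner ℝ (proj K u - x) (proj K u - x) ≤ (0 : ℝ) := by
    have : (inner ℝ (proj K u - x) (proj K u - x) : ℝ) =
      inner ℝ (u - x) (proj K u - x) + inner ℝ (u - proj K u) (x - proj K u) := by
      simp only [inner_sub_left, inner_sub_right]; ring
    linarith
  have h4 := real_inner_self_nonpos.1 h3
  exact sub_eq_zero.1 h4

theorem proj_firm (K : ConvexBody (En n)) (u v : En n) :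
    ‖proj K u - proj K v‖ ^ 2 ≤ inner ℝ (proj K u - proj K v) (u - v) := by
  have h1 := proj_inner K u (proj_mem K v)
  have h2 := proj_inner K v (proj_mem K u)
  rw [← real_inner_self_eq_norm_sq]
  simp only [inner_sub_left, inner_sub_right] at *
  have e1 := real_inner_comm (proj K u) (proj K v)
  have e2 := real_inner_comm (proj K u) u
  have e3 := real_inner_comm (proj K u) v
  have e4 := real_inner_comm (proj K v) u
  have e5 := real_inner_comm (proj K v) v
  linarith

theorem proj_lip (K : ConvexBody (En n)) : LipschitzWith 1 (proj K) := by
  refine LipschitzWith.of_dist_le_mul fun u v => ?_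
  rw [dist_eq_norm, dist_eq_norm]
  have h1 := proj_firm K u v
  have h2 := real_inner_le_norm (proj K u - proj K v) (u - v)
  simp only [NNReal.coe_one, one_mul]
  by_contra hc
  push Not at hc
  have h3 := norm_nonneg (u - v)
  nlinarith [norm_nonneg (proj K u - proj K v)]

theorem proj_cont (K : ConvexBody (En n)) : Continuous (proj K) := (proj_lip K).continuous

theorem proj_ray (K : ConvexBody (En n)) (u : En n) {s : ℝ} (hs : 0 ≤ s) :
    proj K (proj K u + s • (u - proj K u)) = proj K u := by
  refine proj_unique K _ _ (proj_mem K u) fun y hy => ?_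
  rw [add_sub_cancel_left, inner_smul_left]
  have := proj_inner K u hy
  simp only [conj_trivial]
  nlinarith

/-- the normal vector at the nearest point -/
def nrm (K : ConvexBody (En n)) (u : En n) : En n := u - proj K u

theorem nrm_cont (K : ConvexBody (En n)) : Continuous (nrm K) :=
  continuous_id.sub (proj_cont K)

theorem infDist_eq (K : ConvexBody (En n)) (u : En n) :
    Metric.infDist u (K : Set (En n)) = ‖nrm K u‖ := by
  apply le_antisymm
  · rw [nrm, ← dist_eq_norm]
    exact Metric.infDist_le_dist_of_mem (proj_mem K u)
  · rw [Metric.le_infDist K.nonempty]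
    intro y hy
    rw [dist_eq_norm, nrm]
    have h1 := proj_inner K u hy
    have h2 := real_inner_le_norm (u - proj K u) (u - y)
    have h3 : (inner ℝ (u - proj K u) (u - y) : ℝ) =
      ‖u - proj K u‖ ^ 2 - inner ℝ (u - proj K u) (y - proj K u) := by
      rw [← real_inner_self_eq_norm_sq, ← inner_sub_right]; congr 1; abel
    by_contra hc
    push Not at hc
    nlinarith [norm_nonneg (u - y), norm_nonneg (u - proj K u)]

/-- the closed `r`-neighbourhood -/
theorem setOf_nrm_le (K : ConvexBody (En n)) {r : ℝ} (hr : 0 ≤ r) :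
    {u | ‖nrm K u‖ ≤ r} = (K : Set (En n)) + r • Metric.closedBall (0 : En n) 1 := by
  ext u
  rw [smul_unitClosedBall_of_nonneg hr]
  simp only [Set.mem_ofPred_eq, Set.mem_add, mem_closedBall, dist_zero_right]
  constructor
  · intro h
    exact ⟨proj K u, proj_mem K u, nrm K u, h, by simp [nrm]⟩
  · rintro ⟨x, hx, y, hy, rfl⟩
    rw [← infDist_eq]
    refine (Metric.infDist_le_dist_of_mem hx).trans ?_
    simpa [dist_eq_norm] using hy

/-- a primitive of the nearest point map -/
def prim (K : ConvexBody (En n)) (u : En n) : ℝ := inner ℝ u (proj K u) - ‖proj K u‖ ^ 2 / 2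

theorem prim_ge (K : ConvexBody (En n)) (u : En n) {y : En n} (hy : y ∈ (K : Set (En n))) :
    inner ℝ u y - ‖y‖ ^ 2 / 2 ≤ prim K u := by
  have h := proj_inner K u hy
  have h2 : 0 ≤ ‖y - proj K u‖ ^ 2 := sq_nonneg _
  unfold prim
  rw [← real_inner_self_eq_norm_sq] at *
  simp only [inner_sub_left, inner_sub_right] at *
  rw [← real_inner_self_eq_norm_sq]
  have e1 := real_inner_comm (proj K u) y
  linarith

theorem prim_add_le (K : ConvexBody (En n)) (u h : En n) :
    prim K (u + h) ≤ prim K u + inner ℝ h (proj K (u + h)) := by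
  have := prim_ge K u (proj_mem K (u + h))
  unfold prim at *
  rw [inner_add_left]
  linarith

theorem le_prim_add (K : ConvexBody (En n)) (u h : En n) :
    prim K u + inner ℝ h (proj K u) ≤ prim K (u + h) := by
  have := prim_ge K (u + h) (proj_mem K u)
  unfold prim at *
  rw [inner_add_left] at this
  linarith

theorem prim_hasFDerivAt (K : ConvexBody (En n)) (u : En n) :
    HasFDerivAt (prim K) (innerSL ℝ (proj K u)) u := by
  rw [hasFDerivAt_iff_isLittleO_nhds_zero]
  refine Asymptotics.IsBigO.trans_isLittleO (g := fun h => ‖h‖ ^ 2) ?_ ?_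
  · refine Asymptotics.IsBigO.of_bound 1 (Filter.Eventually.of_forall fun h => ?_)
    have h1 := prim_add_le K u h
    have h2 := le_prim_add K u h
    have h3 : (inner ℝ h (proj K (u + h)) : ℝ) ≤ inner ℝ h (proj K u) + ‖h‖ ^ 2 := by
      have h4 := real_inner_le_norm h (proj K (u + h) - proj K u)
      have h5 := (proj_lip K).dist_le_mul (u + h) u
      rw [dist_eq_norm, dist_eq_norm] at h5
      simp only [NNReal.coe_one, one_mul, add_sub_cancel_left] at h5
      rw [inner_sub_right] at h4
      nlinarith [norm_nonneg h]
    simp only [innerSL_apply_apply, norm_pow, norm_norm, one_mul]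
    rw [real_inner_comm, Real.norm_eq_abs, abs_le]
    constructor <;> nlinarith [sq_nonneg ‖h‖]
  · simpa using (Asymptotics.isLittleO_norm_pow_id (E' := En n) one_lt_two)

theorem proj_ae_diff (K : ConvexBody (En n)) :
    ∀ᵐ u : En n, DifferentiableAt ℝ (proj K) u := (proj_lip K).ae_differentiableAt

theorem fderiv_proj_symm (K : ConvexBody (En n)) {u : En n}
    (hu : DifferentiableAt ℝ (proj K) u) (v w : En n) :
    inner ℝ (fderiv ℝ (proj K) u v) w = inner ℝ (fderiv ℝ (proj K) u w) v := by
  have hx : HasFDerivAt (fun y => innerSL ℝ (proj K y))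
      ((innerSL ℝ).comp (fderiv ℝ (proj K) u)) u :=
    (innerSL ℝ (E := En n)).hasFDerivAt.comp u hu.hasFDerivAt
  have := second_derivative_symmetric (fun y => prim_hasFDerivAt K y) hx v w
  simpa using this

theorem fderiv_proj_nonneg (K : ConvexBody (En n)) {u : En n}
    (hu : DifferentiableAt ℝ (proj K) u) (v : En n) :
    0 ≤ inner ℝ (fderiv ℝ (proj K) u v) v := by
  have h1 : HasDerivAt (fun t : ℝ => proj K (u + t • v)) (fderiv ℝ (proj K) u v) 0 := by
    have := hu.hasFDerivAt.hasLineDerivAt v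
    exact this
  have h2 : HasDerivAt (fun t : ℝ => (inner ℝ (proj K (u + t • v)) v : ℝ))
      (inner ℝ (fderiv ℝ (proj K) u v) v) 0 := by
    simpa using h1.inner ℝ (hasDerivAt_const (0:ℝ) v)
  have hm : Monotone (fun t : ℝ => (inner ℝ (proj K (u + t • v)) v : ℝ)) := by
    intro a b hab
    rcases hab.eq_or_lt with rfl | hab
    · exact le_rfl
    have := proj_firm K (u + b • v) (u + a • v)
    rw [add_sub_add_left_eq_sub, ← sub_smul, inner_smul_right, inner_sub_left] at this
    have h0 : 0 ≤ ‖proj K (u + b • v) - proj K (u + a • v)‖ ^ 2 := sq_nonneg _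
    have h3 : 0 < b - a := sub_pos.2 hab
    have h4 := nonneg_of_mul_nonneg_right (h0.trans this) h3
    simp only
    linarith
  rw [← h2.deriv]
  exact hm.deriv_nonneg

theorem fderiv_proj_nrm (K : ConvexBody (En n)) {u : En n}
    (hu : DifferentiableAt ℝ (proj K) u) : fderiv ℝ (proj K) u (nrm K u) = 0 := by
  have h1 : HasDerivAt (fun t : ℝ => proj K (u + t • nrm K u)) 
      (fderiv ℝ (proj K) u (nrm K u)) 0 := hu.hasFDerivAt.hasLineDerivAt _
  refine h1.unique ?_
  refine (hasDerivAt_const (0:ℝ) (proj K u)).congr_of_eventuallyEq ?_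
  filter_upwards [lt_mem_nhds (show (-1:ℝ) < 0 by norm_num)] with t ht
  have := proj_ray K u (s := 1 + t) (by linarith)
  rw [← this]
  congr 1
  rw [nrm]; module

end AKF

/-! ### Area formula -/

namespace AKF

variable {n : ℕ}

theorem lip_null {C : NNReal} {T : En n → En n} (hT : LipschitzWith C T) {s : Set (En n)}
    (hs : volume s = 0) : volume (T '' s) = 0 := by
  have h1 : (volume : Measure (En n)) ≪ Measure.hausdorffMeasure (Module.finrank ℝ (En n)) :=
    Measure.absolutelyContinuous_isAddHaarMeasure _ _
  have h2 : (Measure.hausdorffMeasure (Module.finrank ℝ (En n)) : Measure (En n)) ≪ volume :=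
    Measure.absolutelyContinuous_isAddHaarMeasure _ _
  apply h1
  have := hT.hausdorffMeasure_image_le (d := Module.finrank ℝ (En n)) (Nat.cast_nonneg _) s
  rw [h2 hs, mul_zero] at this
  exact nonpos_iff_eq_zero.1 this

theorem area {C : NNReal} {T : En n → En n} (hT : LipschitzWith C T) {s : Set (En n)}
    (hs : MeasurableSet s)
    (hinj : ∀ u ∈ s, ∀ v ∈ s, DifferentiableAt ℝ T u → (fderiv ℝ T u).det ≠ 0 → T u = T v → u = v) :
    volume (T '' s) = ∫⁻ u in s, ENNReal.ofReal |(fderiv ℝ T u).det| := by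
  have hdm : Measurable fun u => (fderiv ℝ T u).det :=
    ContinuousLinearMap.continuous_det.measurable.comp (measurable_fderiv ℝ T)
  have hD : MeasurableSet {u | DifferentiableAt ℝ T u} := measurableSet_of_differentiableAt ℝ T
  set G : Set (En n) := s ∩ {u | DifferentiableAt ℝ T u} ∩ {u | (fderiv ℝ T u).det ≠ 0} with hG
  set Z : Set (En n) := s ∩ {u | DifferentiableAt ℝ T u} ∩ {u | (fderiv ℝ T u).det = 0} with hZ
  have hGm : MeasurableSet G :=
    (hs.inter hD).inter (hdm (measurableSet_singleton (0:ℝ)).compl)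
  have hN : volume {u | DifferentiableAt ℝ T u}ᶜ = 0 := hT.ae_differentiableAt
  have hZ0 : volume (T '' Z) = 0 :=
    addHaar_image_eq_zero_of_det_fderivWithin_eq_zero (f' := fun u => fderiv ℝ T u) volume
      (fun x hx => hx.1.2.hasFDerivAt.hasFDerivWithinAt) (fun x hx => hx.2)
  have hN0 : volume (T '' {u | DifferentiableAt ℝ T u}ᶜ) = 0 := lip_null hT hN
  have h1 : volume (T '' s) = volume (T '' G) := by
    apply le_antisymm
    · have : T '' s ⊆ T '' G ∪ (T '' Z ∪ T '' {u | DifferentiableAt ℝ T u}ᶜ) := by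
        rw [← image_union, ← image_union]
        apply image_mono
        intro u hu
        by_cases hd : DifferentiableAt ℝ T u
        · by_cases h0 : (fderiv ℝ T u).det = 0
          · exact Or.inr (Or.inl ⟨⟨hu, hd⟩, h0⟩)
          · exact Or.inl ⟨⟨hu, hd⟩, h0⟩
        · exact Or.inr (Or.inr hd)
      refine (measure_mono this).trans ((measure_union_le _ _).trans ?_)
      rw [measure_union_null hZ0 hN0, add_zero]
    · exact measure_mono (image_mono (fun u hu => hu.1.1))
  rw [h1, ← lintegral_abs_det_fderiv_eq_addHaar_image volume hGm
    (f' := fun u => fderiv ℝ T u) (fun x hx => hx.1.2.hasFDerivAt.hasFDerivWithinAt)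
    (fun x hx y hy hxy => hinj x hx.1.1 y hy.1.1 hx.1.2 hx.2 hxy)]
  rw [← lintegral_indicator hGm, ← lintegral_indicator hs]
  refine lintegral_congr_ae ?_
  filter_upwards [hT.ae_differentiableAt] with u hd
  by_cases hu : u ∈ s
  · by_cases h0 : (fderiv ℝ T u).det = 0
    · have : u ∉ G := fun h => h.2 h0
      simp [this, hu, h0]
    · have : u ∈ G := ⟨⟨hu, hd⟩, h0⟩
      simp [this, hu]
  · have : u ∉ G := fun h => hu h.1.1
    simp [this, hu]

theorem proj_segment (K : ConvexBody (En n)) (u v : En n) (h : proj K u = proj K v) {t : ℝ}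
    (h0 : 0 ≤ t) (h1 : t ≤ 1) : proj K (u + t • (v - u)) = proj K u := by
  refine proj_unique K _ _ (proj_mem K u) fun y hy => ?_
  have a := proj_inner K u hy
  have b := proj_inner K v hy
  rw [← h] at b
  have : u + t • (v - u) - proj K u = (1 - t) • (u - proj K u) + t • (v - proj K u) := by module
  rw [this, inner_add_left, inner_smul_left, inner_smul_left]
  simp only [conj_trivial]
  nlinarith [mul_nonneg (sub_nonneg.2 h1) (neg_nonneg.2 a), mul_nonneg h0 (neg_nonneg.2 b)]

theorem sum_inj (K L : ConvexBody (En n)) {u v : En n}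
    (hd : DifferentiableAt ℝ (fun u => proj K u + proj L u) u)
    (h0 : (fderiv ℝ (fun u => proj K u + proj L u) u).det ≠ 0)
    (h : proj K u + proj L u = proj K v + proj L v) : u = v := by
  have h1 := proj_firm K u v
  have h2 := proj_firm L u v
  have h3 : (inner ℝ (proj K u - proj K v) (u - v) + inner ℝ (proj L u - proj L v) (u - v) : ℝ) 
      = 0 := by
    rw [← inner_add_left]
    have : proj K u - proj K v + (proj L u - proj L v) = 0 := by
      rw [← add_sub_add_comm, h, sub_self]
    rw [this, inner_zero_left]
  have hK : proj K u = proj K v := by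
    have : ‖proj K u - proj K v‖ ^ 2 = 0 := by
      nlinarith [sq_nonneg ‖proj K u - proj K v‖, sq_nonneg ‖proj L u - proj L v‖]
    exact sub_eq_zero.1 (norm_eq_zero.1 (pow_eq_zero_iff two_ne_zero |>.1 this))
  have hL : proj L u = proj L v := by
    rw [hK] at h; exact add_left_cancel h
  set T := (fun u => proj K u + proj L u) with hT
  have hder : HasDerivAt (fun t : ℝ => T (u + t • (v - u))) (fderiv ℝ T u (v - u)) 0 :=
    hd.hasFDerivAt.hasLineDerivAt _
  have hz : fderiv ℝ T u (v - u) = 0 := by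
    have hu : UniqueDiffWithinAt ℝ (Icc (0:ℝ) 1) 0 :=
      uniqueDiffOn_Icc zero_lt_one 0 (by simp)
    refine hu.eq_deriv _ hder.hasDerivWithinAt ?_
    refine (hasDerivWithinAt_const (0:ℝ) (Icc (0:ℝ) 1) (T u)).congr (fun t ht => ?_) (by simp)
    simp only [hT]
    rw [proj_segment K u v hK ht.1 ht.2, proj_segment L u v hL ht.1 ht.2]
  by_contra hne
  apply h0
  have hbot : LinearMap.ker (fderiv ℝ T u : En n →ₗ[ℝ] En n) ≠ ⊥ := by
    intro hb
    have : v - u ∈ LinearMap.ker (fderiv ℝ T u : En n →ₗ[ℝ] En n) := hz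
    rw [hb, Submodule.mem_bot, sub_eq_zero] at this
    exact hne this.symm
  exact LinearMap.det_eq_zero_iff_ker_ne_bot.2 hbot

theorem sum_range (K L : ConvexBody (En n)) :
    interior ((K : Set (En n)) + (L : Set (En n))) ⊆ range (fun u => proj K u + proj L u) := by
  intro x hx
  obtain ⟨δ, hδ, hball⟩ := Metric.isOpen_iff.1 isOpen_interior x hx
  obtain ⟨CK, hCK⟩ := K.isBounded.exists_norm_le
  obtain ⟨CL, hCL⟩ := L.isBounded.exists_norm_le
  let f : En n → ℝ := fun u => prim K u + prim L u - inner ℝ u x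
  have hcont : Continuous f := by
    have hK : Continuous (prim K) := 
      continuous_iff_continuousAt.2 fun u => (prim_hasFDerivAt K u).continuousAt
    have hL : Continuous (prim L) := 
      continuous_iff_continuousAt.2 fun u => (prim_hasFDerivAt L u).continuousAt
    exact (hK.add hL).sub (continuous_id.inner continuous_const)
  have hlow : ∀ u, δ / 2 * ‖u‖ - (CK ^ 2 / 2 + CL ^ 2 / 2) ≤ f u := by
    intro u
    have hmem : x + (δ / 2 / ‖u‖) • u ∈ (K : Set (En n)) + (L : Set (En n)) := by
      apply interior_subset
      apply hball
      rw [mem_ball, dist_eq_norm, add_sub_cancel_left, norm_smul]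
      by_cases hu : ‖u‖ = 0
      · rw [hu]; simpa using hδ
      · rw [Real.norm_eq_abs, abs_of_nonneg (by positivity), div_mul_cancel₀ _ hu]
        linarith
    obtain ⟨y, hy, z, hz, hyz⟩ := hmem
    have h1 := prim_ge K u hy
    have h2 := prim_ge L u hz
    have h3 : (inner ℝ u y + inner ℝ u z : ℝ) = inner ℝ u x + δ / 2 * ‖u‖ := by
      rw [← inner_add_right]
      simp only at hyz
      rw [hyz, inner_add_right, inner_smul_right, real_inner_self_eq_norm_sq]
      by_cases hu : ‖u‖ = 0
      · simp [hu]
      · field_simp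
    have h4 : ‖y‖ ^ 2 ≤ CK ^ 2 := by
      have := hCK y hy
      nlinarith [norm_nonneg y]
    have h5 : ‖z‖ ^ 2 ≤ CL ^ 2 := by
      have := hCL z hz
      nlinarith [norm_nonneg z]
    simp only [f]
    linarith
  have htend : Filter.Tendsto f (Filter.cocompact (En n)) Filter.atTop := by
    refine Filter.tendsto_atTop_mono hlow ?_
    apply Filter.tendsto_atTop_add_const_right
    exact (tendsto_norm_cocompact_atTop (E := En n)).const_mul_atTop (by positivity)
  obtain ⟨u, hu⟩ := hcont.exists_forall_le htend
  refine ⟨u, ?_⟩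
  set T := (fun u => proj K u + proj L u) with hT
  have key : ∀ h : En n, 0 ≤ (inner ℝ h (T (u + h) - x) : ℝ) := by
    intro h
    have h1 := hu (u + h)
    have h2 := prim_add_le K u h
    have h3 := prim_add_le L u h
    simp only [f, inner_add_left] at h1
    simp only [hT, inner_sub_right, inner_add_right]
    linarith
  have hTc : Continuous T := (proj_cont K).add (proj_cont L)
  have hlim : Filter.Tendsto (fun s : ℝ => (inner ℝ (-(T u - x)) (T (u + s • (-(T u - x))) - x) : ℝ))
      (nhdsWithin 0 (Ioi 0)) (nhds (inner ℝ (-(T u - x)) (T u - x))) := by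
    have : Continuous (fun s : ℝ => (inner ℝ (-(T u - x)) (T (u + s • (-(T u - x))) - x) : ℝ)) := by
      fun_prop
    have h2 := (this.tendsto 0).mono_left (nhdsWithin_le_nhds (s := Ioi 0))
    simpa only [zero_smul, add_zero] using h2
  have hge : (0:ℝ) ≤ inner ℝ (-(T u - x)) (T u - x) := by
    refine ge_of_tendsto hlim ?_
    filter_upwards [self_mem_nhdsWithin] with s hs
    have := key (s • (-(T u - x)))
    rw [inner_smul_left] at this
    exact nonneg_of_mul_nonneg_right (by simpa using this) hs
  rw [inner_neg_left] at hge
  exact sub_eq_zero.1 (real_inner_self_nonpos.1 (by linarith))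

theorem vol_sum (K L : ConvexBody (En n)) :
    volume ((K : Set (En n)) + (L : Set (En n))) =
      ∫⁻ u, ENNReal.ofReal |(fderiv ℝ (proj K) u + fderiv ℝ (proj L) u).det| := by
  have hT := (proj_lip K).add (proj_lip L)
  have h := area hT MeasurableSet.univ
    (fun u _ v _ hd h0 h => sum_inj K L hd h0 h)
  rw [Measure.restrict_univ, image_univ] at h
  have hr : volume (range (fun u => proj K u + proj L u)) = volume ((K : Set (En n)) + (L : Set (En n))) := by
    apply le_antisymm
    · apply measure_mono
      rintro _ ⟨u, rfl⟩
      exact Set.add_mem_add (proj_mem K u) (proj_mem L u)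
    · rw [← measure_interior_of_null_frontier ((K.convex.add L.convex).addHaar_frontier volume)]
      exact measure_mono (sum_range K L)
  rw [← hr, h]
  refine lintegral_congr_ae ?_
  filter_upwards [proj_ae_diff K, proj_ae_diff L] with u hK hL
  rw [fderiv_fun_add hK hL]

theorem vol_scale (K : ConvexBody (En n)) {s : ℝ} (hs : 0 < s) (r : ℝ) :
    volume {u | ‖nrm K u‖ ≤ s * r} = ∫⁻ u in {u | ‖nrm K u‖ ≤ r}, 
      ENNReal.ofReal |((1 - s) • fderiv ℝ (proj K) u + s • ContinuousLinearMap.id ℝ (En n)).det| := by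
  let T : En n → En n := fun u => (1 - s) • proj K u + s • u
  have hT : LipschitzWith (‖1 - s‖₊ * 1 + ‖s‖₊ * 1) T := 
    ((lipschitzWith_smul (1 - s)).comp (proj_lip K)).add 
      ((lipschitzWith_smul s).comp LipschitzWith.id)
  have hTe : ∀ u, T u = proj K u + s • (u - proj K u) := fun u => by simp only [T]; module
  have hpT : ∀ u, proj K (T u) = proj K u := fun u => by rw [hTe]; exact proj_ray K u hs.le
  have hnT : ∀ u, nrm K (T u) = s • nrm K u := fun u => by
    rw [nrm, hpT, hTe, nrm, add_sub_cancel_left]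
  have him : T '' {u | ‖nrm K u‖ ≤ r} = {u | ‖nrm K u‖ ≤ s * r} := by
    apply Subset.antisymm
    · rintro _ ⟨u, hu, rfl⟩
      simp only [Set.mem_ofPred_eq] at hu ⊢
      rw [hnT, norm_smul, Real.norm_eq_abs, abs_of_pos hs]
      exact mul_le_mul_of_nonneg_left hu hs.le
    · intro x hx
      have h1 : proj K (proj K x + s⁻¹ • (x - proj K x)) = proj K x := 
        proj_ray K x (inv_nonneg.2 hs.le)
      refine ⟨proj K x + s⁻¹ • (x - proj K x), ?_, ?_⟩
      · simp only [Set.mem_ofPred_eq] at hx ⊢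
        rw [nrm, h1, add_sub_cancel_left, norm_smul, norm_inv, Real.norm_eq_abs, abs_of_pos hs,
          inv_mul_le_iff₀ hs]
        exact hx
      · rw [hTe, h1, add_sub_cancel_left, smul_smul, mul_inv_cancel₀ hs.ne', one_smul]
        abel
  have hm : MeasurableSet {u | ‖nrm K u‖ ≤ r} := 
    (isClosed_le (nrm_cont K).norm continuous_const).measurableSet
  rw [← him, area hT hm]
  · refine lintegral_congr_ae (ae_restrict_of_ae ?_)
    filter_upwards [proj_ae_diff K] with u hK
    have : HasFDerivAt T ((1 - s) • fderiv ℝ (proj K) u + s • ContinuousLinearMap.id ℝ (En n)) u :=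
      (hK.hasFDerivAt.const_smul (1 - s)).add ((hasFDerivAt_id u).const_smul s)
    rw [this.fderiv]
  · intro u _ v _ _ _ h
    have h1 : proj K u = proj K v := by rw [← hpT u, h, hpT v]
    have h2 : s • u = s • v := by
      simp only [T] at h
      rw [h1] at h
      exact add_left_cancel h
    exact smul_right_injective _ hs.ne' h2

end AKF

/-! ### Principal minors -/

namespace AKF

open Matrix

variable {n : ℕ}

/-- the matrix `M` with the rows in `s` replaced by the rows of the identity -/
def pw (s : Finset (Fin n)) (M : Matrix (Fin n) (Fin n) ℝ) : Matrix (Fin n) (Fin n) ℝ :=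
  Matrix.of fun i j => if i ∈ s then (1 : Matrix (Fin n) (Fin n) ℝ) i j else M i j

/-- principal minor of `M` with index set the complement of `s` -/
def minor (s : Finset (Fin n)) (M : Matrix (Fin n) (Fin n) ℝ) : ℝ := (pw s M).det

theorem det_diag_add (a : Fin n → ℝ) (C : Matrix (Fin n) (Fin n) ℝ) :
    (diagonal a + C).det = ∑ s : Finset (Fin n), (∏ i ∈ s, a i) * minor s C := by
  have := (detRowAlternating (n := Fin n) (R := ℝ)).map_add_univ (diagonal a) C
  refine this.trans (Finset.sum_congr rfl fun s _ => ?_)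
  have h := det_mul_column (fun i => if i ∈ s then a i else 1) (pw s C)
  have h2 : (∏ i, if i ∈ s then a i else 1) = ∏ i ∈ s, a i := by
    rw [Finset.prod_ite_mem]; simp
  rw [minor, ← h2, ← h]
  change det _ = det _
  congr 1
  ext i j
  by_cases hi : i ∈ s
  · have h0 : s.piecewise (Matrix.diagonal a) C i = Matrix.diagonal a i :=
      Finset.piecewise_eq_of_mem _ _ _ hi
    rw [h0]
    by_cases hij : i = j
    · subst hij; simp [pw, hi]
    · simp [pw, hi, hij]
  · have h0 : s.piecewise (Matrix.diagonal a) C i = C i :=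
      Finset.piecewise_eq_of_notMem _ _ _ hi
    rw [h0]
    simp [pw, hi]

theorem pw_eq (s : Finset (Fin n)) (M : Matrix (Fin n) (Fin n) ℝ) :
    pw s M = diagonal (fun i => if i ∈ s then 1 else 0) +
      diagonal (fun i => if i ∈ s then 0 else 1) * M := by
  ext i j
  by_cases hi : i ∈ s
  · by_cases hij : i = j
    · subst hij; simp [pw, hi]
    · simp [pw, hi, hij]
  · by_cases hij : i = j
    · subst hij; simp [pw, hi]
    · simp [pw, hi, hij]

theorem minor_nonneg (s : Finset (Fin n)) {M : Matrix (Fin n) (Fin n) ℝ} (hM : M.PosSemidef) :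
    0 ≤ minor s M := by
  set D : Matrix (Fin n) (Fin n) ℝ := diagonal (fun i => if i ∈ s then 1 else 0) with hD
  set P : Matrix (Fin n) (Fin n) ℝ := diagonal (fun i => if i ∈ s then 0 else 1) with hP
  have hDD : D * D = D := by
    rw [hD, diagonal_mul_diagonal]; congr 1; ext i; split_ifs <;> simp
  have hDP : D * P = 0 := by
    rw [hD, hP, diagonal_mul_diagonal, ← diagonal_zero]; congr 1; ext i; split_ifs <;> simp
  have hPD : P + D = 1 := by
    rw [hD, hP, diagonal_add, ← diagonal_one]; congr 1; ext i; split_ifs <;> simp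
  have hPH : Pᴴ = P := by
    rw [hP, diagonal_conjTranspose]; simp
  have h1 : pw s M = (1 + P * M * D) * (D + P * M * P) := by
    rw [pw_eq, ← hD, ← hP]
    have : P * M * D * (D + P * M * P) = P * M * D := by
      rw [mul_add, mul_assoc (P * M) D D, hDD]
      have : P * M * D * (P * M * P) = P * M * (D * P) * (M * P) := by simp only [mul_assoc]
      rw [this, hDP]; simp
    rw [add_mul, one_mul, this, add_assoc, ← mul_add, hPD, mul_one]
  have h2 : (1 + P * M * D).det = 1 := by
    rw [det_one_add_mul_comm, ← mul_assoc, hDP]; simp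
  have h3 : (D + P * M * P).PosSemidef := by
    refine PosSemidef.add ?_ ?_
    · refine PosSemidef.diagonal fun i => ?_
      simp only [Pi.zero_apply]; split_ifs <;> simp
    · have := hM.mul_mul_conjTranspose_same P
      rwa [hPH] at this
  rw [minor, h1, det_mul, h2, one_mul]
  exact h3.det_nonneg

/-- elementary symmetric function of degree `m` of the eigenvalues -/
def es (m : ℕ) (A : Matrix (Fin n) (Fin n) ℝ) : ℝ :=
  ∑ s : Finset (Fin n) with s.card + m = n, minor s A

theorem es_nonneg (m : ℕ) {A : Matrix (Fin n) (Fin n) ℝ} (hA : A.PosSemidef) : 0 ≤ es m A :=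
  Finset.sum_nonneg fun s _ => minor_nonneg s hA

theorem sum_by_card {β : Type*} [AddCommMonoid β] (f : Finset (Fin n) → β) :
    ∑ s, f s = ∑ m ∈ Finset.range (n + 1), ∑ s : Finset (Fin n) with s.card = m, f s := by
  refine (Finset.sum_fiberwise_of_maps_to (fun s _ => ?_) f).symm
  have := s.card_le_univ
  simp only [Fintype.card_fin] at this
  simp; omega

theorem sum_by_cocard {β : Type*} [AddCommMonoid β] (f : Finset (Fin n) → β) :
    ∑ s, f s = ∑ m ∈ Finset.range (n + 1), ∑ s : Finset (Fin n) with s.card + m = n, f s := by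
  rw [← Finset.sum_fiberwise_of_maps_to (g := fun s : Finset (Fin n) => n - s.card) 
    (t := Finset.range (n + 1)) (fun s _ => by simp) f]
  refine Finset.sum_congr rfl fun m hm => ?_
  refine Finset.sum_congr ?_ fun _ _ => rfl
  ext s
  have := s.card_le_univ
  simp only [Fintype.card_fin] at this
  simp at hm ⊢
  omega

theorem det_add_scalar (x : ℝ) (A : Matrix (Fin n) (Fin n) ℝ) :
    (A + x • (1 : Matrix (Fin n) (Fin n) ℝ)).det = ∑ m ∈ Finset.range (n + 1), x ^ (n - m) * es m A := by
  rw [add_comm, show x • (1 : Matrix (Fin n) (Fin n) ℝ) = Matrix.diagonal (fun _ => x) by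
    rw [smul_one_eq_diagonal], det_diag_add, sum_by_cocard]
  refine Finset.sum_congr rfl fun m _ => ?_
  rw [es, Finset.mul_sum]
  refine Finset.sum_congr rfl fun s hs => ?_
  simp only [Finset.mem_filter] at hs
  rw [Finset.prod_const]
  congr 2; omega

theorem det_comb (x y : ℝ) (hy : y ≠ 0) (A : Matrix (Fin n) (Fin n) ℝ) :
    (y • A + x • (1 : Matrix (Fin n) (Fin n) ℝ)).det = 
      ∑ m ∈ Finset.range (n + 1), y ^ m * x ^ (n - m) * es m A := by
  have : y • A + x • (1 : Matrix (Fin n) (Fin n) ℝ) = y • (A + (x / y) • 1) := by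
    rw [smul_add, smul_smul, mul_div_cancel₀ _ hy]
  rw [this, det_smul, det_add_scalar, Fintype.card_fin, Finset.mul_sum]
  refine Finset.sum_congr rfl fun m hm => ?_
  have hm' : m ≤ n := by simp at hm; omega
  rw [div_pow, ← mul_assoc]
  congr 1
  have : y ^ n = y ^ m * y ^ (n - m) := by rw [← pow_add]; congr 1; omega
  rw [this]
  field_simp

theorem poly_unique (N : ℕ) (c d : ℕ → ℝ) 
    (h : ∀ x : ℝ, 0 < x → ∑ m ∈ Finset.range N, c m * x ^ m = ∑ m ∈ Finset.range N, d m * x ^ m) :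
    ∀ m < N, c m = d m := by
  let p : Polynomial ℝ := ∑ m ∈ Finset.range N, Polynomial.C (c m - d m) * Polynomial.X ^ m
  have hp : p = 0 := by
    refine Polynomial.eq_zero_of_infinite_isRoot p ?_
    refine (Ioi_infinite (0:ℝ)).mono fun x hx => ?_
    have := h x hx
    simp only [p, Set.mem_ofPred_eq, Polynomial.IsRoot, Polynomial.eval_finsetSum, Polynomial.eval_mul,
      Polynomial.eval_C, Polynomial.eval_pow, Polynomial.eval_X, sub_mul, Finset.sum_sub_distrib]
    linarith
  intro m hm
  have h2 : p.coeff m = c m - d m := by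
    simp only [p, Polynomial.finsetSum_coeff, Polynomial.coeff_C_mul_X_pow]
    rw [Finset.sum_eq_single m]
    · simp
    · intro b _ hb; simp [hb.symm]
    · intro h; simp at h; omega
  rw [hp] at h2
  simp at h2
  linarith

theorem poly_unique' (N : ℕ) (c d : ℕ → ℝ) 
    (h : ∀ x : ℝ, 0 < x → ∑ m ∈ Finset.range (N+1), x ^ (N - m) * c m = 
      ∑ m ∈ Finset.range (N+1), x ^ (N - m) * d m) :
    ∀ m ≤ N, c m = d m := by
  have := poly_unique (N+1) (fun m => c (N - m)) (fun m => d (N - m)) (fun x hx => by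
    rw [← Finset.sum_range_reflect, ← Finset.sum_range_reflect (fun m => d (N - m) * x ^ m)]
    convert h x hx using 1
    · refine Finset.sum_congr rfl fun m hm => ?_
      have hm' : m ≤ N := by simp at hm; omega
      rw [mul_comm, show N + 1 - 1 - m = N - m by omega, show N - (N - m) = m by omega]
    · refine Finset.sum_congr rfl fun m hm => ?_
      have hm' : m ≤ N := by simp at hm; omega
      rw [mul_comm, show N + 1 - 1 - m = N - m by omega, show N - (N - m) = m by omega])
  intro m hm
  have h2 := this (N - m) (by omega)
  simpa only [show N - (N - m) = m by omega] using h2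

theorem es_conj {A Q : Matrix (Fin n) (Fin n) ℝ} {a : Fin n → ℝ} (hQ : Q * Qᵀ = 1)
    (hA : A = Q * diagonal a * Qᵀ) (m : ℕ) (hm : m ≤ n) :
    es m A = ∑ s : Finset (Fin n) with s.card = m, ∏ i ∈ s, a i := by
  refine poly_unique' n (fun m => es m A) 
    (fun m => ∑ s : Finset (Fin n) with s.card = m, ∏ i ∈ s, a i) (fun x _ => ?_) m hm
  rw [← det_add_scalar]
  have h1 : A + x • (1 : Matrix (Fin n) (Fin n) ℝ) = Q * (diagonal a + x • 1) * Qᵀ := by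
    rw [mul_add, add_mul, ← hA, mul_smul_comm, mul_one, smul_mul_assoc, hQ]
  have hd : Q.det * Qᵀ.det = 1 := by rw [← det_mul, hQ, det_one]
  rw [h1, det_mul, det_mul, mul_right_comm, hd, one_mul, smul_one_eq_diagonal, diagonal_add,
    det_diagonal, Finset.prod_add]
  · simp only [Finset.powerset_univ]
    rw [sum_by_card]
    refine Finset.sum_congr rfl fun m _ => ?_
    rw [Finset.mul_sum]
    refine Finset.sum_congr rfl fun s hs => ?_
    simp only [Finset.mem_filter] at hs
    rw [Finset.prod_const, mul_comm, Finset.card_sdiff_of_subset (Finset.subset_univ _)]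
    simp [hs.2]

theorem exists_good_basis {A : Matrix (Fin n) (Fin n) ℝ} (hA : A.PosSemidef) (v : Fin n → ℝ)
    (hv : A *ᵥ v = 0) : ∃ (Q : Matrix (Fin n) (Fin n) ℝ) (a : Fin n → ℝ), Q * Qᵀ = 1 ∧
      (∀ i, 0 ≤ a i) ∧ A = Q * diagonal a * Qᵀ ∧
      (v ≠ 0 → ∃ i, a i = 0 ∧ (∀ j, j ≠ i → (Qᵀ *ᵥ v) j = 0)) := by
  have hH : (A - vecMulVec v v).IsHermitian := by
    refine IsHermitian.sub hA.1 ?_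
    ext i j
    simp [vecMulVec_apply, mul_comm]
  set Q : Matrix (Fin n) (Fin n) ℝ := hH.eigenvectorUnitary.1 with hQdef
  set l := hH.eigenvalues with hl
  have hQ1 : Q * Qᵀ = 1 := by
    have := (mem_unitaryGroup_iff (A := Q)).1 hH.eigenvectorUnitary.2
    rwa [star_eq_conjTranspose, conjTranspose_eq_transpose_of_trivial] at this
  have hQ2 : Qᵀ * Q = 1 := mul_eq_one_comm.1 hQ1
  have hsp : A - vecMulVec v v = Q * diagonal l * Qᵀ := by
    have := hH.spectral_theorem
    rw [Unitary.conjStarAlgAut_apply] at this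
    simpa [star_eq_conjTranspose, conjTranspose_eq_transpose_of_trivial] using this
  set y := Qᵀ *ᵥ v with hy
  have hvm : Qᵀ * vecMulVec v v * Q = vecMulVec y y := by
    rw [mul_vecMulVec, vecMulVec_mul, ← mulVec_transpose]
  have hconj : Qᵀ * A * Q = diagonal l + vecMulVec y y := by
    have : A = Q * diagonal l * Qᵀ + vecMulVec v v := by rw [← hsp]; abel
    rw [this, mul_add, add_mul, hvm]
    congr 1
    calc Qᵀ * (Q * diagonal l * Qᵀ) * Q = (Qᵀ * Q) * diagonal l * (Qᵀ * Q) := by 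
          simp only [Matrix.mul_assoc]
      _ = diagonal l := by rw [hQ2]; simp
  have hQy : Q *ᵥ y = v := by rw [hy, mulVec_mulVec, hQ1, one_mulVec]
  have hpos : ∀ i, 0 ≤ l i + y i ^ 2 := by
    intro i
    have h1 : (Qᵀ * A * Q).PosSemidef := by
      have := hA.conjTranspose_mul_mul_same Q
      rwa [conjTranspose_eq_transpose_of_trivial] at this
    have h2 := h1.diag_nonneg (i := i)
    rw [hconj] at h2
    simpa [vecMulVec_apply, sq] using h2
  have hzero : ∀ i, l i * y i + y i * (y ⬝ᵥ y) = 0 := by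
    intro i
    have h1 : (Qᵀ * A * Q) *ᵥ y = 0 := by
      rw [← mulVec_mulVec, hQy, ← mulVec_mulVec, hv, mulVec_zero]
    rw [hconj, add_mulVec] at h1
    have h2 := congrFun h1 i
    simp only [Pi.add_apply, mulVec_diagonal, vecMulVec_mulVec, Pi.zero_apply] at h2
    simpa [mul_comm] using h2
  have hcase : v ≠ 0 → ∃ i, l i + y i ^ 2 = 0 ∧ (∀ j, j ≠ i → y j = 0) := by
    intro hv0
    have hy0 : y ≠ 0 := by
      intro h
      apply hv0
      rw [← hQy, h, mulVec_zero]
    obtain ⟨i, hi⟩ := Function.ne_iff.1 hy0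
    simp only [Pi.zero_apply] at hi
    have h1 : l i = - (y ⬝ᵥ y) := by
      have := hzero i
      have h3 : y i * (l i + y ⬝ᵥ y) = 0 := by linarith
      rcases mul_eq_zero.1 h3 with h | h
      · exact absurd h hi
      · linarith
    have h2 : y ⬝ᵥ y = y i ^ 2 + ∑ j ∈ Finset.univ.erase i, y j ^ 2 := by
      rw [Finset.add_sum_erase _ (fun j => y j ^ 2) (Finset.mem_univ i)]
      simp [dotProduct, sq]
    have h3 : 0 ≤ ∑ j ∈ Finset.univ.erase i, y j ^ 2 := Finset.sum_nonneg fun _ _ => sq_nonneg _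
    have h4 := hpos i
    have h5 : ∑ j ∈ Finset.univ.erase i, y j ^ 2 = 0 := by linarith
    refine ⟨i, by linarith, fun j hj => ?_⟩
    have h6 := (Finset.sum_eq_zero_iff_of_nonneg (fun _ _ => sq_nonneg _)).1 h5 j 
      (Finset.mem_erase.2 ⟨hj, Finset.mem_univ _⟩)
    exact pow_eq_zero_iff two_ne_zero |>.1 h6
  refine ⟨Q, fun i => l i + y i ^ 2, hQ1, hpos, ?_, hcase⟩
  have hdiag : diagonal l + vecMulVec y y = diagonal (fun i => l i + y i ^ 2) := by
    ext i j
    by_cases hij : i = j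
    · subst hij; simp [vecMulVec_apply, sq]
    · simp only [Matrix.add_apply, diagonal_apply_ne _ hij, vecMulVec_apply, zero_add]
      by_cases hv0 : v = 0
      · simp [hy, hv0]
      · obtain ⟨k, _, hk⟩ := hcase hv0
        by_cases hik : i = k
        · rw [hk j (fun h => hij (by rw [hik, h])), mul_zero]
        · rw [hk i hik, zero_mul]
  rw [← hdiag, ← hconj]
  calc A = (Q * Qᵀ) * A * (Q * Qᵀ) := by rw [hQ1]; simp
    _ = _ := by simp only [Matrix.mul_assoc]

end AKF

/-! ### The matrix of the derivative of the metric projection -/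

namespace AKF

open Matrix

variable {n : ℕ}

/-- matrix of the derivative of the metric projection -/
def dmat (K : ConvexBody (En n)) (u : En n) : Matrix (Fin n) (Fin n) ℝ :=
  Matrix.toEuclideanLin.symm (fderiv ℝ (proj K) u : En n →ₗ[ℝ] En n)

theorem dmat_lin (K : ConvexBody (En n)) (u : En n) :
    Matrix.toEuclideanLin (dmat K u) = (fderiv ℝ (proj K) u : En n →ₗ[ℝ] En n) := by
  rw [dmat, LinearEquiv.apply_symm_apply]

theorem dmat_mulVec (K : ConvexBody (En n)) (u x : En n) :
    dmat K u *ᵥ x.ofLp = (fderiv ℝ (proj K) u x).ofLp := by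
  have h := congrArg (fun f => (f x).ofLp) (dmat_lin K u)
  simp only [toLpLin_apply] at h
  exact h

theorem dmat_psd (K : ConvexBody (En n)) (u : En n) : (dmat K u).PosSemidef := by
  rw [← isPositive_toEuclideanLin_iff, dmat_lin]
  by_cases hu : DifferentiableAt ℝ (proj K) u
  · refine ⟨fun v w => ?_, fun v => ?_⟩
    · have := fderiv_proj_symm K hu v w
      simp only [ContinuousLinearMap.coe_coe]
      rw [this, real_inner_comm]
    · simpa using fderiv_proj_nonneg K hu v
  · rw [fderiv_zero_of_not_differentiableAt hu]
    exact LinearMap.isPositive_zero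

theorem dmat_nrm (K : ConvexBody (En n)) (u : En n) : dmat K u *ᵥ (nrm K u).ofLp = 0 := by
  rw [dmat_mulVec]
  by_cases hu : DifferentiableAt ℝ (proj K) u
  · rw [fderiv_proj_nrm K hu]; rfl
  · rw [fderiv_zero_of_not_differentiableAt hu]; rfl

theorem det_lin (M : Matrix (Fin n) (Fin n) ℝ) : LinearMap.det (Matrix.toEuclideanLin M) = M.det := by
  rw [toEuclideanLin, toLpLin_eq_toLin, LinearMap.det_toLin]

theorem vol_sum' (K L : ConvexBody (En n)) :
    volume ((K : Set (En n)) + (L : Set (En n))) =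
      ∫⁻ u, ENNReal.ofReal (dmat K u + dmat L u).det := by
  rw [vol_sum]
  refine lintegral_congr fun u => ?_
  rw [abs_of_nonneg]
  · congr 1
    rw [← det_lin, map_add, dmat_lin, dmat_lin]; rfl
  · have h := ((dmat_psd K u).add (dmat_psd L u)).det_nonneg
    rw [← det_lin, map_add, dmat_lin, dmat_lin] at h
    exact h

theorem vol_scale' (K : ConvexBody (En n)) {s : ℝ} (hs : 0 < s) (hs1 : s < 1) (r : ℝ) :
    volume {u | ‖nrm K u‖ ≤ s * r} = ∫⁻ u in {u | ‖nrm K u‖ ≤ r}, 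
      ENNReal.ofReal ((1 - s) • dmat K u + s • (1 : Matrix (Fin n) (Fin n) ℝ)).det := by
  rw [vol_scale K hs]
  refine lintegral_congr fun u => ?_
  have h1 : ((1 - s) • fderiv ℝ (proj K) u + s • ContinuousLinearMap.id ℝ (En n)).det = 
    ((1 - s) • dmat K u + s • (1 : Matrix (Fin n) (Fin n) ℝ)).det := by
    rw [← det_lin, map_add, map_smul, map_smul, dmat_lin, toEuclideanLin, toLpLin_one]; rfl
  rw [h1, abs_of_nonneg]
  exact (((dmat_psd K u).smul (by linarith)).add (PosSemidef.one.smul hs.le)).det_nonneg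

theorem dmat_apply (K : ConvexBody (En n)) (u : En n) (i j : Fin n) :
    dmat K u i j = (fderiv ℝ (proj K) u (EuclideanSpace.single j 1)) i := by
  have := congrFun (dmat_mulVec K u (EuclideanSpace.single j 1)) i
  rw [← this]
  simp

theorem dmat_meas (K : ConvexBody (En n)) : Measurable (dmat K) := by
  refine measurable_pi_lambda _ fun i => measurable_pi_lambda _ fun j => ?_
  simp only [dmat_apply]
  have h := measurable_fderiv_apply_const ℝ (proj K) (EuclideanSpace.single j (1:ℝ))
  have h2 : Measurable fun x : En n => x i := (EuclideanSpace.proj (𝕜 := ℝ) i).continuous.measurable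
  exact h2.comp h

theorem meas_det {α : Type*} [MeasurableSpace α] {f : α → Matrix (Fin n) (Fin n) ℝ}
    (hf : ∀ i j, Measurable fun x => f x i j) : Measurable fun x => (f x).det := by
  simp only [det_apply]
  refine Finset.measurable_sum _ fun σ _ => ?_
  refine Measurable.const_smul ?_ _
  exact Finset.measurable_prod _ fun i _ => hf _ _

theorem meas_entry {α : Type*} [MeasurableSpace α] {f : α → Matrix (Fin n) (Fin n) ℝ}
    (hf : Measurable f) (i j : Fin n) : Measurable fun x => f x i j :=
  (measurable_pi_apply j).comp ((measurable_pi_apply i).comp hf)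

theorem meas_of_entry {α : Type*} [MeasurableSpace α] {f : α → Matrix (Fin n) (Fin n) ℝ}
    (hf : ∀ i j, Measurable fun x => f x i j) : Measurable f :=
  measurable_pi_lambda _ fun i => measurable_pi_lambda _ fun j => hf i j

theorem meas_mul {α : Type*} [MeasurableSpace α] {f g : α → Matrix (Fin n) (Fin n) ℝ}
    (hf : Measurable f) (hg : Measurable g) : Measurable fun x => f x * g x := by
  refine meas_of_entry fun i j => ?_
  simp only [mul_apply]
  exact Finset.measurable_sum _ fun k _ => (meas_entry hf _ _).mul (meas_entry hg _ _)

theorem meas_transpose {α : Type*} [MeasurableSpace α] {f : α → Matrix (Fin n) (Fin n) ℝ}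
    (hf : Measurable f) : Measurable fun x => (f x)ᵀ :=
  meas_of_entry fun i j => meas_entry hf j i

theorem meas_add {α : Type*} [MeasurableSpace α] {f g : α → Matrix (Fin n) (Fin n) ℝ}
    (hf : Measurable f) (hg : Measurable g) : Measurable fun x => f x + g x :=
  meas_of_entry fun i j => (meas_entry hf i j).add (meas_entry hg i j)

theorem meas_minor {α : Type*} [MeasurableSpace α] {f : α → Matrix (Fin n) (Fin n) ℝ}
    (s : Finset (Fin n)) (hf : Measurable f) : Measurable fun x => minor s (f x) := by
  refine meas_det fun i j => ?_
  simp only [pw, of_apply]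
  split_ifs
  · exact measurable_const
  · exact meas_entry hf i j

theorem meas_es {α : Type*} [MeasurableSpace α] {f : α → Matrix (Fin n) (Fin n) ℝ}
    (m : ℕ) (hf : Measurable f) : Measurable fun x => es m (f x) :=
  Finset.measurable_sum _ fun s _ => meas_minor s hf

/-- the underlying matrix -/
def mat (g : SO n) : Matrix (Fin n) (Fin n) ℝ := g.1.1

theorem mat_meas : Measurable (mat : SO n → _) := 
  measurable_subtype_coe.comp measurable_subtype_coe

theorem mat_mul (g h : SO n) : mat (g * h) = mat g * mat h := rfl

theorem mat_mul_t (g : SO n) : mat g * (mat g)ᵀ = 1 := by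
  have := (mem_unitaryGroup_iff (A := mat g)).1 g.1.2
  rwa [star_eq_conjTranspose, conjTranspose_eq_transpose_of_trivial] at this

theorem mat_t_mul (g : SO n) : (mat g)ᵀ * mat g = 1 := mul_eq_one_comm.1 (mat_mul_t g)

theorem mat_inv (g : SO n) : mat g⁻¹ = (mat g)ᵀ := by
  have h : mat g⁻¹ * mat g = 1 := by rw [← mat_mul, inv_mul_cancel]; rfl
  calc mat g⁻¹ = mat g⁻¹ * (mat g * (mat g)ᵀ) := by rw [mat_mul_t, Matrix.mul_one]
    _ = (mat g)ᵀ := by rw [← Matrix.mul_assoc, h, Matrix.one_mul]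

theorem soAct_ofLp (g : SO n) (x : En n) : (soAct g x).ofLp = mat g *ᵥ x.ofLp := by
  simp only [soAct, toLpLin_apply]; rfl

theorem soAct_mul (g h : SO n) (x : En n) : soAct (g * h) x = soAct g (soAct h x) := by
  apply WithLp.ofLp_injective 2
  rw [soAct_ofLp, soAct_ofLp, soAct_ofLp, mat_mul, mulVec_mulVec]

theorem soAct_one (x : En n) : soAct (1 : SO n) x = x := by
  apply WithLp.ofLp_injective 2
  rw [soAct_ofLp, show mat (1 : SO n) = 1 from rfl, one_mulVec]

theorem inner_eq (x y : En n) : inner ℝ x y = x.ofLp ⬝ᵥ y.ofLp := by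
  rw [EuclideanSpace.inner_eq_star_dotProduct, dotProduct_comm]; simp

theorem soAct_inner (g : SO n) (x y : En n) : inner ℝ (soAct g x) (soAct g y) = (inner ℝ x y : ℝ) := by
  rw [inner_eq, inner_eq, soAct_ofLp, soAct_ofLp, dotProduct_mulVec, vecMul_mulVec, ← dotProduct_mulVec,
    mat_t_mul, one_mulVec]

/-- the action as an isometry -/
def act (g : SO n) : En n ≃ₗᵢ[ℝ] En n where
  toLinearEquiv := LinearEquiv.ofLinearMap (soAct g) (soAct g⁻¹)
    (by ext1 x; simp [← soAct_mul, soAct_one]) (by ext1 x; simp [← soAct_mul, soAct_one])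
  norm_map' x := by
    have := soAct_inner g x x
    rw [real_inner_self_eq_norm_sq, real_inner_self_eq_norm_sq] at this
    exact (sq_eq_sq₀ (norm_nonneg _) (norm_nonneg _)).1 this

theorem act_apply (g : SO n) (x : En n) : act g x = soAct g x := rfl
theorem act_symm_apply (g : SO n) (x : En n) : (act g).symm x = soAct g⁻¹ x := rfl

theorem proj_map (g : SO n) (L : ConvexBody (En n)) (u : En n) : 
    proj (mapBody (soAct g) L) u = act g (proj L ((act g).symm u)) := by
  refine proj_unique _ _ _ ⟨_, proj_mem L _, rfl⟩ ?_
  rintro _ ⟨y, hy, rfl⟩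
  have h := proj_inner L ((act g).symm u) hy
  have hu : u = act g ((act g).symm u) := by simp
  rw [← act_apply]
  nth_rewrite 1 [hu]
  rw [← map_sub, ← map_sub, LinearIsometryEquiv.inner_map_map]
  exact h

theorem dmat_map (g : SO n) (L : ConvexBody (En n)) (u : En n) :
    dmat (mapBody (soAct g) L) u = mat g * dmat L ((act g).symm u) * (mat g)ᵀ := by
  apply Matrix.toEuclideanLin.injective
  rw [dmat_lin]
  have h0 : proj (mapBody (soAct g) L) = act g ∘ (proj L ∘ (act g).symm) := by
    ext1 u; exact proj_map g L u
  have h1 : fderiv ℝ (proj (mapBody (soAct g) L)) u = ((act g : En n ≃L[ℝ] En n) : En n →L[ℝ] En n).comp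
      ((fderiv ℝ (proj L) ((act g).symm u)).comp 
        (((act g).symm : En n ≃L[ℝ] En n) : En n →L[ℝ] En n)) := by
    rw [h0]
    rw [LinearIsometryEquiv.comp_fderiv]
    congr 1
    exact ContinuousLinearEquiv.comp_right_fderiv ((act g).symm : En n ≃L[ℝ] En n)
  rw [h1]
  ext1 x
  apply WithLp.ofLp_injective 2
  rw [toLpLin_apply]
  simp only [← mulVec_mulVec]
  rw [← mat_inv]
  have h2 := dmat_mulVec L ((act g).symm u) (soAct g⁻¹ x)
  rw [soAct_ofLp] at h2
  rw [h2, ← soAct_ofLp]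
  rfl

/-- translate of a body -/
def tr (b : En n) (L : ConvexBody (En n)) : ConvexBody (En n) where
  carrier := (fun x => x - b) '' (L : Set (En n))
  convex' := by
    have := L.convex.translate (-b)
    simpa [sub_eq_neg_add] using this
  isCompact' := L.isCompact.image (by fun_prop)
  nonempty' := L.nonempty.image _

theorem tr_coe (b : En n) (L : ConvexBody (En n)) : 
    (tr b L : Set (En n)) = (fun x => x - b) '' (L : Set (En n)) := rfl

theorem proj_tr (b : En n) (L : ConvexBody (En n)) (u : En n) : proj (tr b L) u = proj L (u + b) - b := by
  refine proj_unique _ _ _ ⟨_, proj_mem L _, rfl⟩ ?_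
  rintro _ ⟨y, hy, rfl⟩
  have h := proj_inner L (u + b) hy
  rw [show u - (proj L (u + b) - b) = u + b - proj L (u + b) by abel]
  simp only [sub_sub_sub_cancel_right]
  exact h

theorem dmat_tr (b : En n) (L : ConvexBody (En n)) (u : En n) : dmat (tr b L) u = dmat L (u + b) := by
  have h0 : proj (tr b L) = fun u => proj L (u + b) - b := by ext1 u; exact proj_tr b L u
  rw [dmat, dmat, h0, fderiv_sub_const, fderiv_comp_add_right]

theorem vol_tr (g : SO n) (b : En n) (K L : ConvexBody (En n)) :
    volume ((K : Set (En n)) + (mapBody (soAct g) (tr b L) : Set (En n))) = 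
      volume ((K : Set (En n)) + (mapBody (soAct g) L : Set (En n))) := by
  have : (K : Set (En n)) + (mapBody (soAct g) (tr b L) : Set (En n)) = 
    (fun x => x + -(soAct g b)) '' ((K : Set (En n)) + (mapBody (soAct g) L : Set (En n))) := by
    ext x
    constructor
    · rintro ⟨k, hk, _, ⟨_, ⟨l, hl, rfl⟩, rfl⟩, rfl⟩
      refine ⟨_, ⟨k, hk, _, ⟨l, hl, rfl⟩, rfl⟩, ?_⟩
      simp only [map_sub]; abel
    · rintro ⟨_, ⟨k, hk, _, ⟨l, hl, rfl⟩, rfl⟩, rfl⟩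
      refine ⟨k, hk, _, ⟨_, ⟨l, hl, rfl⟩, rfl⟩, ?_⟩
      simp only [map_sub]; abel
  rw [this, Set.image_add_right, measure_preimage_add_right]

theorem vol_key (g : SO n) (b : En n) (K L : ConvexBody (En n)) :
    volume ((K : Set (En n)) + (mapBody (soAct g) L : Set (En n))) = 
      ∫⁻ u, ENNReal.ofReal (dmat K u + mat g * dmat L ((act g).symm u + b) * (mat g)ᵀ).det := by
  rw [← vol_tr g b, vol_sum']
  simp only [dmat_map, dmat_tr]

end AKF

/-! ### Averaging over the rotation group -/

namespace AKF

open Matrix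

variable {k : ℕ}

/-- the last `m` indices -/
def lastSet (k m : ℕ) : Finset (Fin (k + 2)) := Finset.univ.filter fun i => k + 2 ≤ i.1 + m

theorem card_lastSet {m : ℕ} (hm : m ≤ k + 2) : (lastSet k m).card = m := by
  let f : Fin m → Fin (k + 2) := fun i => ⟨k + 2 - m + i.1, by omega⟩
  have hf : Function.Injective f := fun i j h => by
    have h' := congrArg Fin.val h
    simp only [f] at h'
    exact Fin.ext (by omega)
  have h : (lastSet k m) = (Finset.univ : Finset (Fin m)).image f := by
    ext i
    simp only [lastSet, Finset.mem_filter, Finset.mem_univ, true_and, Finset.mem_image]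
    constructor
    · intro h
      exact ⟨⟨i.1 - (k + 2 - m), by omega⟩, Fin.ext (by simp only [f]; omega)⟩
    · rintro ⟨a, rfl⟩
      simp only [f]; omega
  rw [h, Finset.card_image_of_injective _ hf, Finset.card_univ, Fintype.card_fin]

theorem exists_perm (s : Finset (Fin (k + 2))) (i0 : Fin (k + 2)) :
    ∃ τ : Equiv.Perm (Fin (k + 2)), (∀ i, τ i ∈ lastSet k s.card ↔ i ∈ s) ∧ (i0 ∉ s → τ i0 = 0) := by
  have hc : s.card ≤ k + 2 := by simpa using s.card_le_univ
  have hS := card_lastSet hc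
  let e : {x // x ∈ s} ≃ {x // x ∈ lastSet k s.card} := Finset.equivOfCardEq hS.symm
  let τ0 : Equiv.Perm (Fin (k + 2)) := e.extendSubtype
  have h0 : ∀ i, τ0 i ∈ lastSet k s.card ↔ i ∈ s := by
    intro i
    constructor
    · intro h
      by_contra hi
      exact e.extendSubtype_not_mem i hi h
    · intro hi
      exact e.extendSubtype_mem i hi
  by_cases hi : i0 ∈ s
  · exact ⟨τ0, h0, fun h => absurd hi h⟩
  · have hlt : s.card < k + 2 := by
      have := Finset.card_lt_univ_of_notMem hi
      simpa using this
    have hz : (0 : Fin (k + 2)) ∉ lastSet k s.card := by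
      simp [lastSet]; omega
    have hti : τ0 i0 ∉ lastSet k s.card := fun h => hi ((h0 _).1 h)
    refine ⟨τ0.trans (Equiv.swap (τ0 i0) 0), fun i => ?_, fun _ => by simp⟩
    rw [← h0 i, Equiv.trans_apply]
    by_cases h1 : τ0 i = τ0 i0
    · rw [h1, Equiv.swap_apply_left]
      exact ⟨fun h => absurd h hz, fun h => absurd h hti⟩
    · by_cases h2 : τ0 i = 0
      · rw [h2, Equiv.swap_apply_right]
        exact ⟨fun h => absurd h hti, fun h => absurd h hz⟩
      · rw [Equiv.swap_apply_of_ne_of_ne h1 h2]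

/-- first basis vector -/
def e0 (k : ℕ) : En (k + 2) := EuclideanSpace.single 0 1

theorem exists_rot {Q : Matrix (Fin (k + 2)) (Fin (k + 2)) ℝ} (hQ : Q * Qᵀ = 1)
    (s : Finset (Fin (k + 2))) (i0 : Fin (k + 2)) (v : En (k + 2))
    (hv : ∀ j, j ≠ i0 → (Qᵀ *ᵥ v.ofLp) j = 0) (hs : v ≠ 0 → i0 ∉ s) :
    ∃ h : SO (k + 2), soAct h v = ‖v‖ • e0 k ∧
      ∀ M, minor (lastSet k s.card) (mat h * M * (mat h)ᵀ) = minor s (Qᵀ * M * Q) := by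
  obtain ⟨τ, hτ, hτ0⟩ := exists_perm s i0
  set h0 : Matrix (Fin (k + 2)) (Fin (k + 2)) ℝ := Qᵀ.submatrix τ.symm id with hh0
  have hQ2 : Qᵀ * Q = 1 := mul_eq_one_comm.1 hQ
  have h0o : h0 * h0ᵀ = 1 := by
    rw [hh0, transpose_submatrix, transpose_transpose]
    have h := submatrix_mul_equiv Qᵀ Q τ.symm (Equiv.refl _) τ.symm
    rw [hQ2, submatrix_one_equiv] at h
    exact h
  have hdet : h0.det * h0.det = 1 := by
    have := congrArg det h0o
    rwa [det_mul, det_transpose, det_one] at this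
  set c := (Qᵀ *ᵥ v.ofLp) i0 with hc
  set ε : ℝ := if c < 0 then -1 else 1 with hε
  have hεε : ε * ε = 1 := by rw [hε]; split_ifs <;> norm_num
  have hεc : ε * c = |c| := by
    rw [hε]; split_ifs with h
    · rw [abs_of_neg h]; ring
    · rw [abs_of_nonneg (not_lt.1 h)]; ring
  set d : Fin (k + 2) → ℝ := fun j => if j = 0 then ε else if j = 1 then ε * h0.det else 1 with hd
  have hdd : ∀ j, d j * d j = 1 := by
    intro j
    simp only [hd]
    split_ifs
    · exact hεε
    · calc ε * h0.det * (ε * h0.det) = (ε * ε) * (h0.det * h0.det) := by ring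
        _ = 1 := by rw [hεε, hdet, one_mul]
    · norm_num
  have hdp : ∏ j, d j = h0.det := by
    rw [Fin.prod_univ_succ, Fin.prod_univ_succ]
    have : ∀ i : Fin k, d i.succ.succ = 1 := by
      intro i
      have h2 : (i.succ.succ : Fin (k + 2)) ≠ 1 := by
        intro h
        have := congrArg Fin.val h
        simp at this
      simp only [hd, Fin.succ_ne_zero, if_false, h2]
    simp only [this, Finset.prod_const_one, mul_one]
    simp only [hd, if_true, Fin.succ_zero_eq_one, one_ne_zero, if_false]
    rw [← mul_assoc, hεε, one_mul]
  set H : Matrix (Fin (k + 2)) (Fin (k + 2)) ℝ := of fun i j => d i * h0 i j with hH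
  have hHD : H = Matrix.diagonal d * h0 := by
    ext i j; simp [hH, diagonal_mul]
  have hHo : H * Hᵀ = 1 := by
    rw [hHD, transpose_mul, diagonal_transpose, Matrix.mul_assoc, ← Matrix.mul_assoc h0, h0o,
      Matrix.one_mul, diagonal_mul_diagonal, ← diagonal_one]
    congr 1; ext i; exact hdd i
  have hHdet : H.det = 1 := by
    rw [hHD, det_mul, det_diagonal, hdp, hdet]
  let h : SO (k + 2) := ⟨⟨H, mem_unitaryGroup_iff.2 (by
    rw [star_eq_conjTranspose, conjTranspose_eq_transpose_of_trivial]; exact hHo)⟩, hHdet⟩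
  have hmat : mat h = H := rfl
  refine ⟨h, ?_, fun M => ?_⟩
  · have h1 : ∀ j, (soAct h v) j = d j * (Qᵀ *ᵥ v.ofLp) (τ.symm j) := by
      intro j
      change (soAct h v).ofLp j = _
      rw [soAct_ofLp, hmat, hHD, ← mulVec_mulVec, mulVec_diagonal]
      congr 1
    by_cases hv0 : v = 0
    · simp [hv0]
    · have ht := hτ0 (hs hv0)
      have h2 : soAct h v = |c| • e0 k := by
        ext j
        rw [h1]
        by_cases hj : j = 0
        · rw [hj, ← ht, Equiv.symm_apply_apply, ht]
          simp only [hd, if_true, e0]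
          simpa using hεc
        · rw [hv]
          · simp [e0, hj]
          · intro hji
            apply hj
            rw [← ht, ← hji, Equiv.apply_symm_apply]
      have h3 : ‖v‖ = |c| := by
        rw [← (act h).norm_map v, act_apply, h2, norm_smul]
        simp [e0]
      rw [h2, h3]
  · set N := Qᵀ * M * Q with hN
    have h1 : mat h * M * (mat h)ᵀ = of fun i j => d i * (d j * N (τ.symm i) (τ.symm j)) := by
      have : h0 * M * h0ᵀ = N.submatrix τ.symm τ.symm := by
        rw [hN, hh0, transpose_submatrix, transpose_transpose]
        ext i j
        simp [mul_apply, submatrix]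
      rw [hmat, hHD, transpose_mul, diagonal_transpose]
      rw [show Matrix.diagonal d * h0 * M * (h0ᵀ * Matrix.diagonal d) = 
        Matrix.diagonal d * (h0 * M * h0ᵀ) * Matrix.diagonal d by simp only [Matrix.mul_assoc], this]
      ext i j
      simp [diagonal_mul, mul_diagonal]; ring
    have h2 : pw (lastSet k s.card) (mat h * M * (mat h)ᵀ) = 
        of fun i j => d i * (of fun i j => d j * (pw s N).submatrix τ.symm τ.symm i j) i j := by
      rw [h1]
      ext i j
      have hi := hτ (τ.symm i)
      rw [Equiv.apply_symm_apply] at hi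
      simp only [pw, of_apply, submatrix_apply]
      by_cases his : τ.symm i ∈ s
      · rw [if_pos his, if_pos (hi.2 his)]
        by_cases hij : i = j
        · subst hij; simp [hdd]
        · simp [hij]
      · rw [if_neg his, if_neg (fun h => his (hi.1 h))]
    rw [minor, h2, det_mul_column, det_mul_row, det_submatrix_equiv_self, minor, ← mul_assoc, hdp, hdet,
      one_mul]

theorem meas_mul_left (h : SO k) : Measurable fun g : SO k => h * g := by
  refine Measurable.subtype_mk (Measurable.subtype_mk ?_)
  exact meas_mul measurable_const mat_meas

theorem lint_left (ν : Measure (SO k)) [ν.IsMulLeftInvariant] (h : SO k) {f : SO k → ℝ≥0∞}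
    (hf : Measurable f) : ∫⁻ g, f (h * g) ∂ν = ∫⁻ g, f g ∂ν := by
  conv_rhs => rw [← map_mul_left_eq_self ν h]
  rw [lintegral_map hf (meas_mul_left h)]

theorem meas_actinv {α : Type*} [MeasurableSpace α] {f : α → SO k} {x : α → En k} (hf : Measurable f)
    (hx : Measurable x) : Measurable fun a => soAct (f a)⁻¹ (x a) := by
  have h1 : (fun a => soAct (f a)⁻¹ (x a)) = fun a => WithLp.toLp 2 ((mat (f a))ᵀ *ᵥ (x a).ofLp) := by
    ext1 a
    apply WithLp.ofLp_injective 2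
    rw [soAct_ofLp, mat_inv]
  rw [h1]
  refine (PiLp.continuous_toLp 2 _).measurable.comp ?_
  refine measurable_pi_lambda _ fun i => ?_
  simp only [mulVec, dotProduct]
  refine Finset.measurable_sum _ fun j _ => ?_
  refine (meas_entry (meas_transpose (mat_meas.comp hf)) i j).mul ?_
  exact (EuclideanSpace.proj (𝕜 := ℝ) j).continuous.measurable.comp hx

/-- the averaged coefficient -/
def cc (ν : Measure (SO (k + 2))) (φ : En (k + 2) → ℝ≥0∞) (B : Matrix (Fin (k + 2)) (Fin (k + 2)) ℝ) 
    (m : ℕ) (r : ℝ) : ℝ≥0∞ :=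
  ∫⁻ g, φ (soAct g⁻¹ (r • e0 k)) * ENNReal.ofReal (minor (lastSet k m) (mat g * B * (mat g)ᵀ)) ∂ν

theorem averaging (ν : Measure (SO (k + 2))) [ν.IsMulLeftInvariant] {φ : En (k + 2) → ℝ≥0∞} 
    (hφ : Measurable φ) {A B : Matrix (Fin (k + 2)) (Fin (k + 2)) ℝ} (hA : A.PosSemidef) 
    (hB : B.PosSemidef) (v : En (k + 2)) (hv : A *ᵥ v.ofLp = 0) :
    ∫⁻ g, φ (soAct g⁻¹ v) * ENNReal.ofReal (A + mat g * B * (mat g)ᵀ).det ∂ν = 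
      ∑ m ∈ Finset.range (k + 2 + 1), cc ν φ B m ‖v‖ * ENNReal.ofReal (es m A) := by
  obtain ⟨Q, a, hQ, ha, hAQ, hi⟩ := exists_good_basis hA v.ofLp hv
  have hQ2 : Qᵀ * Q = 1 := mul_eq_one_comm.1 hQ
  have hd : Q.det * Qᵀ.det = 1 := by rw [← det_mul, hQ, det_one]
  have hpsd : ∀ g : SO (k + 2), (mat g * B * (mat g)ᵀ).PosSemidef := fun g => by
    have := hB.mul_mul_conjTranspose_same (mat g)
    rwa [conjTranspose_eq_transpose_of_trivial] at this
  have hpsd2 : ∀ g : SO (k + 2), (Qᵀ * (mat g * B * (mat g)ᵀ) * Q).PosSemidef := fun g => by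
    have := (hpsd g).conjTranspose_mul_mul_same Q
    rwa [conjTranspose_eq_transpose_of_trivial] at this
  have hdet : ∀ g : SO (k + 2), (A + mat g * B * (mat g)ᵀ).det = 
      ∑ s : Finset (Fin (k + 2)), (∏ i ∈ s, a i) * minor s (Qᵀ * (mat g * B * (mat g)ᵀ) * Q) := by
    intro g
    rw [← det_diag_add]
    have : A + mat g * B * (mat g)ᵀ = 
        Q * (Matrix.diagonal a + Qᵀ * (mat g * B * (mat g)ᵀ) * Q) * Qᵀ := by
      rw [Matrix.mul_add, Matrix.add_mul, ← hAQ]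
      congr 1
      calc mat g * B * (mat g)ᵀ = (Q * Qᵀ) * (mat g * B * (mat g)ᵀ) * (Q * Qᵀ) := by rw [hQ]; simp
        _ = _ := by simp only [Matrix.mul_assoc]
    rw [this, det_mul, det_mul, mul_right_comm, hd, one_mul]
  have hmB : Measurable fun g : SO (k + 2) => mat g * B * (mat g)ᵀ :=
    meas_mul (meas_mul mat_meas measurable_const) (meas_transpose mat_meas)
  have hI : ∀ s : Finset (Fin (k + 2)), 
      ENNReal.ofReal (∏ i ∈ s, a i) * ∫⁻ g, φ (soAct g⁻¹ v) * 
        ENNReal.ofReal (minor s (Qᵀ * (mat g * B * (mat g)ᵀ) * Q)) ∂ν =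
      ENNReal.ofReal (∏ i ∈ s, a i) * cc ν φ B s.card ‖v‖ := by
    intro s
    have hi0 : ∃ i0, (∀ j, j ≠ i0 → (Qᵀ *ᵥ v.ofLp) j = 0) ∧ (v ≠ 0 → a i0 = 0) := by
      by_cases hv0 : v = 0
      · exact ⟨0, by simp [hv0], fun h => absurd hv0 h⟩
      · obtain ⟨i, h1, h2⟩ := hi (fun h => hv0 (WithLp.ofLp_injective 2 h))
        exact ⟨i, h2, fun _ => h1⟩
    obtain ⟨i0, h1, h2⟩ := hi0
    by_cases hbad : v ≠ 0 ∧ i0 ∈ s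
    · rw [Finset.prod_eq_zero hbad.2 (h2 hbad.1)]; simp
    · obtain ⟨h, hhv, hhM⟩ := exists_rot hQ s i0 v h1 (fun h h' => hbad ⟨h, h'⟩)
      congr 1
      refine Eq.trans ?_ (lint_left ν h ?_)
      · refine lintegral_congr fun g => ?_
        congr 2
        · rw [_root_.mul_inv_rev, soAct_mul, ← hhv, ← soAct_mul h⁻¹, inv_mul_cancel, soAct_one]
        · rw [← hhM, mat_mul, transpose_mul]
          simp only [Matrix.mul_assoc]
      · exact (hφ.comp (meas_actinv measurable_id measurable_const)).mul 
          (ENNReal.measurable_ofReal.comp (meas_minor _ hmB))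
  have hsplit : ∀ g : SO (k + 2), φ (soAct g⁻¹ v) * ENNReal.ofReal (A + mat g * B * (mat g)ᵀ).det = 
      ∑ s : Finset (Fin (k + 2)), ENNReal.ofReal (∏ i ∈ s, a i) * (φ (soAct g⁻¹ v) * 
        ENNReal.ofReal (minor s (Qᵀ * (mat g * B * (mat g)ᵀ) * Q))) := by
    intro g
    rw [hdet, ENNReal.ofReal_sum_of_nonneg, Finset.mul_sum]
    · refine Finset.sum_congr rfl fun s _ => ?_
      rw [ENNReal.ofReal_mul (Finset.prod_nonneg fun i _ => ha i)]
      ring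
    · intro s _
      exact mul_nonneg (Finset.prod_nonneg fun i _ => ha i) (minor_nonneg s (hpsd2 g))
  have hms : ∀ s, Measurable fun g : SO (k + 2) => φ (soAct g⁻¹ v) * 
        ENNReal.ofReal (minor s (Qᵀ * (mat g * B * (mat g)ᵀ) * Q)) := fun s =>
    (hφ.comp (meas_actinv measurable_id measurable_const)).mul 
      (ENNReal.measurable_ofReal.comp (meas_minor _ 
        (meas_mul (meas_mul measurable_const hmB) measurable_const)))
  simp only [hsplit]
  rw [lintegral_finsetSum _ (fun s _ => (hms s).const_mul _)]
  simp only [lintegral_const_mul _ (hms _), hI]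
  rw [sum_by_card]
  refine Finset.sum_congr rfl fun m hm => ?_
  rw [es_conj hQ hAQ m (by simp at hm; omega), ENNReal.ofReal_sum_of_nonneg, Finset.mul_sum]
  · refine Finset.sum_congr rfl fun s hs => ?_
    simp only [Finset.mem_filter] at hs
    rw [hs.2, mul_comm]
  · intro s _
    exact Finset.prod_nonneg fun i _ => ha i

end AKF

/-! ### The averaged double integral -/

namespace AKF

open Matrix

variable {n k : ℕ}

/-- indicator of a ball -/
def ind (ρ : ℝ) (x : En n) : ℝ≥0∞ := (ball (0 : En n) ρ).indicator (fun _ => (1 : ℝ≥0∞)) x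

theorem ind_meas (ρ : ℝ) : Measurable (ind ρ : En n → ℝ≥0∞) :=
  measurable_const.indicator measurableSet_ball

theorem ind_le {ρ σ : ℝ} {x y : En n} (h : ‖x‖ < ρ → ‖y‖ < σ) : ind ρ x ≤ ind σ y := by
  unfold ind
  by_cases hx : x ∈ ball (0 : En n) ρ
  · have hy : y ∈ ball (0 : En n) σ := by
      rw [mem_ball_zero_iff] at *; exact h hx
    rw [indicator_of_mem hx, indicator_of_mem hy]
  · rw [indicator_of_notMem hx]; exact zero_le

/-- density -/
def D (K L : ConvexBody (En n)) (g : SO n) (u w : En n) : ℝ≥0∞ :=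
  ENNReal.ofReal (dmat K u + mat g * dmat L w * (mat g)ᵀ).det

theorem D_meas (K L : ConvexBody (En n)) {α : Type*} [MeasurableSpace α] {g : α → SO n} {u w : α → En n}
    (hg : Measurable g) (hu : Measurable u) (hw : Measurable w) : 
    Measurable fun a => D K L (g a) (u a) (w a) := by
  refine ENNReal.measurable_ofReal.comp (meas_det (meas_entry ?_))
  refine meas_add ((dmat_meas K).comp hu) ?_
  exact meas_mul (meas_mul (mat_meas.comp hg) ((dmat_meas L).comp hw)) (meas_transpose (mat_meas.comp hg))

/-- volume of the rotated sum -/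
def sumVol (K L : ConvexBody (En n)) (g : SO n) : ℝ≥0∞ := 
  volume ((K : Set (En n)) + (mapBody (soAct g) L : Set (En n)))

theorem sumVol_eq (K L : ConvexBody (En n)) (g : SO n) (b : En n) : 
    sumVol K L g = ∫⁻ u, D K L g u (soAct g⁻¹ u + b) := vol_key g b K L

theorem sumVol_meas (K L : ConvexBody (En n)) : Measurable (sumVol K L) := by
  have h : sumVol K L = fun g => ∫⁻ u, D K L g u (soAct g⁻¹ u + 0) := by
    ext1 g; exact sumVol_eq K L g 0
  rw [h]
  have h2 : Measurable fun p : SO n × En n => D K L p.1 p.2 (soAct p.1⁻¹ p.2 + 0) :=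
    D_meas K L measurable_fst measurable_snd ((meas_actinv measurable_fst measurable_snd).add_const 0)
  exact h2.lintegral_prod_right'

theorem ball_V (K L : ConvexBody (En n)) (g : SO n) (ρ : ℝ) : 
    volume (ball (0 : En n) ρ) * sumVol K L g = ∫⁻ u, ∫⁻ w, ind ρ (w - soAct g⁻¹ u) * D K L g u w := by
  have h1 : volume (ball (0 : En n) ρ) = ∫⁻ b, ind ρ (b : En n) := by
    unfold ind
    rw [lintegral_indicator_const measurableSet_ball, one_mul]
  rw [h1, ← lintegral_mul_const _ (ind_meas ρ)]
  have h2 : ∀ b : En n, ind ρ b * sumVol K L g = ∫⁻ u, ind ρ b * D K L g u (soAct g⁻¹ u + b) := by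
    intro b
    rw [sumVol_eq K L g b, lintegral_const_mul]
    exact D_meas K L measurable_const measurable_id 
      ((meas_actinv measurable_const measurable_id).add_const b)
  simp only [h2]
  rw [lintegral_lintegral_swap]
  · refine lintegral_congr fun u => ?_
    rw [← lintegral_add_left_eq_self (fun w => ind ρ (w - soAct g⁻¹ u) * D K L g u w) (soAct g⁻¹ u)]
    refine lintegral_congr fun b => ?_
    rw [add_sub_cancel_left]
  · refine Measurable.aemeasurable ?_
    refine ((ind_meas ρ).comp measurable_fst).mul ?_
    exact D_meas K L measurable_const measurable_snd 
      ((meas_actinv measurable_const measurable_snd).add measurable_fst)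

/-- the modified integral -/
def q (K L : ConvexBody (En n)) (R : ℝ) (g : SO n) : ℝ≥0∞ :=
  ∫⁻ u, ∫⁻ w, ind R (w - soAct g⁻¹ (nrm K u)) * D K L g u w

theorem norm_soAct (g : SO n) (x : En n) : ‖soAct g x‖ = ‖x‖ := (act g).norm_map x

theorem q_lower (K L : ConvexBody (En n)) {C R : ℝ} (hC : ∀ x ∈ (K : Set (En n)), ‖x‖ ≤ C) (g : SO n) :
    volume (ball (0 : En n) (R - C)) * sumVol K L g ≤ q K L R g := by
  rw [ball_V]
  refine lintegral_mono fun u => lintegral_mono fun w => ?_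
  refine mul_le_mul_left (ind_le fun h => ?_) _
  have h1 : w - soAct g⁻¹ (nrm K u) = (w - soAct g⁻¹ u) + soAct g⁻¹ (proj K u) := by
    rw [nrm, map_sub]; abel
  rw [h1]
  have h2 := norm_add_le (w - soAct g⁻¹ u) (soAct g⁻¹ (proj K u))
  rw [norm_soAct] at h2
  have h3 := hC _ (proj_mem K u)
  linarith

theorem q_upper (K L : ConvexBody (En n)) {C R : ℝ} (hC : ∀ x ∈ (K : Set (En n)), ‖x‖ ≤ C) (g : SO n) :
    q K L R g ≤ volume (ball (0 : En n) (R + C)) * sumVol K L g := by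
  rw [ball_V]
  refine lintegral_mono fun u => lintegral_mono fun w => ?_
  refine mul_le_mul_left (ind_le fun h => ?_) _
  have h1 : w - soAct g⁻¹ u = (w - soAct g⁻¹ (nrm K u)) - soAct g⁻¹ (proj K u) := by
    rw [nrm, map_sub]; abel
  rw [h1]
  have h2 := norm_sub_le (w - soAct g⁻¹ (nrm K u)) (soAct g⁻¹ (proj K u))
  rw [norm_soAct] at h2
  have h3 := hC _ (proj_mem K u)
  linarith

/-- pushforward of curvature measures to the radial variable -/
def M (K : ConvexBody (En n)) (m : ℕ) : Measure ℝ :=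
  (volume.withDensity fun u => ENNReal.ofReal (es m (dmat K u))).map fun u => ‖nrm K u‖

theorem nn_meas (K : ConvexBody (En n)) : Measurable fun u => ‖nrm K u‖ := (nrm_cont K).norm.measurable

theorem es_meas (K : ConvexBody (En n)) (m : ℕ) : 
    Measurable fun u => ENNReal.ofReal (es m (dmat K u)) :=
  ENNReal.measurable_ofReal.comp (meas_es m (dmat_meas K))

theorem lint_M (K : ConvexBody (En n)) (m : ℕ) {f : ℝ → ℝ≥0∞} (hf : Measurable f) :
    ∫⁻ r, f r ∂(M K m) = ∫⁻ u, f ‖nrm K u‖ * ENNReal.ofReal (es m (dmat K u)) := by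
  rw [M, lintegral_map hf (nn_meas K)]
  refine (lintegral_withDensity_eq_lintegral_mul _ (es_meas K m) (hf.comp (nn_meas K))).trans ?_
  refine lintegral_congr fun u => ?_
  rw [Pi.mul_apply, mul_comm]; rfl

theorem M_Iic (K : ConvexBody (En n)) (m : ℕ) (r : ℝ) :
    M K m (Iic r) = ∫⁻ u in {u | ‖nrm K u‖ ≤ r}, ENNReal.ofReal (es m (dmat K u)) := by
  rw [M, Measure.map_apply (nn_meas K) measurableSet_Iic, withDensity_apply _ 
    (nn_meas K measurableSet_Iic)]
  rfl

theorem M_scale (K : ConvexBody (En n)) {s : ℝ} (hs : 0 < s) (hs1 : s < 1) (r : ℝ) :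
    volume {u | ‖nrm K u‖ ≤ s * r} = 
      ∑ m ∈ Finset.range (n + 1), ENNReal.ofReal ((1 - s) ^ m * s ^ (n - m)) * M K m (Iic r) := by
  rw [vol_scale' K hs hs1]
  have h0 : 0 < 1 - s := by linarith
  have h1 : ∀ m, 0 ≤ (1 - s) ^ m * s ^ (n - m) := fun m => by positivity
  have h2 : ∀ u, ENNReal.ofReal ((1 - s) • dmat K u + s • (1 : Matrix (Fin n) (Fin n) ℝ)).det = 
      ∑ m ∈ Finset.range (n + 1), ENNReal.ofReal ((1 - s) ^ m * s ^ (n - m)) * 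
        ENNReal.ofReal (es m (dmat K u)) := by
    intro u
    rw [det_comb _ _ h0.ne', ENNReal.ofReal_sum_of_nonneg]
    · refine Finset.sum_congr rfl fun m _ => ?_
      rw [ENNReal.ofReal_mul (h1 m)]
    · intro m _
      exact mul_nonneg (h1 m) (es_nonneg m (dmat_psd K u))
  simp only [h2, M_Iic]
  rw [lintegral_finsetSum _ fun m _ => (es_meas K m).const_mul _]
  simp only [lintegral_const_mul _ (es_meas K _)]

/-- the integrated coefficient -/
def Cm (ν : Measure (SO (k + 2))) (L : ConvexBody (En (k + 2))) (R : ℝ) (m : ℕ) (r : ℝ) : ℝ≥0∞ :=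
  ∫⁻ w, cc ν (fun y => ind R (w - y)) (dmat L w) m r

theorem cc_meas (ν : Measure (SO (k + 2))) [IsProbabilityMeasure ν] (L : ConvexBody (En (k + 2))) (R : ℝ) (m : ℕ) :
    Measurable fun p : ℝ × En (k + 2) => cc ν (fun y => ind R (p.2 - y)) (dmat L p.2) m p.1 := by
  unfold cc
  have h : Measurable fun p : (ℝ × En (k + 2)) × SO (k + 2) => 
      ind R (p.1.2 - soAct p.2⁻¹ (p.1.1 • e0 k)) * 
        ENNReal.ofReal (minor (lastSet k m) (mat p.2 * dmat L p.1.2 * (mat p.2)ᵀ)) := by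
    refine Measurable.mul ?_ ?_
    · refine (ind_meas R).comp ?_
      refine measurable_fst.snd.sub (meas_actinv measurable_snd ?_)
      exact measurable_fst.fst.smul_const _
    · refine ENNReal.measurable_ofReal.comp (meas_minor _ ?_)
      exact meas_mul (meas_mul (mat_meas.comp measurable_snd) ((dmat_meas L).comp measurable_fst.snd)) 
        (meas_transpose (mat_meas.comp measurable_snd))
  exact h.lintegral_prod_right'

theorem Cm_meas (ν : Measure (SO (k + 2))) [IsProbabilityMeasure ν] (L : ConvexBody (En (k + 2))) (R : ℝ) (m : ℕ) :
    Measurable (Cm ν L R m) :=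
  (cc_meas ν L R m).lintegral_prod_right'


theorem cc_meas' (ν : Measure (SO (k + 2))) [IsProbabilityMeasure ν] (L : ConvexBody (En (k + 2))) (R : ℝ) (m : ℕ) (r : ℝ) :
    Measurable fun w => cc ν (fun y => ind R (w - y)) (dmat L w) m r := by
  unfold cc
  have h : Measurable fun p : En (k + 2) × SO (k + 2) => 
      ind R (p.1 - soAct p.2⁻¹ (r • e0 k)) * 
        ENNReal.ofReal (minor (lastSet k m) (mat p.2 * dmat L p.1 * (mat p.2)ᵀ)) := by
    refine Measurable.mul ?_ ?_
    · refine (ind_meas R).comp ?_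
      exact measurable_fst.sub (meas_actinv measurable_snd measurable_const)
    · refine ENNReal.measurable_ofReal.comp (meas_minor _ ?_)
      exact meas_mul (meas_mul (mat_meas.comp measurable_snd) ((dmat_meas L).comp measurable_fst)) 
        (meas_transpose (mat_meas.comp measurable_snd))
  exact h.lintegral_prod_right'

theorem q_avg0 (ν : Measure (SO (k + 2))) [IsProbabilityMeasure ν] (L : ConvexBody (En (k + 2))) (R : ℝ) 
    (r : ℝ) (c : ℕ → ℝ≥0∞) :
    ∫⁻ w, ∑ m ∈ Finset.range (k + 2 + 1), cc ν (fun y => ind R (w - y)) (dmat L w) m r * c m =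
    ∑ m ∈ Finset.range (k + 2 + 1), Cm ν L R m r * c m := by
  rw [lintegral_finsetSum _ fun m _ => (cc_meas' ν L R m r).mul_const _]
  refine Finset.sum_congr rfl fun m _ => ?_
  rw [lintegral_mul_const _ (cc_meas' ν L R m r), Cm]

theorem q_avg1 (ν : Measure (SO (k + 2))) [IsProbabilityMeasure ν] [ν.IsMulLeftInvariant] 
    (K L : ConvexBody (En (k + 2))) (R : ℝ) (u : En (k + 2)) : 
    ∫⁻ w, ∫⁻ g, ind R (w - soAct g⁻¹ (nrm K u)) * D K L g u w ∂ν = 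
        ∑ m ∈ Finset.range (k + 2 + 1), Cm ν L R m ‖nrm K u‖ * ENNReal.ofReal (es m (dmat K u)) := by
  rw [← q_avg0 ν L R ‖nrm K u‖ (fun m => ENNReal.ofReal (es m (dmat K u)))]
  refine lintegral_congr fun w => ?_
  have h5 : Measurable fun y : En (k + 2) => ind R (w - y) := 
    (ind_meas R).comp (measurable_const.sub measurable_id)
  exact averaging ν h5 (dmat_psd K u) (dmat_psd L w) (nrm K u) (dmat_nrm K u)

theorem q_swap (ν : Measure (SO n)) [IsProbabilityMeasure ν] (K L : ConvexBody (En n)) (R : ℝ) :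
    ∫⁻ g, q K L R g ∂ν = ∫⁻ u, ∫⁻ w, ∫⁻ g, ind R (w - soAct g⁻¹ (nrm K u)) * D K L g u w ∂ν := by
  have hF : Measurable fun p : (SO n × En n) × En n => 
      ind R (p.2 - soAct p.1.1⁻¹ (nrm K p.1.2)) * D K L p.1.1 p.1.2 p.2 := by
    refine Measurable.mul ?_ (D_meas K L measurable_fst.fst measurable_fst.snd measurable_snd)
    refine (ind_meas R).comp (measurable_snd.sub (meas_actinv measurable_fst.fst ?_))
    exact (nrm_cont K).measurable.comp measurable_fst.snd
  have hF2 : ∀ u : En n, Measurable fun p : SO n × En n => 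
      ind R (p.2 - soAct p.1⁻¹ (nrm K u)) * D K L p.1 u p.2 := by
    intro u
    refine Measurable.mul ?_ (D_meas K L measurable_fst measurable_const measurable_snd)
    exact (ind_meas R).comp (measurable_snd.sub (meas_actinv measurable_fst measurable_const))
  have h1 : Measurable fun p : SO n × En n => 
      ∫⁻ w, ind R (w - soAct p.1⁻¹ (nrm K p.2)) * D K L p.1 p.2 w := hF.lintegral_prod_right'
  unfold q
  rw [lintegral_lintegral_swap h1.aemeasurable]
  refine lintegral_congr fun u => ?_
  exact lintegral_lintegral_swap (hF2 u).aemeasurable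

theorem q_avg (ν : Measure (SO (k + 2))) [IsProbabilityMeasure ν] [ν.IsMulLeftInvariant] 
    (K L : ConvexBody (En (k + 2))) (R : ℝ) :
    ∫⁻ g, q K L R g ∂ν = ∑ m ∈ Finset.range (k + 2 + 1), ∫⁻ r, Cm ν L R m r ∂(M K m) := by
  rw [q_swap, lintegral_congr fun u => q_avg1 ν K L R u]
  have h : ∀ m, Measurable fun u => Cm ν L R m ‖nrm K u‖ * ENNReal.ofReal (es m (dmat K u)) :=
    fun m => ((Cm_meas ν L R m).comp (nn_meas K)).mul (es_meas K m)
  rw [lintegral_finsetSum _ fun m _ => h m]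
  refine Finset.sum_congr rfl fun m _ => ?_
  rw [lint_M K m (Cm_meas ν L R m)]

end AKF

/-! ### The key identity -/

namespace AKF

open Matrix

variable {n k : ℕ}

theorem sub_fin (K : ConvexBody (En n)) (r : ℝ) : volume {u | ‖nrm K u‖ ≤ r} ≠ ⊤ := by
  obtain ⟨C, hC⟩ := K.isBounded.exists_norm_le
  have h : {u | ‖nrm K u‖ ≤ r} ⊆ closedBall (0 : En n) (r + C) := by
    intro u hu
    rw [mem_closedBall_zero_iff]
    have h1 : u = nrm K u + proj K u := by rw [nrm]; abel
    rw [h1]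
    have h2 := norm_add_le (nrm K u) (proj K u)
    have h3 := hC _ (proj_mem K u)
    have h4 : ‖nrm K u‖ ≤ r := hu
    linarith
  exact ((measure_mono h).trans_lt measure_closedBall_lt_top).ne

theorem M_fin (K : ConvexBody (En n)) {m : ℕ} (hm : m ≤ n) (r : ℝ) : M K m (Iic r) ≠ ⊤ := by
  intro h
  have h1 := M_scale K (s := 1 / 2) (by norm_num) (by norm_num) r
  have h2 := sub_fin K (1 / 2 * r)
  rw [h1] at h2
  have h3 := (ENNReal.sum_ne_top.1 h2) m (by simp; omega)
  rw [h, ENNReal.mul_top] at h3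
  · exact h3 rfl
  · rw [Ne, ENNReal.ofReal_eq_zero, not_le]; positivity

theorem M_scale_real (K : ConvexBody (En n)) {x : ℝ} (hx : 0 < x) (r : ℝ) :
    (1 + x) ^ n * (volume {u | ‖nrm K u‖ ≤ x / (1 + x) * r}).toReal = 
      ∑ m ∈ Finset.range (n + 1), x ^ (n - m) * (M K m (Iic r)).toReal := by
  have h0 : 0 < 1 + x := by linarith
  have h1 : 1 - x / (1 + x) = 1 / (1 + x) := by field_simp; ring
  rw [M_scale K (s := x / (1 + x)) (by positivity) (by rw [div_lt_one h0]; linarith) r,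
    ENNReal.toReal_sum, Finset.mul_sum]
  · refine Finset.sum_congr rfl fun m hm => ?_
    have hm' : m ≤ n := by simp at hm; omega
    rw [ENNReal.toReal_mul, ENNReal.toReal_ofReal (by rw [h1]; positivity), h1, ← mul_assoc]
    congr 1
    have : (1 + x) ^ n = (1 + x) ^ m * (1 + x) ^ (n - m) := by rw [← pow_add]; congr 1; omega
    rw [this, div_pow, div_pow, one_pow]
    field_simp
  · intro m hm
    exact ENNReal.mul_ne_top ENNReal.ofReal_ne_top (M_fin K (by simp at hm; omega) r)

theorem M_neg (K : ConvexBody (En n)) (m : ℕ) {r : ℝ} (hr : r < 0) : M K m (Iic r) = 0 := by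
  rw [M_Iic]
  have : {u | ‖nrm K u‖ ≤ r} = ∅ := by
    ext u
    simp only [Set.mem_ofPred_eq, mem_empty_iff_false, iff_false, not_le]
    exact hr.trans_le (norm_nonneg _)
  rw [this]; simp

theorem M_eq {ι : Type*} [Fintype ι] (K : ι → ConvexBody (En n)) (p q : ι → NNReal)
    (h : ∀ r : ℝ, 0 ≤ r → ∑ j, (p j : ℝ) * (volume {u | ‖nrm (K j) u‖ ≤ r}).toReal = 
      ∑ j, (q j : ℝ) * (volume {u | ‖nrm (K j) u‖ ≤ r}).toReal) {m : ℕ} (hm : m ≤ n) :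
    ∑ j, (p j) • M (K j) m = ∑ j, (q j) • M (K j) m := by
  have hval : ∀ (p : ι → NNReal) (s : Set ℝ), (∑ j, (p j) • M (K j) m) s = 
      ∑ j, (p j : ℝ≥0∞) * M (K j) m s := by
    intro p s
    rw [Measure.finsetSum_apply]
    rfl
  have hfin : ∀ (p : ι → NNReal) (r : ℝ), ∑ j, (p j : ℝ≥0∞) * M (K j) m (Iic r) ≠ ⊤ := by
    intro p r
    rw [ENNReal.sum_ne_top]
    exact fun j _ => ENNReal.mul_ne_top ENNReal.coe_ne_top (M_fin _ hm r)
  refine Measure.ext_of_generateFrom_of_iUnion (range Iic) (fun i : ℕ => Iic (i : ℝ)) ?_ isPiSystem_Iic ?_ 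
    (fun i => ⟨_, rfl⟩) ?_ ?_
  · rw [← borel_eq_generateFrom_Iic]; exact BorelSpace.measurable_eq
  · rw [iUnion_eq_univ_iff]
    intro x
    obtain ⟨N, hN⟩ := exists_nat_ge x
    exact ⟨N, hN⟩
  · intro i
    rw [hval]
    exact hfin p _
  · rintro _ ⟨r, rfl⟩
    rw [hval, hval]
    by_cases hr : r < 0
    · simp [M_neg _ _ hr]
    · rw [not_lt] at hr
      rw [← ENNReal.toReal_eq_toReal_iff' (hfin p r) (hfin q r)]
      have key : ∀ (p : ι → NNReal) (m : ℕ), m ≤ n → 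
          (∑ j, (p j : ℝ≥0∞) * M (K j) m (Iic r)).toReal = 
          ∑ j, (p j : ℝ) * (M (K j) m (Iic r)).toReal := by
        intro p m hm
        rw [ENNReal.toReal_sum]
        · simp
        · exact fun j _ => ENNReal.mul_ne_top ENNReal.coe_ne_top (M_fin _ hm r)
      rw [key p m hm, key q m hm]
      refine poly_unique' n (fun m => ∑ j, (p j : ℝ) * (M (K j) m (Iic r)).toReal) 
        (fun m => ∑ j, (q j : ℝ) * (M (K j) m (Iic r)).toReal) (fun x hx => ?_) m hm
      have hc : ∀ p : ι → NNReal, ∑ m ∈ Finset.range (n + 1), x ^ (n - m) * 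
          ∑ j, (p j : ℝ) * (M (K j) m (Iic r)).toReal = (1 + x) ^ n * 
            ∑ j, (p j : ℝ) * (volume {u | ‖nrm (K j) u‖ ≤ x / (1 + x) * r}).toReal := by
        intro p
        simp only [Finset.mul_sum]
        rw [Finset.sum_comm]
        refine Finset.sum_congr rfl fun j _ => ?_
        rw [mul_left_comm, M_scale_real _ hx, Finset.mul_sum]
        exact Finset.sum_congr rfl fun m _ => by ring
      rw [hc, hc, h _ (by positivity)]

/-- averaged volume -/
def F (ν : Measure (SO n)) (K L : ConvexBody (En n)) : ℝ≥0∞ := ∫⁻ g, sumVol K L g ∂ν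

theorem sumVol_le (K L : ConvexBody (En n)) : ∃ c : NNReal, ∀ g, sumVol K L g ≤ c := by
  obtain ⟨C, hC⟩ := K.isBounded.exists_norm_le
  obtain ⟨C', hC'⟩ := L.isBounded.exists_norm_le
  refine ⟨(volume (closedBall (0 : En n) (C + C'))).toNNReal, fun g => ?_⟩
  rw [ENNReal.coe_toNNReal measure_closedBall_lt_top.ne]
  refine measure_mono ?_
  rintro _ ⟨x, hx, _, ⟨y, hy, rfl⟩, rfl⟩
  rw [mem_closedBall_zero_iff]
  refine (norm_add_le _ _).trans (add_le_add (hC x hx) ?_)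
  rw [norm_soAct]
  exact hC' y hy

theorem F_fin (ν : Measure (SO n)) [IsProbabilityMeasure ν] (K L : ConvexBody (En n)) : F ν K L ≠ ⊤ := by
  obtain ⟨c, hc⟩ := sumVol_le K L
  have : F ν K L ≤ ∫⁻ _, c ∂ν := lintegral_mono hc
  rw [lintegral_const, measure_univ, mul_one] at this
  exact (this.trans_lt ENNReal.coe_lt_top).ne

theorem key_le (ν : Measure (SO (k + 2))) [IsProbabilityMeasure ν] [ν.IsMulLeftInvariant]
    {ι : Type*} [Fintype ι] (K : ι → ConvexBody (En (k + 2))) (L : ConvexBody (En (k + 2))) (p p' : ι → NNReal)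
    (h : ∀ r : ℝ, 0 ≤ r → ∑ j, (p j : ℝ) * (volume {u | ‖nrm (K j) u‖ ≤ r}).toReal = 
      ∑ j, (p' j : ℝ) * (volume {u | ‖nrm (K j) u‖ ≤ r}).toReal) :
    ∑ j, (p j : ℝ) * (F ν (K j) L).toReal ≤ ∑ j, (p' j : ℝ) * (F ν (K j) L).toReal := by
  have hq : ∀ R, ∑ j, (p j : ℝ≥0∞) * ∫⁻ g, q (K j) L R g ∂ν = ∑ j, (p' j : ℝ≥0∞) * ∫⁻ g, q (K j) L R g ∂ν := by
    intro R
    have hp : ∀ p : ι → NNReal, ∑ j, (p j : ℝ≥0∞) * ∫⁻ g, q (K j) L R g ∂ν = 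
        ∑ m ∈ Finset.range (k + 2 + 1), ∫⁻ r, Cm ν L R m r ∂(∑ j, (p j) • M (K j) m) := by
      intro p
      simp only [q_avg, Finset.mul_sum]
      rw [Finset.sum_comm]
      refine Finset.sum_congr rfl fun m _ => ?_
      rw [lintegral_finsetSum_measure]
      refine Finset.sum_congr rfl fun j _ => ?_
      rw [lintegral_smul_measure]
      rfl
    rw [hp, hp]
    refine Finset.sum_congr rfl fun m hm => ?_
    rw [M_eq K p p' h (by simp at hm; omega)]
  have hCex : ∃ C : ℝ, 0 < C ∧ ∀ j, ∀ x ∈ (K j : Set (En (k + 2))), ‖x‖ ≤ C := by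
    choose C hC using fun j => (K j).isBounded.exists_norm_le
    refine ⟨1 + ∑ j, |C j|, by positivity, fun j x hx => ?_⟩
    have h1 := hC j x hx
    have h2 : |C j| ≤ ∑ j, |C j| := Finset.single_le_sum (f := fun j => |C j|) (fun _ _ => abs_nonneg _) 
      (Finset.mem_univ j)
    have h3 := le_abs_self (C j)
    linarith
  obtain ⟨C, hC0, hC⟩ := hCex
  have hlow : ∀ R j, volume (ball (0 : En (k + 2)) (R - C)) * F ν (K j) L ≤ ∫⁻ g, q (K j) L R g ∂ν := by
    intro R j
    rw [F, ← lintegral_const_mul _ (sumVol_meas _ _)]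
    exact lintegral_mono fun g => q_lower _ _ (hC j) g
  have hup : ∀ R j, ∫⁻ g, q (K j) L R g ∂ν ≤ volume (ball (0 : En (k + 2)) (R + C)) * F ν (K j) L := by
    intro R j
    rw [F, ← lintegral_const_mul _ (sumVol_meas _ _)]
    exact lintegral_mono fun g => q_upper _ _ (hC j) g
  set P := ∑ j, (p j : ℝ≥0∞) * F ν (K j) L with hP
  set P' := ∑ j, (p' j : ℝ≥0∞) * F ν (K j) L with hP'
  have hPf : ∀ p : ι → NNReal, ∑ j, (p j : ℝ≥0∞) * F ν (K j) L ≠ ⊤ := fun p => 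
    ENNReal.sum_ne_top.2 fun j _ => ENNReal.mul_ne_top ENNReal.coe_ne_top (F_fin ν _ _)
  have hPr : ∀ p : ι → NNReal, (∑ j, (p j : ℝ≥0∞) * F ν (K j) L).toReal = 
      ∑ j, (p j : ℝ) * (F ν (K j) L).toReal := by
    intro p
    rw [ENNReal.toReal_sum fun j _ => ENNReal.mul_ne_top ENNReal.coe_ne_top (F_fin ν _ _)]
    simp
  rw [← hPr, ← hPr, ← hP, ← hP']
  have hR : ∀ R, volume (ball (0 : En (k + 2)) (R - C)) * P ≤ volume (ball (0 : En (k + 2)) (R + C)) * P' := by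
    intro R
    calc volume (ball (0 : En (k + 2)) (R - C)) * P = 
          ∑ j, (p j : ℝ≥0∞) * (volume (ball (0 : En (k + 2)) (R - C)) * F ν (K j) L) := by
          rw [hP, Finset.mul_sum]; exact Finset.sum_congr rfl fun j _ => by ring
      _ ≤ ∑ j, (p j : ℝ≥0∞) * ∫⁻ g, q (K j) L R g ∂ν := 
          Finset.sum_le_sum fun j _ => mul_le_mul_right (hlow R j) _
      _ = ∑ j, (p' j : ℝ≥0∞) * ∫⁻ g, q (K j) L R g ∂ν := hq R
      _ ≤ ∑ j, (p' j : ℝ≥0∞) * (volume (ball (0 : En (k + 2)) (R + C)) * F ν (K j) L) := 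
          Finset.sum_le_sum fun j _ => mul_le_mul_right (hup R j) _
      _ = _ := by
          rw [hP', Finset.mul_sum]; exact Finset.sum_congr rfl fun j _ => by ring
  set b := (volume (ball (0 : En (k + 2)) 1)).toReal with hb
  have hbpos : 0 < b := ENNReal.toReal_pos (measure_ball_pos _ _ one_pos).ne' measure_ball_lt_top.ne
  have hball : ∀ ρ : ℝ, 0 < ρ → (volume (ball (0 : En (k + 2)) ρ)).toReal = ρ ^ (k + 2) * b := by
    intro ρ hρ
    rw [Measure.addHaar_ball_of_pos _ _ hρ, ENNReal.toReal_mul, 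
      ENNReal.toReal_ofReal (by positivity), finrank_euclideanSpace, Fintype.card_fin]
  have hreal : ∀ R, C < R → (R - C) ^ (k + 2) * P.toReal ≤ (R + C) ^ (k + 2) * P'.toReal := by
    intro R hRC
    have h1 := hR R
    have h2 : (volume (ball (0 : En (k + 2)) (R - C)) * P).toReal ≤ 
        (volume (ball (0 : En (k + 2)) (R + C)) * P').toReal := 
      ENNReal.toReal_mono (ENNReal.mul_ne_top measure_ball_lt_top.ne (hPf p')) h1
    rw [ENNReal.toReal_mul, ENNReal.toReal_mul, hball _ (by linarith), hball _ (by linarith)] at h2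
    have h3 : b * ((R - C) ^ (k + 2) * P.toReal) ≤ b * ((R + C) ^ (k + 2) * P'.toReal) := by linarith
    exact le_of_mul_le_mul_left h3 hbpos
  have hδ : ∀ δ : ℝ, 0 < δ → δ < 1 → (1 - δ) ^ (k + 2) * P.toReal ≤ (1 + δ) ^ (k + 2) * P'.toReal := by
    intro δ h0 h1
    have h2 : C < C / δ := by rw [lt_div_iff₀ h0]; nlinarith
    have h3 := hreal (C / δ) h2
    have h4 : C / δ - C = C / δ * (1 - δ) := by field_simp
    have h5 : C / δ + C = C / δ * (1 + δ) := by field_simp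
    rw [h4, h5, mul_pow, mul_pow, mul_assoc, mul_assoc] at h3
    exact le_of_mul_le_mul_left h3 (by positivity)
  have hc1 : Filter.Tendsto (fun δ : ℝ => (1 - δ) ^ (k + 2) * P.toReal) (nhdsWithin 0 (Ioi 0)) 
      (nhds ((1 - 0) ^ (k + 2) * P.toReal)) := by
    refine Filter.Tendsto.mono_left ?_ nhdsWithin_le_nhds
    exact Continuous.tendsto (by fun_prop) 0
  have hc2 : Filter.Tendsto (fun δ : ℝ => (1 + δ) ^ (k + 2) * P'.toReal) (nhdsWithin 0 (Ioi 0)) 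
      (nhds ((1 + 0) ^ (k + 2) * P'.toReal)) := by
    refine Filter.Tendsto.mono_left ?_ nhdsWithin_le_nhds
    exact Continuous.tendsto (by fun_prop) 0
  have hfinal := le_of_tendsto_of_tendsto hc1 hc2 (by
    filter_upwards [Ioo_mem_nhdsGT (show (0:ℝ) < 1 by norm_num)] with δ hδ'
    exact hδ δ hδ'.1 hδ'.2)
  simpa using hfinal

theorem key_eq (ν : Measure (SO (k + 2))) [IsProbabilityMeasure ν] [ν.IsMulLeftInvariant]
    {ι : Type*} [Fintype ι] (K : ι → ConvexBody (En (k + 2))) (L : ConvexBody (En (k + 2))) (a : ι → ℝ)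
    (h : ∀ r : ℝ, 0 ≤ r → ∑ j, a j * (volume {u | ‖nrm (K j) u‖ ≤ r}).toReal = 0) :
    ∑ j, a j * (F ν (K j) L).toReal = 0 := by
  have hdec : ∀ j, a j = ((a j).toNNReal : ℝ) - ((-(a j)).toNNReal : ℝ) := by
    intro j
    rw [Real.coe_toNNReal', Real.coe_toNNReal']
    rcases le_total 0 (a j) with h | h
    · rw [max_eq_left h, max_eq_right (by linarith)]; ring
    · rw [max_eq_right h, max_eq_left (by linarith)]; ring
  have hs : ∀ f : ι → ℝ, ∑ j, a j * f j = 
      ∑ j, ((a j).toNNReal : ℝ) * f j - ∑ j, ((-(a j)).toNNReal : ℝ) * f j := by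
    intro f
    rw [← Finset.sum_sub_distrib]
    refine Finset.sum_congr rfl fun j _ => ?_
    rw [← sub_mul, ← hdec]
  have h' : ∀ r : ℝ, 0 ≤ r → ∑ j, ((a j).toNNReal : ℝ) * (volume {u | ‖nrm (K j) u‖ ≤ r}).toReal = 
      ∑ j, ((-(a j)).toNNReal : ℝ) * (volume {u | ‖nrm (K j) u‖ ≤ r}).toReal := by
    intro r hr
    have := h r hr
    rw [hs] at this
    linarith
  rw [hs, sub_eq_zero]
  exact le_antisymm (key_le ν K L _ _ h') (key_le ν K L _ _ fun r hr => (h' r hr).symm)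

end AKF

/-! Part 8: low dimensions, balls. -/
namespace AKF
variable {n k : ℕ}

/-- The body `r • B`. -/
def bl (n : ℕ) (r : ℝ) : ConvexBody (En n) :=
  ⟨r • closedBall (0 : En n) 1, (convex_closedBall _ _).smul r, 
    (isCompact_closedBall _ _).smul r, ⟨r • 0, Set.smul_mem_smul_set (by simp)⟩⟩

theorem bl_coe (r : ℝ) : (bl n r : Set (En n)) = r • closedBall (0 : En n) 1 := rfl

theorem bl_add {r s : ℝ} (hr : 0 ≤ r) (hs : 0 ≤ s) : bl n r + bl n s = bl n (r + s) := by
  apply SetLike.coe_injective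
  rw [ConvexBody.coe_add, bl_coe, bl_coe, bl_coe, (convex_closedBall _ _).add_smul hr hs]

theorem vol_bl {r : ℝ} (hr : 0 ≤ r) : (volume (bl n r : Set (En n))).toReal = r ^ n * ballVol n := by
  rw [bl_coe, Measure.addHaar_smul, ENNReal.toReal_mul, ENNReal.toReal_ofReal (abs_nonneg _),
    finrank_euclideanSpace, Fintype.card_fin, abs_of_nonneg (by positivity)]
  rfl

theorem ballVol_pos (n : ℕ) : 0 < ballVol n := 
  ENNReal.toReal_pos (measure_closedBall_pos _ _ one_pos).ne' measure_closedBall_lt_top.ne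

theorem vol_fin (K : ConvexBody (En n)) : volume (K : Set (En n)) ≠ ⊤ := K.isCompact.measure_lt_top.ne

theorem map_bl (g : SO n) (r : ℝ) : mapBody (soAct g) (bl n r) = bl n r := by
  apply SetLike.coe_injective
  change soAct g '' (r • closedBall (0 : En n) 1) = r • closedBall (0 : En n) 1
  rw [image_smul_set]
  congr 1
  have := (act g).image_closedBall 0 1
  rw [map_zero] at this
  exact this

theorem map_add (g : SO n) (K L : ConvexBody (En n)) : 
    mapBody (soAct g) (K + L) = mapBody (soAct g) K + mapBody (soAct g) L := by
  apply SetLike.coe_injective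
  rw [ConvexBody.coe_add]
  change soAct g '' ((K + L : ConvexBody (En n)) : Set (En n)) = soAct g '' K + soAct g '' L
  rw [ConvexBody.coe_add, Set.image_add]

theorem vol_map (g : SO n) (K : ConvexBody (En n)) : 
    volume (mapBody (soAct g) K : Set (En n)) = volume (K : Set (En n)) := by
  change volume (act g '' (K : Set (En n))) = _
  rw [LinearIsometryEquiv.image_eq_preimage_symm]
  exact (act g).symm.measurePreserving.measure_preimage K.isCompact.measurableSet.nullMeasurableSet

theorem sumVol_body (K L : ConvexBody (En n)) (g : SO n) : 
    sumVol K L g = volume ((K + mapBody (soAct g) L : ConvexBody (En n)) : Set (En n)) := by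
  rw [ConvexBody.coe_add]; rfl

theorem F_bl (ν : Measure (SO n)) [IsProbabilityMeasure ν] (r : ℝ) (L : ConvexBody (En n)) : 
    F ν (bl n r) L = volume ((L + bl n r : ConvexBody (En n)) : Set (En n)) := by
  have : ∀ g, sumVol (bl n r) L g = volume ((L + bl n r : ConvexBody (En n)) : Set (En n)) := by
    intro g
    rw [sumVol_body, ← vol_map g (L + bl n r), map_add, map_bl, add_comm]
  simp [F, this]

theorem key0 (ν : Measure (SO 0)) [IsProbabilityMeasure ν]
    {ι : Type*} [Fintype ι] (K : ι → ConvexBody (En 0)) (L : ConvexBody (En 0)) (a : ι → ℝ)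
    (h : ∀ r : ℝ, 0 ≤ r → ∑ j, a j * (volume ((K j + bl 0 r : ConvexBody (En 0)) : Set (En 0))).toReal = 0) :
    ∑ j, a j * (F ν (K j) L).toReal = 0 := by
  have hu : ∀ K : ConvexBody (En 0), (K : Set (En 0)) = univ := fun K => 
    Subsingleton.eq_univ_of_nonempty K.nonempty
  have := h 0 le_rfl
  simp only [hu] at this
  simpa [F, sumVol_body, hu] using this

theorem key1 (ν : Measure (SO 1)) [IsProbabilityMeasure ν]
    {ι : Type*} [Fintype ι] (K : ι → ConvexBody (En 1)) (L : ConvexBody (En 1)) (a : ι → ℝ)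
    (h : ∀ r : ℝ, 0 ≤ r → ∑ j, a j * (volume ((K j + bl 1 r : ConvexBody (En 1)) : Set (En 1))).toReal = 0) :
    ∑ j, a j * (F ν (K j) L).toReal = 0 := by
  set A : ConvexBody (En 1) → ℝ≥0∞ := fun K => ∫⁻ u, ENNReal.ofReal (dmat K u).det with hA
  have hsum : ∀ K L : ConvexBody (En 1), volume ((K + L : ConvexBody (En 1)) : Set (En 1)) = A K + A L := by
    intro K L
    rw [ConvexBody.coe_add, vol_sum', hA, ← lintegral_add_left]
    · refine lintegral_congr fun u => ?_
      rw [← ENNReal.ofReal_add (dmat_psd K u).det_nonneg (dmat_psd L u).det_nonneg]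
      simp
    · exact (meas_det (meas_entry (dmat_meas K))).ennreal_ofReal
  have hfin : ∀ K, A K ≠ ⊤ := fun K hK => by
    have := hsum K K
    rw [hK, top_add] at this
    exact vol_fin _ this
  have hz : A (bl 1 0) = 0 := by
    have h1 := hsum (bl 1 0) (bl 1 0)
    have h2 : volume ((bl 1 0 + bl 1 0 : ConvexBody (En 1)) : Set (En 1)) = 0 := by
      have := vol_bl (n := 1) (r := 0) le_rfl
      rw [bl_add le_rfl le_rfl, add_zero]
      simp only [pow_one, zero_mul] at this
      exact ((ENNReal.toReal_eq_zero_iff _).1 this).resolve_right (vol_fin _)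
    rw [h2] at h1
    exact (add_eq_zero.1 h1.symm).1
  have hA' : ∀ K, A K = volume (K : Set (En 1)) := by
    intro K
    have h1 := hsum K (bl 1 0)
    rw [hz, add_zero] at h1
    rw [← h1]
    rw [ConvexBody.coe_add, bl_coe, zero_smul_set (nonempty_closedBall.2 zero_le_one), add_zero]
  have hr : ∀ K L : ConvexBody (En 1), (volume ((K + L : ConvexBody (En 1)) : Set (En 1))).toReal = 
      (A K).toReal + (A L).toReal := fun K L => by rw [hsum, ENNReal.toReal_add (hfin _) (hfin _)]
  have hF : ∀ K, (F ν K L).toReal = (A K).toReal + (A L).toReal := by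
    intro K
    rw [← ENNReal.toReal_add (hfin _) (hfin _)]
    congr 1
    have : ∀ g, sumVol K L g = A K + A L := by
      intro g
      rw [sumVol_body, hsum, hA' (mapBody _ _), vol_map, ← hA']
    simp [F, this]
  simp only [hr, mul_add, Finset.sum_add_distrib, ← Finset.sum_mul, hF] at h ⊢
  have h0 := h 0 le_rfl
  have h1 := h 1 zero_le_one
  rw [hz] at h0
  rw [hA' (bl 1 1), vol_bl zero_le_one] at h1
  simp only [ENNReal.toReal_zero, mul_zero, add_zero] at h0
  rw [h0] at h1 ⊢
  have h2 : ∑ j, a j = 0 := by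
    have := (ballVol_pos 1).ne'
    simpa [this] using h1
  rw [h2]; simp

theorem key_all (ν : Measure (SO n)) [IsProbabilityMeasure ν] [ν.IsMulLeftInvariant]
    {ι : Type*} [Fintype ι] (K : ι → ConvexBody (En n)) (L : ConvexBody (En n)) (a : ι → ℝ)
    (h : ∀ r : ℝ, 0 ≤ r → ∑ j, a j * (volume ((K j + bl n r : ConvexBody (En n)) : Set (En n))).toReal = 0) :
    ∑ j, a j * (F ν (K j) L).toReal = 0 := by
  obtain rfl | rfl | ⟨k, rfl⟩ : n = 0 ∨ n = 1 ∨ ∃ k, n = k + 2 := by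
    rcases n with _ | _ | k
    · simp
    · simp
    · exact Or.inr (Or.inr ⟨k, rfl⟩)
  · exact key0 ν K L a h
  · exact key1 ν K L a h
  · refine key_eq ν K L a fun r hr => ?_
    rw [← h r hr]
    refine Finset.sum_congr rfl fun j _ => ?_
    rw [setOf_nrm_le _ hr, ConvexBody.coe_add, bl_coe]

theorem vand (N : ℕ) (c : ℕ → ℝ) : ∃ α : Fin N → ℝ, ∀ k < N, ∑ j, α j * ((j : ℕ) : ℝ) ^ k = c k := by
  set A : Matrix (Fin N) (Fin N) ℝ := (Matrix.vandermonde fun j : Fin N => ((j : ℕ) : ℝ)) with hA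
  have hd : A.det ≠ 0 := by
    rw [hA, Matrix.det_vandermonde_ne_zero_iff]
    intro i j hij
    exact Fin.ext (Nat.cast_injective (R := ℝ) hij)
  have hu : IsUnit A.det := hd.isUnit
  refine ⟨Matrix.vecMul (fun k : Fin N => c k) A⁻¹, fun k hk => ?_⟩
  have : Matrix.vecMul (Matrix.vecMul (fun k : Fin N => c k) A⁻¹) A = fun k : Fin N => c k := by
    rw [Matrix.vecMul_vecMul, Matrix.nonsing_inv_mul _ hu, Matrix.vecMul_one]
  exact congrFun this ⟨k, hk⟩

end AKF

/-! Part 9: final algebra. -/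
namespace AKF
variable {n k : ℕ}

/-- Steiner polynomial with natural number indices. -/
def Steiner (n : ℕ) (m : ℕ → ConvexBody (En n) → ℝ) : Prop :=
  ∀ (K : ConvexBody (En n)) (t : ℝ), 0 ≤ t → (volume ((K + bl n t : ConvexBody (En n)) : Set (En n))).toReal =
    ∑ p ∈ Finset.range (n + 1), m (n - p) K * ballVol p * t ^ p

theorem stepB (m : ℕ → ConvexBody (En n) → ℝ) (hm : Steiner n m) (ν : Measure (SO n)) 
    [IsProbabilityMeasure ν] [ν.IsMulLeftInvariant] (K : ConvexBody (En n)) :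
    ∃ α : Fin (n + 1) → ℝ, (∀ p < n + 1, ∑ j, α j * ((j : ℕ) : ℝ) ^ p = 
      m p K * ballVol (n - p) / (n.choose p * ballVol n)) ∧ ∀ L, 
      (F ν K L).toReal = ∑ j, α j * (volume ((L + bl n (j : ℕ) : ConvexBody (En n)) : Set (En n))).toReal := by
  obtain ⟨α, hα⟩ := vand (n + 1) fun p => m p K * ballVol (n - p) / (n.choose p * ballVol n)
  refine ⟨α, hα, fun L => ?_⟩
  have h := key_all ν (fun o : Option (Fin (n + 1)) => o.elim K (fun j => bl n (j : ℕ))) L 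
    (fun o => o.elim 1 fun j => - α j) ?_
  · simp only [Fintype.sum_option, Option.elim, one_mul, F_bl, neg_mul, Finset.sum_neg_distrib] at h
    linarith
  · intro r hr
    simp only [Fintype.sum_option, Option.elim, one_mul, neg_mul, Finset.sum_neg_distrib]
    rw [hm K r hr]
    have h1 : ∀ j : Fin (n + 1), (volume ((bl n ((j : ℕ) : ℝ) + bl n r : ConvexBody (En n)) : Set (En n))).toReal = 
        ∑ p ∈ Finset.range (n + 1), (n.choose p * ballVol n * r ^ p) * ((j : ℕ) : ℝ) ^ (n - p) := by
      intro j
      rw [bl_add (by positivity) hr, vol_bl (by positivity), add_comm, add_pow, Finset.sum_mul]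
      exact Finset.sum_congr rfl fun p _ => by ring
    simp only [h1, Finset.mul_sum]
    rw [Finset.sum_comm, ← sub_eq_add_neg, sub_eq_zero]
    refine Finset.sum_congr rfl fun p hp => ?_
    have hp' : p ≤ n := by simp at hp; omega
    calc _ = (n.choose p * ballVol n * r ^ p) * 
          (m (n - p) K * ballVol (n - (n - p)) / (n.choose (n - p) * ballVol n)) := by
          rw [Nat.sub_sub_self hp', Nat.choose_symm hp']
          have := (ballVol_pos n).ne'
          have : (n.choose p : ℝ) ≠ 0 := by exact_mod_cast (Nat.choose_pos hp').ne'
          field_simp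
      _ = _ := by
          rw [← hα (n - p) (by omega), Finset.mul_sum]
          exact Finset.sum_congr rfl fun j _ => by ring

theorem stepA (m : ℕ → ConvexBody (En n) → ℝ) (hm : Steiner n m) (ν : Measure (SO n)) 
    [IsProbabilityMeasure ν] (K L : ConvexBody (En n)) (t : ℝ) (ht : 0 ≤ t) : 
    (F ν K (L + bl n t)).toReal = ∑ p ∈ Finset.range (n + 1), 
      ((∫ g, m (n - p) (K + mapBody (soAct g) L) ∂ν) * ballVol p) * t ^ p := by
  have hW : ∀ t, 0 ≤ t → ∀ g, (sumVol K (L + bl n t) g).toReal = 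
      ∑ p ∈ Finset.range (n + 1), m (n - p) (K + mapBody (soAct g) L) * ballVol p * t ^ p := by
    intro t ht g
    rw [sumVol_body, AKF.map_add, map_bl, ← add_assoc, hm _ t ht]
  have hWi : ∀ t, Integrable (fun g => (sumVol K (L + bl n t) g).toReal) ν := by
    intro t
    exact integrable_toReal_of_lintegral_ne_top (sumVol_meas _ _).aemeasurable (F_fin ν _ _)
  have hmi : ∀ p < n + 1, Integrable (fun g => m (n - p) (K + mapBody (soAct g) L)) ν := by
    intro p hp
    obtain ⟨β, hβ⟩ := vand (n + 1) fun q => if q = p then 1 else 0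
    have h1 : ∀ g, m (n - p) (K + mapBody (soAct g) L) = 
        (∑ j : Fin (n + 1), β j * (sumVol K (L + bl n (j : ℕ)) g).toReal) / ballVol p := by
      intro g
      rw [eq_div_iff (ballVol_pos p).ne']
      have h2 : ∀ j : Fin (n + 1), _ := fun j => hW ((j : ℕ) : ℝ) (by positivity) g
      simp only [h2, Finset.mul_sum]
      rw [Finset.sum_comm]
      have h3 : ∀ q ∈ Finset.range (n + 1), ∑ j : Fin (n + 1), 
          β j * (m (n - q) (K + mapBody (soAct g) L) * ballVol q * ((j : ℕ) : ℝ) ^ q) = 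
          (m (n - q) (K + mapBody (soAct g) L) * ballVol q) * if q = p then 1 else 0 := by
        intro q hq
        rw [← hβ q (by simpa using hq), Finset.mul_sum]
        exact Finset.sum_congr rfl fun j _ => by ring
      rw [Finset.sum_congr rfl h3]
      simp [hp]
    simp only [h1]
    exact (integrable_finsetSum _ fun j _ => (hWi _).const_mul _).div_const _
  rw [F, ← integral_toReal (sumVol_meas _ _).aemeasurable]
  · simp only [hW t ht]
    rw [integral_finsetSum]
    · refine Finset.sum_congr rfl fun p _ => ?_
      rw [integral_mul_const, integral_mul_const]
    · intro p hp
      exact ((hmi p (by simpa using hp)).mul_const _).mul_const _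
  · obtain ⟨c, hc⟩ := sumVol_le K (L + bl n t)
    exact Filter.Eventually.of_forall fun g => (hc g).trans_lt ENNReal.coe_lt_top

theorem stepC (m : ℕ → ConvexBody (En n) → ℝ) (hm : Steiner n m) (ν : Measure (SO n)) 
    [IsProbabilityMeasure ν] [ν.IsMulLeftInvariant] (K L : ConvexBody (En n)) (p : ℕ) (hp : p < n + 1) : 
    (∫ g, m (n - p) (K + mapBody (soAct g) L) ∂ν) * ballVol p = ∑ q ∈ Finset.range (n + 1), 
      m (n - q) L * ballVol q * q.choose p * 
        (m (q - p) K * ballVol (n - (q - p)) / (n.choose (q - p) * ballVol n)) := by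
  obtain ⟨α, hα, hF⟩ := stepB m hm ν K
  refine poly_unique (n + 1) (fun p => (∫ g, m (n - p) (K + mapBody (soAct g) L) ∂ν) * ballVol p)
    (fun p => ∑ q ∈ Finset.range (n + 1), 
      m (n - q) L * ballVol q * q.choose p * 
        (m (q - p) K * ballVol (n - (q - p)) / (n.choose (q - p) * ballVol n))) ?_ p hp
  intro t ht
  rw [← stepA m hm ν K L t ht.le, hF]
  have h1 : ∀ j : Fin (n + 1), (volume ((L + bl n t + bl n ((j : ℕ) : ℝ) : ConvexBody (En n)) : 
      Set (En n))).toReal = ∑ q ∈ Finset.range (n + 1), ∑ p ∈ Finset.range (n + 1), 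
        (m (n - q) L * ballVol q * q.choose p * t ^ p) * ((j : ℕ) : ℝ) ^ (q - p) := by
    intro j
    rw [add_assoc, bl_add ht.le (by positivity), hm _ _ (by positivity)]
    refine Finset.sum_congr rfl fun q hq => ?_
    rw [add_pow, Finset.mul_sum]
    have hs : Finset.range (q + 1) ⊆ Finset.range (n + 1) := Finset.range_mono (by simp at hq; omega)
    rw [← Finset.sum_subset hs]
    · exact Finset.sum_congr rfl fun p _ => by ring
    · intro p _ h
      rw [Nat.choose_eq_zero_of_lt (by simp at h; omega)]
      simp
  simp only [h1, Finset.mul_sum, Finset.sum_mul]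
  rw [Finset.sum_comm]
  rw [Finset.sum_comm (s := Finset.range (n + 1)) (t := Finset.range (n + 1))]
  refine Finset.sum_congr rfl fun q hq => ?_
  rw [Finset.sum_comm]
  refine Finset.sum_congr rfl fun p _ => ?_
  rw [← hα (q - p) (by simp at hq; omega), Finset.mul_sum, Finset.sum_mul]
  exact Finset.sum_congr rfl fun j _ => by ring

theorem choose_id (a k l : ℕ) : 
    (2 * a + k + l).choose a * (a + k + l).choose k = (a + k).choose a * (2 * a + k + l).choose (a + l) := by
  have h1 := Nat.add_choose_mul_factorial_mul_factorial (a + k + l) a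
  have h2 := Nat.add_choose_mul_factorial_mul_factorial (a + l) k
  have h3 := Nat.add_choose_mul_factorial_mul_factorial k a
  have h4 := Nat.add_choose_mul_factorial_mul_factorial (a + k) (a + l)
  rw [show a + k + l + a = 2 * a + k + l by ring] at h1
  rw [show a + l + k = a + k + l by ring] at h2
  rw [show k + a = a + k by ring] at h3
  rw [show a + k + (a + l) = 2 * a + k + l by ring] at h4
  have hpos : 0 < a.factorial * k.factorial * (a + l).factorial := by positivity
  apply Nat.eq_of_mul_eq_mul_right hpos
  calc _ = (2 * a + k + l).choose a * 
        ((a + k + l).choose k * (a + l).factorial * k.factorial) * a.factorial := by ring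
    _ = (2 * a + k + l).choose (a + l) *  
        ((a + k).choose a * k.factorial * a.factorial) * (a + l).factorial := by rw [h2, h1, h3, h4]
    _ = _ := by ring

theorem flag_id (n k l : ℕ) (h : k + l ≤ n) : 
    flagCoeff (2 * n - (k + l)) (n - (k + l)) * (flagCoeff (2 * n - (k + l)) (n - k))⁻¹ * ballVol (n - (k + l)) = 
      ballVol (n - l) * (n - l).choose (n - (k + l)) * (ballVol (n - k) / (n.choose k * ballVol n)) := by
  obtain ⟨a, rfl⟩ := Nat.exists_eq_add_of_le' h
  have e1 : 2 * (a + (k + l)) - (k + l) = 2 * a + k + l := by omega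
  have e2 : a + (k + l) - (k + l) = a := by omega
  have e3 : a + (k + l) - k = a + l := by omega
  have e4 : a + (k + l) - l = a + k := by omega
  have e5 : 2 * a + k + l - a = a + k + l := by omega
  have e6 : 2 * a + k + l - (a + l) = a + k := by omega
  rw [e1, e2, e3, e4, flagCoeff, flagCoeff, e5, e6, ← add_assoc]
  have hc : ((2 * a + k + l).choose a : ℝ) * (a + k + l).choose k = 
    (a + k).choose a * (2 * a + k + l).choose (a + l) := by exact_mod_cast choose_id a k l
  have p1 := (ballVol_pos a).ne'
  have p2 := (ballVol_pos (2 * a + k + l)).ne'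
  have p3 := (ballVol_pos (a + k + l)).ne'
  have p4 := (ballVol_pos (a + k)).ne'
  have p5 := (ballVol_pos (a + l)).ne'
  have q1 : ((2 * a + k + l).choose (a + l) : ℝ) ≠ 0 := by 
    exact_mod_cast (Nat.choose_pos (by omega)).ne'
  have q2 : ((a + k + l).choose k : ℝ) ≠ 0 := by 
    exact_mod_cast (Nat.choose_pos (by omega)).ne'
  field_simp
  linear_combination hc

theorem final (n i : ℕ) (hi : i ≤ n) (hin : i < n + 1)
    (μ : Fin (n + 1) → ConvexBody (En n) → ℝ) (hμ : SteinerFamily n μ)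
    (ν : Measure (SO n)) [IsProbabilityMeasure ν] [ν.IsMulLeftInvariant]
    (K L : ConvexBody (En n)) :
    (∫ g : SO n, μ ⟨i, hin⟩ (K + mapBody (soAct g) L) ∂ν) =
      flagCoeff (2 * n - i) (n - i) * ∑ k : Fin (n + 1), ∑ l : Fin (n + 1),
        if (k : ℕ) + (l : ℕ) = i then (flagCoeff (2 * n - i) (n - (k : ℕ)))⁻¹ * μ k K * μ l L else 0 := by
  set m : ℕ → ConvexBody (En n) → ℝ := fun k K => if h : k < n + 1 then μ ⟨k, h⟩ K else 0 with hmdef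
  have hmμ : ∀ k : Fin (n + 1), ∀ K, μ k K = m k K := by
    intro k K
    rw [hmdef]
    simp only [k.2, dif_pos]
  have hm : Steiner n m := by
    intro K t ht
    rw [ConvexBody.coe_add, bl_coe, hμ K t ht, Finset.sum_range]
    refine Finset.sum_congr rfl fun k _ => ?_
    rw [hmμ, Fin.val_rev]
    congr 3
    rw [Nat.add_sub_add_right]
  have hC := stepC m hm ν K L (n - i) (by omega)
  rw [Nat.sub_sub_self hi] at hC
  have hω := (ballVol_pos (n - i)).ne'
  apply mul_right_cancel₀ hω
  simp only [hmμ]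
  rw [hC, Finset.sum_comm, ← Finset.sum_range (n := n + 1) (f := fun l => ∑ k : Fin (n + 1), 
    if (k : ℕ) + l = i then (flagCoeff (2 * n - i) (n - (k : ℕ)))⁻¹ * m k K * m l L else 0),
    ← Finset.sum_range_reflect, Finset.mul_sum, Finset.sum_mul]
  refine Finset.sum_congr rfl fun l hl => ?_
  have hl' : l ≤ n := by simp at hl; omega
  have e1 : n + 1 - 1 - l = n - l := by omega
  rw [e1, Nat.sub_sub_self hl', ← Finset.sum_range (n := n + 1) (f := fun k => 
    if k + l = i then (flagCoeff (2 * n - i) (n - k))⁻¹ * m k K * m l L else 0)]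
  by_cases hli : l ≤ i
  · obtain ⟨k, rfl⟩ := Nat.exists_eq_add_of_le' hli
    have e2 : n - l - (n - (k + l)) = k := by omega
    rw [e2, Finset.sum_eq_single k]
    · rw [if_pos rfl]
      linear_combination (-(m k K * m l L)) * flag_id n k l hi
    · intro b _ hb
      rw [if_neg (by omega)]
    · intro h
      simp at h
      omega
  · rw [Nat.choose_eq_zero_of_lt (by omega), Finset.sum_eq_zero]
    · simp
    · intro b _
      rw [if_neg (by omega)]

end AKF

/-- the additive kinematic formula for `SO(n)`. -/
theorem statement6 (n i : ℕ) (hi : i ≤ n)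
    (μ : Fin (n+1) → ConvexBody (En n) → ℝ) (hμ : SteinerFamily n μ)
    (ν : Measure (SO n)) [IsProbabilityMeasure ν] [ν.IsMulLeftInvariant]
    (K L : ConvexBody (En n)) :
    (∫ g : SO n, μ ⟨i, by omega⟩ (K + mapBody (soAct g) L) ∂ν)
      = flagCoeff (2 * n - i) (n - i) *
          ∑ k : Fin (n+1), ∑ l : Fin (n+1),
            if (k : ℕ) + (l : ℕ) = i then
              (flagCoeff (2 * n - i) (n - (k : ℕ)))⁻¹ * μ k K * μ l L
            else 0 := by
  exact AKF.final n i hi _ μ hμ ν K L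

end
end

section
/- (McMullen's decomposition) Let V be an n-dimensional real vector space. Every continuous, translation invariant, complex-valued valuation μ on V can be written in exactly one way as μ = Σ_{k=0}^{n} (μ_k^+ + μ_k^-), where each μ_k^+ is a continuous, translation invariant valuation which is homogeneous of degree k (μ_k^+(tK) = t^k μ_k^+(K) for all t ≥ 0) and even (μ_k^+(-K) = μ_k^+(K)), and each μ_k^- is a continuous, translation invariant valuation which is homogeneous of degree k and odd (μ_k^-(-K) = -μ_k^-(K)). -/
open MeasureTheory Metric Set
open scoped Pointwise ENNReal

noncomputable section

variable {V : Type*} [NormedAddCommGroup V] [NormedSpace ℝ V]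

/-- `μ` is a (complex-valued) valuation: additivity on unions of convex bodies whose
union is again convex. -/
def IsValuationC (μ : ConvexBody V → ℂ) : Prop :=
  ∀ K L M N : ConvexBody V,
    (M : Set V) = (K : Set V) ∪ (L : Set V) → (N : Set V) = (K : Set V) ∩ (L : Set V) →
      μ M + μ N = μ K + μ L

/-- `μ` is translation invariant. -/
def IsTranslationInvariantC (μ : ConvexBody V → ℂ) : Prop :=
  ∀ (x : V) (K L : ConvexBody V), (L : Set V) = x +ᵥ (K : Set V) → μ L = μ K

/-- `μ` is homogeneous of degree `k`. -/
def IsHomogeneousValC (k : ℕ) (μ : ConvexBody V → ℂ) : Prop :=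
  ∀ (t : ℝ), 0 ≤ t → ∀ K L : ConvexBody V,
    (L : Set V) = t • (K : Set V) → μ L = (t : ℂ) ^ k * μ K

/-- `μ` is an even valuation. -/
def IsEvenValC (μ : ConvexBody V → ℂ) : Prop :=
  ∀ K L : ConvexBody V, (L : Set V) = -(K : Set V) → μ L = μ K

/-- `μ` is an odd valuation. -/
def IsOddValC (μ : ConvexBody V → ℂ) : Prop :=
  ∀ K L : ConvexBody V, (L : Set V) = -(K : Set V) → μ L = -μ K

/-- Extension of a function on convex bodies to all sets by zero. -/
def muT (μ : ConvexBody V → ℂ) (S : Set V) : ℂ :=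
  open Classical in
  if h : Convex ℝ S ∧ IsCompact S ∧ S.Nonempty then μ ⟨S, h.1, h.2.1, h.2.2⟩ else 0

lemma muT_coe (μ : ConvexBody V → ℂ) (K : ConvexBody V) : muT μ (K : Set V) = μ K := by
  have h : Convex ℝ (K : Set V) ∧ IsCompact (K : Set V) ∧ (K : Set V).Nonempty :=
    ⟨K.convex, K.isCompact, K.nonempty⟩
  rw [muT, dif_pos h]
  rfl

lemma muT_empty (μ : ConvexBody V → ℂ) : muT μ (∅ : Set V) = 0 := by
  rw [muT, dif_neg]
  rintro ⟨_, _, h⟩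
  exact Set.not_nonempty_empty h

lemma muT_vadd (μ : ConvexBody V → ℂ) (ht : IsTranslationInvariantC μ) (x : V) (K : ConvexBody V)
    (S : Set V) (hS : S = x +ᵥ (K : Set V)) :
    muT μ S = μ K := by
  have h1 : Convex ℝ S := by rw [hS]; exact K.convex.vadd x
  have h2 : IsCompact S := by rw [hS]; exact K.isCompact.vadd x
  have h3 : S.Nonempty := by rw [hS]; exact K.nonempty.vadd_set
  have := muT_coe μ ⟨S, h1, h2, h3⟩
  rw [ConvexBody.coe_mk] at this
  rw [this]
  exact ht x K _ hS

lemma muT_val (μ : ConvexBody V → ℂ) (hval : IsValuationC μ) {S T M N : Set V}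
    (hS : Convex ℝ S) (hS' : IsCompact S) (hT : Convex ℝ T) (hT' : IsCompact T)
    (hM : Convex ℝ M) (hMe : M = S ∪ T) (hNe : N = S ∩ T)
    (hne : S.Nonempty → T.Nonempty → N.Nonempty) :
    muT μ M + muT μ N = muT μ S + muT μ T := by
  rcases S.eq_empty_or_nonempty with rfl | hSn
  · simp at hMe hNe; subst hMe; subst hNe; simp [muT_empty]
  rcases T.eq_empty_or_nonempty with rfl | hTn
  · simp at hMe hNe; subst hMe; subst hNe; simp [muT_empty]
  have hNn := hne hSn hTn
  have hNc : Convex ℝ N := hNe ▸ hS.inter hT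
  have hNk : IsCompact N := hNe ▸ hS'.inter_right hT'.isClosed
  have hMk : IsCompact M := hMe ▸ hS'.union hT'
  have hMn : M.Nonempty := hMe ▸ hSn.mono subset_union_left
  have := hval ⟨S, hS, hS', hSn⟩ ⟨T, hT, hT', hTn⟩ ⟨M, hM, hMk, hMn⟩ ⟨N, hNc, hNk, hNn⟩ hMe hNe
  rw [← muT_coe μ, ← muT_coe μ, ← muT_coe μ, ← muT_coe μ] at this
  exact this

lemma cut_point {E : Type*} [AddCommGroup E] [Module ℝ E] (f : E →ₗ[ℝ] ℝ) {k l : E} {c : ℝ}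
    (hk : f k ≤ c) (hl : c ≤ f l) :
    ∃ a b : ℝ, 0 ≤ a ∧ 0 ≤ b ∧ a + b = 1 ∧ f (a • k + b • l) = c := by
  rcases eq_or_lt_of_le (hk.trans hl) with h | h
  · refine ⟨1, 0, by norm_num, by norm_num, by norm_num, ?_⟩
    simp; linarith
  · have hd : 0 < f l - f k := by linarith
    refine ⟨(f l - c) / (f l - f k), (c - f k) / (f l - f k), by apply div_nonneg <;> linarith,
      by apply div_nonneg <;> linarith, by field_simp; ring, ?_⟩
    simp only [map_add, map_smul, smul_eq_mul]
    field_simp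
    ring

/-- Cutting a convex set (before taking a linear image) with a hyperplane. -/
lemma muT_cut {E : Type*} [NormedAddCommGroup E] [NormedSpace ℝ E]
    (μ : ConvexBody V → ℂ) (hval : IsValuationC μ) (A : E →L[ℝ] V) (f : E →L[ℝ] ℝ) (c : ℝ)
    {C : Set E} (hC : Convex ℝ C) (hC' : IsCompact C) :
    muT μ (A '' C) + muT μ (A '' (C ∩ {x | f x = c})) =
      muT μ (A '' (C ∩ {x | f x ≤ c})) + muT μ (A '' (C ∩ {x | c ≤ f x})) := by
  have c1 : Convex ℝ (C ∩ {x | f x ≤ c}) :=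
    hC.inter (convex_halfSpace_le f.toLinearMap.isLinear c)
  have c2 : Convex ℝ (C ∩ {x | c ≤ f x}) :=
    hC.inter (convex_halfSpace_ge f.toLinearMap.isLinear c)
  have k1 : IsCompact (C ∩ {x | f x ≤ c}) :=
    hC'.inter_right (isClosed_le f.continuous continuous_const)
  have k2 : IsCompact (C ∩ {x | c ≤ f x}) :=
    hC'.inter_right (isClosed_le continuous_const f.continuous)
  have im : ∀ {D : Set E}, Convex ℝ D → Convex ℝ (A '' D) :=
    fun h => h.linear_image A.toLinearMap
  apply muT_val μ hval (im c1) (k1.image A.continuous) (im c2) (k2.image A.continuous) (im hC)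
  · rw [← Set.image_union, ← Set.inter_union_distrib_left]
    congr 1
    ext x
    simp [le_total]
  · ext y
    constructor
    · rintro ⟨x, ⟨hx, hx'⟩, rfl⟩
      exact ⟨⟨x, ⟨hx, le_of_eq hx'⟩, rfl⟩, ⟨x, ⟨hx, ge_of_eq hx'⟩, rfl⟩⟩
    · rintro ⟨⟨k, ⟨hk, hk'⟩, rfl⟩, ⟨l, ⟨hl, hl'⟩, hkl⟩⟩
      obtain ⟨a, b, ha, hb, hab, h⟩ := cut_point f.toLinearMap hk' hl'
      refine ⟨a • k + b • l, ⟨hC hk hl ha hb hab, h⟩, ?_⟩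
      rw [map_add, map_smul, map_smul, hkl, ← add_smul, hab, one_smul]
  · rintro ⟨_, k, ⟨hk, hk'⟩, rfl⟩ ⟨_, l, ⟨hl, hl'⟩, rfl⟩
    obtain ⟨a, b, ha, hb, hab, h⟩ := cut_point f.toLinearMap hk' hl'
    exact ⟨_, a • k + b • l, ⟨hC hk hl ha hb hab, h⟩, rfl⟩

lemma incl_excl {ι : Type*} [Fintype ι] [DecidableEq ι]
    (μ : ConvexBody V → ℂ) (hval : IsValuationC μ) (A : (ι → ℝ) →L[ℝ] V) (s : Finset ι) :
    ∀ {C : Set (ι → ℝ)}, Convex ℝ C → IsCompact C →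
    ∑ S ∈ s.powerset, (-1 : ℂ) ^ S.card * muT μ (A '' (C ∩ {x | ∀ i ∈ S, 1 ≤ x i})) =
    ∑ T ∈ s.powerset, (-1 : ℂ) ^ T.card *
      muT μ (A '' (C ∩ {x | (∀ i ∈ s, x i ≤ 1) ∧ ∀ i ∈ T, x i = 1})) := by
  induction s using Finset.induction_on with
  | empty => intro C _ _; simp
  | insert i s hi ih =>
    intro C hC hC'
    let f : (ι → ℝ) →L[ℝ] ℝ := ContinuousLinearMap.proj i
    have c2 : Convex ℝ (C ∩ {x | 1 ≤ f x}) :=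
      hC.inter (convex_halfSpace_ge f.toLinearMap.isLinear 1)
    have k2 : IsCompact (C ∩ {x | 1 ≤ f x}) :=
      hC'.inter_right (isClosed_le continuous_const f.continuous)
    rw [Finset.sum_powerset_insert hi, Finset.sum_powerset_insert hi]
    have e1 : ∑ S ∈ s.powerset, (-1 : ℂ) ^ (insert i S).card *
        muT μ (A '' (C ∩ {x | ∀ j ∈ insert i S, 1 ≤ x j})) =
        - ∑ S ∈ s.powerset, (-1 : ℂ) ^ S.card *
        muT μ (A '' ((C ∩ {x | 1 ≤ f x}) ∩ {x | ∀ j ∈ S, 1 ≤ x j})) := by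
      rw [← Finset.sum_neg_distrib]
      refine Finset.sum_congr rfl fun S hS => ?_
      rw [Finset.card_insert_of_notMem fun h => hi (Finset.mem_powerset.1 hS h), pow_succ]
      have : (C ∩ {x | ∀ j ∈ insert i S, 1 ≤ x j}) =
          ((C ∩ {x | 1 ≤ f x}) ∩ {x | ∀ j ∈ S, 1 ≤ x j}) := by
        ext x; simp [f, and_assoc]
      rw [this]; ring
    rw [e1, ih hC hC', ih c2 k2, ← Finset.sum_neg_distrib, ← Finset.sum_add_distrib,
      ← Finset.sum_add_distrib]
    refine Finset.sum_congr rfl fun T hT => ?_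
    rw [Finset.card_insert_of_notMem fun h => hi (Finset.mem_powerset.1 hT h), pow_succ]
    set D : Set (ι → ℝ) := C ∩ {x | (∀ i ∈ s, x i ≤ 1) ∧ ∀ i ∈ T, x i = 1} with hD
    have hDc : Convex ℝ D := by
      refine hC.inter ?_
      rintro x ⟨hx1, hx2⟩ y ⟨hy1, hy2⟩ a b ha hb hab
      refine ⟨fun j hj => ?_, fun j hj => ?_⟩
      · simp only [Pi.add_apply, Pi.smul_apply, smul_eq_mul]
        nlinarith [hx1 j hj, hy1 j hj]
      · simp [hx2 j hj, hy2 j hj, hab]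
    have hDk : IsCompact D := by
      refine hC'.inter_right ?_
      have : {x : ι → ℝ | (∀ i ∈ s, x i ≤ 1) ∧ ∀ i ∈ T, x i = 1} =
          (⋂ i ∈ s, {x | x i ≤ 1}) ∩ (⋂ i ∈ T, {x | x i = 1}) := by ext x; simp
      rw [this]
      exact (isClosed_biInter fun i _ => isClosed_le (continuous_apply i) continuous_const).inter
        (isClosed_biInter fun i _ => isClosed_eq (continuous_apply i) continuous_const)
    have key := muT_cut μ hval A f 1 hDc hDk
    have r1 : (C ∩ {x | 1 ≤ f x}) ∩ {x | (∀ i ∈ s, x i ≤ 1) ∧ ∀ i ∈ T, x i = 1} =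
        D ∩ {x | 1 ≤ f x} := by
      ext x; simp [hD]; tauto
    have r2 : C ∩ {x | (∀ j ∈ insert i s, x j ≤ 1) ∧ ∀ j ∈ T, x j = 1} =
        D ∩ {x | f x ≤ 1} := by
      ext x; simp [hD, f]; tauto
    have r3 : C ∩ {x | (∀ j ∈ insert i s, x j ≤ 1) ∧ ∀ j ∈ insert i T, x j = 1} =
        D ∩ {x | f x = 1} := by
      ext x; simp [hD, f]
      constructor
      · tauto
      · rintro ⟨⟨h1, h2, h3⟩, h4⟩
        exact ⟨h1, ⟨h4.le, h2⟩, h4, h3⟩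
    rw [r1, r2, r3]
    linear_combination (-1 : ℂ) ^ T.card * key

lemma simplex_alt {ι : Type*} [Fintype ι] [DecidableEq ι] [Nonempty ι]
    (μ : ConvexBody V → ℂ) (hval : IsValuationC μ) (ht : IsTranslationInvariantC μ)
    (A : (ι → ℝ) →L[ℝ] V) (P : ConvexBody V) (hP : (P : Set V) = A '' stdSimplex ℝ ι)
    (m : ℕ) (hm : Fintype.card ι ≤ m) :
    ∑ S ∈ (Finset.univ : Finset ι).powerset,
      (-1 : ℂ) ^ S.card * μ (((m - S.card : ℕ) : ℝ) • P) = 0 := by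
  set C : Set (ι → ℝ) := (m : ℝ) • stdSimplex ℝ ι with hCdef
  have hC : Convex ℝ C := (convex_stdSimplex ℝ ι).smul _
  have hC' : IsCompact C := (isCompact_stdSimplex ℝ ι).smul _
  have hmpos : 0 < m := lt_of_lt_of_le Fintype.card_pos hm
  have mem : ∀ (t : ℝ), 0 ≤ t → ∀ x : ι → ℝ,
      x ∈ t • stdSimplex ℝ ι ↔ (∀ i, 0 ≤ x i) ∧ ∑ i, x i = t := by
    intro t ht x
    constructor
    · rintro ⟨y, ⟨hy1, hy2⟩, rfl⟩
      refine ⟨fun i => mul_nonneg ht (hy1 i), ?_⟩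
      simp [← Finset.mul_sum, hy2]
    · rintro ⟨h1, h2⟩
      rcases ht.eq_or_lt with h0 | h0
      · have hx : x = 0 := by
          ext i
          rw [← h0] at h2
          exact (Finset.sum_eq_zero_iff_of_nonneg (fun i _ => h1 i)).1 h2 i (Finset.mem_univ i)
        obtain ⟨y, hy⟩ : (stdSimplex ℝ ι).Nonempty :=
          ⟨_, single_mem_stdSimplex ℝ (Classical.arbitrary ι)⟩
        exact ⟨y, hy, by simp [← h0, hx]⟩
      · refine ⟨t⁻¹ • x, ⟨fun i => mul_nonneg (inv_nonneg.2 ht) (h1 i), ?_⟩, ?_⟩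
        · simp [← Finset.mul_sum, h2, h0.ne']
        · simp [smul_smul, h0.ne']
  have key := incl_excl μ hval A Finset.univ hC hC'
  have hR : ∑ T ∈ (Finset.univ : Finset ι).powerset, (-1 : ℂ) ^ T.card *
      muT μ (A '' (C ∩ {x | (∀ i ∈ Finset.univ, x i ≤ 1) ∧ ∀ i ∈ T, x i = 1})) = 0 := by
    have : ∀ T ∈ (Finset.univ : Finset ι).powerset, (-1 : ℂ) ^ T.card *
      muT μ (A '' (C ∩ {x | (∀ i ∈ Finset.univ, x i ≤ 1) ∧ ∀ i ∈ T, x i = 1})) =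
      (-1 : ℂ) ^ T.card *
      muT μ (A '' (C ∩ {x | ∀ i, x i = 1})) := by
      intro T _
      congr 3
      ext x
      constructor
      · rintro ⟨hx, hx1, hx2⟩
        refine ⟨hx, ?_⟩
        have h2 := ((mem m (by positivity) x).1 hx).2
        have h3 : ∑ i, (1 - x i) = 0 := by
          apply le_antisymm
          · rw [Finset.sum_sub_distrib, h2]
            simp
            exact_mod_cast hm
          · exact Finset.sum_nonneg fun i hi => sub_nonneg.2 (hx1 i hi)
        intro i
        have := (Finset.sum_eq_zero_iff_of_nonneg
          (fun i hi => sub_nonneg.2 (hx1 i hi))).1 h3 i (Finset.mem_univ i)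
        linarith
      · rintro ⟨hx, hx1⟩
        exact ⟨hx, fun i _ => (hx1 i).le, fun i _ => hx1 i⟩
    rw [Finset.sum_congr rfl this, ← Finset.sum_mul]
    have h0 := Finset.sum_powerset_neg_one_pow_card_of_nonempty
      (Finset.univ_nonempty (α := ι))
    have h1 : ∑ T ∈ (Finset.univ : Finset ι).powerset, (-1 : ℂ) ^ T.card = 0 := by
      exact_mod_cast congrArg (fun z : ℤ => (z : ℂ)) h0
    rw [h1, zero_mul]
  rw [hR] at key
  rw [← key]
  refine Finset.sum_congr rfl fun S _ => ?_
  congr 1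
  have hSm : S.card ≤ m := (Finset.card_le_univ S).trans hm
  set w : ι → ℝ := fun i => if i ∈ S then 1 else 0 with hw
  have hws : ∑ i, w i = S.card := by simp [hw]
  symm
  apply muT_vadd μ ht (A w)
  rw [ConvexBody.coe_smul, hP]
  have e1 : C ∩ {x | ∀ i ∈ S, 1 ≤ x i} = w +ᵥ (((m - S.card : ℕ) : ℝ) • stdSimplex ℝ ι) := by
    ext x
    rw [Set.mem_vadd_set_iff_neg_vadd_mem, mem _ (by positivity), Set.mem_inter_iff,
      mem _ (by positivity)]
    simp only [vadd_eq_add, Pi.add_apply, Pi.neg_apply, Finset.sum_add_distrib,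
      Finset.sum_neg_distrib, hws, Set.mem_ofPred_eq, Nat.cast_sub hSm]
    constructor
    · rintro ⟨⟨h1, h2⟩, h3⟩
      refine ⟨fun i => ?_, by rw [h2]; ring⟩
      by_cases hi : i ∈ S
      · have := h3 i hi; simp [hw, hi]; linarith
      · have := h1 i; simp [hw, hi]; linarith
    · rintro ⟨h1, h2⟩
      refine ⟨⟨fun i => ?_, by linarith⟩, fun i hi => ?_⟩
      · have := h1 i
        by_cases hi : i ∈ S <;> simp [hw, hi] at this <;> linarith
      · have := h1 i
        simp [hw, hi] at this; linarith
  rw [e1]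
  ext y
  constructor
  · rintro ⟨_, ⟨_, ⟨x, hx, rfl⟩, rfl⟩, rfl⟩
    exact ⟨_, ⟨_, ⟨x, hx, rfl⟩, rfl⟩, by simp⟩
  · rintro ⟨_, ⟨_, ⟨x, hx, rfl⟩, rfl⟩, rfl⟩
    exact ⟨_, ⟨_, ⟨x, hx, rfl⟩, rfl⟩, by simp⟩

open Polynomial in
/-- a function with vanishing iterated differences is polynomial -/
lemma poly_of_fwdDiff (f : ℕ → ℂ) (N : ℕ) (h : ∀ y, (fwdDiff 1)^[N] f y = 0) :
    ∃ p : ℂ[X], ∀ m : ℕ, f m = p.eval (m : ℂ) := by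
  have hk : ∀ k, N ≤ k → (fwdDiff 1)^[k] f 0 = 0 := by
    intro k hk
    obtain ⟨j, rfl⟩ := Nat.exists_eq_add_of_le' hk
    rw [Function.iterate_add_apply]
    have : (fwdDiff 1)^[N] f = fun _ => 0 := funext h
    rw [this]
    clear hk this
    induction j with
    | zero => rfl
    | succ j ih => rw [Function.iterate_succ_apply, fwdDiff_const]; exact ih
  refine ⟨∑ k ∈ Finset.range N, C ((fwdDiff 1)^[k] f 0 / (k.factorial : ℂ)) * descPochhammer ℂ k,
    fun m => ?_⟩
  have := shift_eq_sum_fwdDiff_iter 1 f m 0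
  simp only [smul_eq_mul, mul_one, zero_add] at this
  rw [this, eval_finsetSum]
  have e : ∀ k, (m.choose k) • (fwdDiff 1)^[k] f 0 =
      (C ((fwdDiff 1)^[k] f 0 / (k.factorial : ℂ)) * descPochhammer ℂ k).eval (m : ℂ) := by
    intro k
    rw [eval_mul, eval_C, descPochhammer_eval_eq_descFactorial, Nat.descFactorial_eq_factorial_mul_choose]
    have : (k.factorial : ℂ) ≠ 0 := by exact_mod_cast k.factorial_ne_zero
    push_cast
    rw [nsmul_eq_mul]
    field_simp
  simp_rw [e]
  rw [← Finset.sum_subset (s₁ := Finset.range (min N (m+1))) (s₂ := Finset.range N),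
    ← Finset.sum_subset (s₁ := Finset.range (min N (m+1))) (s₂ := Finset.range (m+1))]
  · intro x hx; simp at hx ⊢; omega
  · intro x hx hx'
    simp at hx hx'
    rw [hk x (by omega)]; simp
  · intro x hx; simp at hx ⊢; omega
  · intro x hx hx'
    simp at hx hx'
    rw [← e, Nat.choose_eq_zero_of_lt (by omega), zero_smul]

open Polynomial in
lemma simplex_poly {ι : Type*} [Fintype ι] [Nonempty ι]
    (μ : ConvexBody V → ℂ) (hval : IsValuationC μ) (ht : IsTranslationInvariantC μ)
    (A : (ι → ℝ) →L[ℝ] V) (P : ConvexBody V) (hP : (P : Set V) = A '' stdSimplex ℝ ι) :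
    ∃ p : ℂ[X], ∀ m : ℕ, μ ((m : ℝ) • P) = p.eval (m : ℂ) := by
  classical
  apply poly_of_fwdDiff (fun m : ℕ => μ ((m : ℝ) • P)) (Fintype.card ι)
  intro y
  have := simplex_alt μ hval ht A P hP (y + Fintype.card ι) (by omega)
  rw [Finset.sum_powerset_apply_card
    (fun c => (-1 : ℂ) ^ c * μ (((y + Fintype.card ι - c : ℕ) : ℝ) • P)), Finset.card_univ] at this
  rw [fwdDiff_iter_eq_sum_shift, ← Finset.sum_range_reflect]
  rw [← this]
  refine Finset.sum_congr rfl fun k hk => ?_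
  have hk' : k ≤ Fintype.card ι := by simp at hk; omega
  have e : Fintype.card ι + 1 - 1 - k = Fintype.card ι - k := by omega
  rw [e, Nat.choose_symm hk', show Fintype.card ι - (Fintype.card ι - k) = k by omega]
  simp only [smul_eq_mul, mul_one, zsmul_eq_mul, nsmul_eq_mul]
  rw [show y + (Fintype.card ι - k) = y + Fintype.card ι - k by omega]
  push_cast
  ring

lemma bdd_on [FiniteDimensional ℝ V] (μ : ConvexBody V → ℂ) (hcont : Continuous μ) {B : Set V}
    (hB : IsCompact B) : ∃ D : ℝ, 0 ≤ D ∧ ∀ K : ConvexBody V, (K : Set V) ⊆ B → ‖μ K‖ ≤ D := by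
  by_contra! hcon
  have : ∀ j : ℕ, ∃ K : ConvexBody V, (K : Set V) ⊆ B ∧ (j : ℝ) < ‖μ K‖ :=
    fun j => hcon j (by positivity)
  choose K hKB hKj using this
  let k : ℕ → TopologicalSpace.NonemptyCompacts V := fun j =>
    ⟨⟨(K j : Set V), (K j).isCompact⟩, (K j).nonempty⟩
  have hc : IsCompact {L : TopologicalSpace.NonemptyCompacts V | (L : Set V) ⊆ B} :=
    TopologicalSpace.NonemptyCompacts.isCompact_subsets_of_isCompact hB
  obtain ⟨L, hL, φ, hφ, hlim⟩ := hc.tendsto_subseq (x := k) (fun j => hKB j)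
  have hdist : Filter.Tendsto (fun j => hausdorffDist (K (φ j) : Set V) (L : Set V))
      Filter.atTop (nhds 0) := by
    have := tendsto_iff_dist_tendsto_zero.1 hlim
    simpa [NonemptyCompacts.dist_eq] using! this
  have hfin : ∀ j, hausdorffEDist (K (φ j) : Set V) (L : Set V) ≠ ⊤ := fun j =>
    hausdorffEDist_ne_top_of_nonempty_of_bounded (K (φ j)).nonempty L.nonempty
      (K (φ j)).isBounded L.isCompact.isBounded
  have hLc : Convex ℝ (L : Set V) := by
    intro x hx y hy a b ha hb hab
    have hcl : IsClosed (L : Set V) := L.isCompact.isClosed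
    rw [hcl.mem_iff_infDist_zero L.nonempty]
    apply le_antisymm _ infDist_nonneg
    apply le_of_forall_pos_le_add
    intro ε hε
    obtain ⟨j, hj⟩ := (hdist.eventually (gt_mem_nhds (half_pos hε))).exists
    obtain ⟨x', hx', hxd⟩ := exists_dist_lt_of_hausdorffDist_lt' hx hj (hfin j)
    obtain ⟨y', hy', hyd⟩ := exists_dist_lt_of_hausdorffDist_lt' hy hj (hfin j)
    have hz' := (K (φ j)).convex hx' hy' ha hb hab
    obtain ⟨z, hz, hzd⟩ := exists_dist_lt_of_hausdorffDist_lt hz' hj (hfin j)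
    have h1 : dist (a • x + b • y) (a • x' + b • y') ≤ ε / 2 := by
      calc dist (a • x + b • y) (a • x' + b • y') ≤ dist (a • x) (a • x') + dist (b • y) (b • y') :=
            dist_add_add_le _ _ _ _
        _ = a * dist x x' + b * dist y y' := by
            rw [dist_smul₀, dist_smul₀, Real.norm_of_nonneg ha, Real.norm_of_nonneg hb]
        _ ≤ a * (ε / 2) + b * (ε / 2) := by
            rw [dist_comm x, dist_comm y]
            gcongr
        _ = ε / 2 := by rw [← add_mul, hab, one_mul]
    calc infDist (a • x + b • y) (L : Set V) ≤ dist (a • x + b • y) z := infDist_le_dist_of_mem hz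
      _ ≤ dist (a • x + b • y) (a • x' + b • y') + dist (a • x' + b • y') z := dist_triangle _ _ _
      _ ≤ 0 + ε := by linarith
  let M : ConvexBody V := ⟨L, hLc, L.isCompact, L.nonempty⟩
  have hM : Filter.Tendsto (fun j => K (φ j)) Filter.atTop (nhds M) :=
    tendsto_iff_dist_tendsto_zero.2 hdist
  have h2 := ((hcont.tendsto M).comp hM).norm
  have h3 : Filter.Tendsto (fun j => ‖μ (K (φ j))‖) Filter.atTop Filter.atTop := by
    refine Filter.tendsto_atTop_mono (fun j => ?_) (tendsto_natCast_atTop_atTop (R := ℝ))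
    have : (j : ℝ) ≤ φ j := by exact_mod_cast hφ.id_le j
    exact this.trans (hKj (φ j)).le
  exact not_tendsto_nhds_of_tendsto_atTop h3 _ h2

lemma growth_aux {n : ℕ} (μ : ConvexBody V → ℂ)
    (hval : IsValuationC μ) (φ : V ≃L[ℝ] (Fin n → ℝ)) (D : ℝ) (hD : 0 ≤ D)
    (hbase : ∀ C : Set V, Convex ℝ C → IsCompact C →
      (∀ i, ∃ a : ℝ, ∀ x ∈ C, a ≤ φ x i ∧ φ x i ≤ a + 1) → ‖muT μ C‖ ≤ D)
    (M : ℕ) (hM : 1 ≤ M) (s : Finset (Fin n)) :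
    ∀ C : Set V, Convex ℝ C → IsCompact C →
      (∀ i ∈ s, ∃ a : ℝ, ∀ x ∈ C, a ≤ φ x i ∧ φ x i ≤ a + M) →
      (∀ i ∉ s, ∃ a : ℝ, ∀ x ∈ C, a ≤ φ x i ∧ φ x i ≤ a + 1) →
      ‖muT μ C‖ ≤ D * (2 * M) ^ s.card := by
  induction s using Finset.induction_on with
  | empty =>
    intro C hC hC' _ h
    simpa using hbase C hC hC' (fun i => h i (by simp))
  | insert i s hi ih =>
    intro C hC hC' h1 h2
    set E := D * (2 * M) ^ s.card with hE
    have hE0 : 0 ≤ E := by positivity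
    have main : ∀ m : ℕ, 1 ≤ m → ∀ C : Set V, Convex ℝ C → IsCompact C →
        (∀ j ∈ s, ∃ a : ℝ, ∀ x ∈ C, a ≤ φ x j ∧ φ x j ≤ a + M) →
        (∀ j ∉ insert i s, ∃ a : ℝ, ∀ x ∈ C, a ≤ φ x j ∧ φ x j ≤ a + 1) →
        (∃ a : ℝ, ∀ x ∈ C, a ≤ φ x i ∧ φ x i ≤ a + m) → ‖muT μ C‖ ≤ 2 * m * E := by
      have one : ∀ C : Set V, Convex ℝ C → IsCompact C →
        (∀ j ∈ s, ∃ a : ℝ, ∀ x ∈ C, a ≤ φ x j ∧ φ x j ≤ a + M) →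
        (∀ j ∉ insert i s, ∃ a : ℝ, ∀ x ∈ C, a ≤ φ x j ∧ φ x j ≤ a + 1) →
        (∃ a : ℝ, ∀ x ∈ C, a ≤ φ x i ∧ φ x i ≤ a + 1) → ‖muT μ C‖ ≤ E := by
        intro C hC hC' h1 h2 h3
        apply ih C hC hC' h1
        intro j hj
        by_cases hji : j = i
        · exact hji ▸ h3
        · exact h2 j (by simp [hji, hj])
      intro m hm
      induction m, hm using Nat.le_induction with
      | base =>
        intro C hC hC' h1 h2 h3
        have := one C hC hC' h1 h2 (by simpa using h3)
        push_cast; linarith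
      | succ m hm ihm =>
        rintro C hC hC' h1 h2 ⟨a, ha⟩
        let f : V →L[ℝ] ℝ := (ContinuousLinearMap.proj i).comp (φ : V →L[ℝ] (Fin n → ℝ))
        have key := muT_cut μ hval (ContinuousLinearMap.id ℝ V) f (a + m) hC hC'
        simp only [ContinuousLinearMap.coe_id', Set.image_id] at key
        have sub : ∀ T : Set V,
            (∀ j ∈ s, ∃ a : ℝ, ∀ x ∈ C ∩ T, a ≤ φ x j ∧ φ x j ≤ a + M) ∧
            (∀ j ∉ insert i s, ∃ a : ℝ, ∀ x ∈ C ∩ T, a ≤ φ x j ∧ φ x j ≤ a + 1) := by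
          intro T
          refine ⟨fun j hj => ?_, fun j hj => ?_⟩
          · obtain ⟨a, ha⟩ := h1 j hj
            exact ⟨a, fun x hx => ha x hx.1⟩
          · obtain ⟨a, ha⟩ := h2 j hj
            exact ⟨a, fun x hx => ha x hx.1⟩
        have b1 : ‖muT μ (C ∩ {x | f x ≤ a + m})‖ ≤ 2 * m * E := by
          apply ihm _ (hC.inter (convex_halfSpace_le f.toLinearMap.isLinear _))
            (hC'.inter_right (isClosed_le f.continuous continuous_const)) (sub _).1 (sub _).2
          exact ⟨a, fun x hx => ⟨(ha x hx.1).1, hx.2⟩⟩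
        have b2 : ‖muT μ (C ∩ {x | a + m ≤ f x})‖ ≤ E := by
          apply one _ (hC.inter (convex_halfSpace_ge f.toLinearMap.isLinear _))
            (hC'.inter_right (isClosed_le continuous_const f.continuous)) (sub _).1 (sub _).2
          refine ⟨a + m, fun x hx => ⟨hx.2, ?_⟩⟩
          have := (ha x hx.1).2
          push_cast at this
          linarith
        have b3 : ‖muT μ (C ∩ {x | f x = a + m})‖ ≤ E := by
          apply one _ (hC.inter (convex_hyperplane f.toLinearMap.isLinear _))
            (hC'.inter_right (isClosed_eq f.continuous continuous_const)) (sub _).1 (sub _).2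
          refine ⟨a + m, fun x hx => ⟨?_, ?_⟩⟩
          · exact ge_of_eq hx.2
          · have : φ x i = a + m := hx.2
            linarith
        have e : muT μ C = muT μ (C ∩ {x | f x ≤ a + m}) + muT μ (C ∩ {x | a + m ≤ f x})
            - muT μ (C ∩ {x | f x = a + m}) := by linear_combination key
        rw [e]
        calc _ ≤ ‖muT μ (C ∩ {x | f x ≤ a + m})‖ + ‖muT μ (C ∩ {x | a + m ≤ f x})‖
              + ‖muT μ (C ∩ {x | f x = a + m})‖ :=
              (norm_sub_le _ _).trans (add_le_add_left (norm_add_le _ _) _)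
          _ ≤ 2 * m * E + E + E := by gcongr
          _ = 2 * (m + 1 : ℕ) * E := by push_cast; ring
    have := main M hM C hC hC' (fun j hj => h1 j (by simp [hj])) h2 (h1 i (by simp))
    rw [Finset.card_insert_of_notMem hi, pow_succ]
    calc _ ≤ _ := this
      _ = _ := by rw [hE]; ring

lemma growth [FiniteDimensional ℝ V] {n : ℕ} (hV : Module.finrank ℝ V = n) (μ : ConvexBody V → ℂ)
    (hval : IsValuationC μ) (hcont : Continuous μ) (ht : IsTranslationInvariantC μ)
    (K : ConvexBody V) :
    ∃ D : ℝ, ∀ m : ℕ, 1 ≤ m → ‖μ ((m : ℝ) • K)‖ ≤ D * (m : ℝ) ^ n := by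
  let φ : V ≃L[ℝ] (Fin n → ℝ) := ContinuousLinearEquiv.ofFinrankEq (by simp [hV])
  have hBc : IsCompact (φ.symm '' (Set.Icc 0 1)) := isCompact_Icc.image φ.symm.continuous
  obtain ⟨D, hD, hbd⟩ := bdd_on μ hcont hBc
  have hbase : ∀ C : Set V, Convex ℝ C → IsCompact C →
      (∀ i, ∃ a : ℝ, ∀ x ∈ C, a ≤ φ x i ∧ φ x i ≤ a + 1) → ‖muT μ C‖ ≤ D := by
    intro C hC hC' h
    rcases C.eq_empty_or_nonempty with rfl | hne
    · rw [muT_empty]; simpa using hD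
    choose a ha using h
    let L : ConvexBody V := ⟨(-φ.symm a) +ᵥ C, hC.vadd _, hC'.vadd _, hne.vadd_set⟩
    have hL : (L : Set V) = (-φ.symm a) +ᵥ C := rfl
    rw [muT_vadd μ ht (φ.symm a) L C (by rw [hL, vadd_vadd]; simp)]
    apply hbd
    rw [hL]
    rintro _ ⟨x, hx, rfl⟩
    refine ⟨φ x - a, ⟨fun i => ?_, fun i => ?_⟩, by simp; abel⟩
    · have := (ha i x hx).1
      simpa using this
    · have := (ha i x hx).2
      simp; linarith
  obtain ⟨R, hR⟩ := (K.isCompact.image φ.continuous).isBounded.exists_norm_le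
  obtain ⟨N, hN⟩ := exists_nat_gt (max (2 * R) 1)
  have hN1 : 1 ≤ N := by
    have : (1 : ℝ) < N := (le_max_right _ _).trans_lt hN
    exact_mod_cast this.le
  have hN2 : 2 * R ≤ N := ((le_max_left _ _).trans_lt hN).le
  refine ⟨D * (2 * N) ^ n, fun m hm => ?_⟩
  have := growth_aux μ hval φ D hD hbase (N * m) (Nat.mul_pos hN1 hm) Finset.univ
    ((m : ℝ) • K : ConvexBody V) (ConvexBody.convex _) (ConvexBody.isCompact _) ?_ (by simp)
  · rw [muT_coe] at this
    simp only [Finset.card_univ, Fintype.card_fin] at this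
    calc _ ≤ _ := this
      _ = _ := by push_cast; ring
  · intro i _
    refine ⟨-(m * R), ?_⟩
    rintro _ ⟨x, hx, rfl⟩
    have h1 := hR _ ⟨x, hx, rfl⟩
    have h2 := (norm_le_pi_norm (φ x) i).trans h1
    rw [Real.norm_eq_abs, abs_le] at h2
    have hm0 : (0 : ℝ) ≤ m := by positivity
    simp only [map_smul, Pi.smul_apply, smul_eq_mul]
    constructor
    · nlinarith
    · push_cast; nlinarith

open Polynomial in
lemma deg_bound (p : ℂ[X]) (n : ℕ) (D : ℝ)
    (h : ∀ m : ℕ, 1 ≤ m → ‖p.eval (m : ℂ)‖ ≤ D * (m : ℝ) ^ n) : p.natDegree ≤ n := by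
  by_contra! hn
  have hp : p ≠ 0 := by rintro rfl; simp at hn
  have h1 : Filter.Tendsto (fun m : ℕ => p.reverse.eval ((m : ℂ)⁻¹)) Filter.atTop
      (nhds (p.reverse.eval 0)) :=
    (p.reverse.continuous.tendsto 0).comp (tendsto_inv_atTop_nhds_zero_nat (𝕜 := ℂ))
  have h2 : Filter.Tendsto (fun m : ℕ => p.reverse.eval ((m : ℂ)⁻¹)) Filter.atTop (nhds 0) := by
    have h3 : Filter.Tendsto (fun m : ℕ => D * (m : ℝ)⁻¹) Filter.atTop (nhds 0) := by
      simpa using (tendsto_inv_atTop_nhds_zero_nat (𝕜 := ℝ)).const_mul D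
    refine squeeze_zero_norm' ?_ h3
    filter_upwards [Filter.eventually_ge_atTop 1] with m hm
    have hm0 : (m : ℂ) ≠ 0 := by exact_mod_cast (by omega : m ≠ 0)
    have hm1 : (1 : ℝ) ≤ m := by exact_mod_cast hm
    let _ : Invertible (m : ℂ) := invertibleOfNonzero hm0
    have e := eval₂_reverse_mul_pow (RingHom.id ℂ) (m : ℂ) p
    change p.reverse.eval _ * _ = p.eval _ at e
    rw [invOf_eq_inv] at e
    have h4 := h m hm
    rw [← e, norm_mul, norm_pow, Complex.norm_natCast] at h4
    have h5 : (m : ℝ) ^ n * m ≤ (m : ℝ) ^ p.natDegree := by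
      rw [← pow_succ]; exact pow_le_pow_right₀ hm1 hn
    have hpos : 0 < (m : ℝ) := by linarith
    have h6 : ‖eval ((m : ℂ)⁻¹) p.reverse‖ * ((m : ℝ) ^ n * m) ≤ D * (m : ℝ) ^ n :=
      (mul_le_mul_of_nonneg_left h5 (norm_nonneg _)).trans h4
    have h7 : ‖eval ((m : ℂ)⁻¹) p.reverse‖ * m ≤ D := by
      have : 0 < (m : ℝ) ^ n := by positivity
      nlinarith
    rw [← div_eq_mul_inv, le_div_iff₀ hpos]
    exact h7
  have := tendsto_nhds_unique h1 h2
  rw [← coeff_zero_eq_eval_zero, coeff_zero_reverse, leadingCoeff_eq_zero] at this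
  exact hp this

lemma dist_le_of {K L : ConvexBody V} {r : ℝ} (hr : 0 ≤ r)
    (h1 : ∀ x ∈ K, ∃ y ∈ L, dist x y ≤ r) (h2 : ∀ x ∈ L, ∃ y ∈ K, dist x y ≤ r) :
    dist K L ≤ r :=
  hausdorffDist_le_of_mem_dist hr h1 h2

lemma exists_dist_le (K L : ConvexBody V) (x : V) (hx : x ∈ K) : ∃ y ∈ L, dist x y ≤ dist K L := by
  obtain ⟨y, hy, h⟩ := L.isCompact.exists_infDist_eq_dist L.nonempty x
  refine ⟨y, hy, ?_⟩
  rw [← h]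
  exact infDist_le_hausdorffDist_of_mem hx ConvexBody.hausdorffEDist_ne_top

lemma continuous_smul_body (c : ℝ) : Continuous (fun K : ConvexBody V => c • K) := by
  apply LipschitzWith.continuous (K := ‖c‖₊)
  apply LipschitzWith.of_dist_le_mul
  intro K L
  have aux : ∀ K L : ConvexBody V, ∀ x ∈ c • K, ∃ y ∈ c • L, dist x y ≤ ‖c‖ * dist K L := by
    rintro K L _ ⟨x, hx, rfl⟩
    obtain ⟨y, hy, h⟩ := exists_dist_le K L x hx
    refine ⟨c • y, ⟨y, hy, rfl⟩, ?_⟩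
    simp only [dist_smul₀]
    gcongr
  refine dist_le_of (by positivity) (aux K L) ?_
  rw [dist_comm]
  exact aux L K

lemma continuous_smul_left (K : ConvexBody V) : Continuous (fun c : ℝ => c • K) := by
  obtain ⟨R, hR0, hR⟩ := K.isBounded.exists_pos_norm_le
  apply LipschitzWith.continuous (K := ⟨R, hR0.le⟩)
  apply LipschitzWith.of_dist_le_mul
  intro c d
  have aux : ∀ c d : ℝ, ∀ x ∈ c • K, ∃ y ∈ d • K, dist x y ≤ R * dist c d := by
    rintro c d _ ⟨x, hx, rfl⟩
    refine ⟨d • x, ⟨x, hx, rfl⟩, ?_⟩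
    change dist (c • x) (d • x) ≤ _
    rw [dist_eq_norm, ← sub_smul, norm_smul, dist_eq_norm, mul_comm]
    gcongr
    exact hR x hx
  refine dist_le_of (by change 0 ≤ R * _; positivity) (aux c d) ?_
  rw [dist_comm]
  exact aux d c

lemma fwd_eq_zero_of_poly {f : ℕ → ℂ} {n : ℕ} (p : Polynomial ℂ) (hp : p.natDegree ≤ n)
    (h : ∀ m : ℕ, f m = p.eval (m : ℂ)) (y : ℕ) : (fwdDiff 1)^[n + 1] f y = 0 := by
  have h1 := congrFun (Polynomial.fwdDiff_iter_eq_zero_of_degree_lt (n := n + 1) (P := p)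
    (by omega)) (y : ℂ)
  rw [fwdDiff_iter_eq_sum_shift] at h1 ⊢
  rw [Pi.zero_apply] at h1
  rw [← h1]
  refine Finset.sum_congr rfl fun k _ => ?_
  rw [h]
  simp

open Polynomial in
lemma nat_poly [FiniteDimensional ℝ V] {n : ℕ} (hV : Module.finrank ℝ V = n) (μ : ConvexBody V → ℂ)
    (hval : IsValuationC μ) (hcont : Continuous μ) (ht : IsTranslationInvariantC μ)
    (K : ConvexBody V) :
    ∃ p : ℂ[X], p.natDegree ≤ n ∧ ∀ m : ℕ, μ ((m : ℝ) • K) = p.eval (m : ℂ) := by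
  have deg : ∀ (K : ConvexBody V) (p : ℂ[X]), (∀ m : ℕ, μ ((m : ℝ) • K) = p.eval (m : ℂ)) →
      p.natDegree ≤ n := by
    intro K p hp
    obtain ⟨D, hD⟩ := growth hV μ hval hcont ht K
    exact deg_bound p n D fun m hm => by rw [← hp]; exact hD m hm
  suffices h : ∀ y, (fwdDiff 1)^[n + 1] (fun m : ℕ => μ ((m : ℝ) • K)) y = 0 by
    obtain ⟨p, hp⟩ := poly_of_fwdDiff _ _ h
    exact ⟨p, deg K p hp, hp⟩
  intro y
  have hcl : IsClosed {L : ConvexBody V |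
      (fwdDiff 1)^[n + 1] (fun m : ℕ => μ ((m : ℝ) • L)) y = 0} := by
    simp only [fwdDiff_iter_eq_sum_shift]
    refine isClosed_eq ?_ continuous_const
    refine continuous_finsetSum _ fun k _ => ?_
    exact (hcont.comp (continuous_smul_body _)).const_smul _
  have hmem : K ∈ closure {L : ConvexBody V |
      (fwdDiff 1)^[n + 1] (fun m : ℕ => μ ((m : ℝ) • L)) y = 0} := by
    rw [Metric.mem_closure_iff]
    intro ε hε
    obtain ⟨F, hFK, hF, hcov⟩ := K.isCompact.finite_cover_balls (half_pos hε)
    have hFn : F.Nonempty := by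
      obtain ⟨x, hx⟩ := K.nonempty
      have := hcov hx
      simp only [Set.mem_iUnion] at this
      obtain ⟨z, hz, _⟩ := this
      exact ⟨z, hz⟩
    let P : ConvexBody V := ⟨convexHull ℝ F, convex_convexHull ℝ F, hF.isCompact_convexHull (𝕜 := ℝ),
      hFn.convexHull⟩
    have hPK : (P : Set V) ⊆ K := convexHull_min hFK K.convex
    refine ⟨P, ?_, ?_⟩
    · let := hF.fintype
      have : Nonempty F := hFn.to_subtype
      let A : (F → ℝ) →L[ℝ] V := LinearMap.toContinuousLinearMap
        (∑ x : F, (LinearMap.proj (R := ℝ) (φ := fun _ : F => ℝ) x).smulRight x.1)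
      have hP : (P : Set V) = A '' stdSimplex ℝ F := hF.convexHull_eq_image
      obtain ⟨p, hp⟩ := simplex_poly μ hval ht A P hP
      exact fwd_eq_zero_of_poly p (deg P p hp) hp y
    · refine (dist_le_of (half_pos hε).le ?_ ?_).trans_lt (half_lt_self hε)
      · intro x hx
        have := hcov hx
        simp only [Set.mem_iUnion] at this
        obtain ⟨z, hz, hxz⟩ := this
        exact ⟨z, subset_convexHull ℝ F hz, (mem_ball.1 hxz).le⟩
      · intro x hx
        exact ⟨x, hPK hx, by simpa using (half_pos hε).le⟩
  rw [hcl.closure_eq] at hmem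
  exact hmem

open Polynomial in
lemma poly_eq_of_nat {p q : ℂ[X]} (h : ∀ m : ℕ, p.eval (m : ℂ) = q.eval (m : ℂ)) : p = q := by
  apply Polynomial.eq_of_infinite_eval_eq
  refine Set.Infinite.mono ?_ (Set.infinite_range_of_injective (Nat.cast_injective (R := ℂ)))
  rintro _ ⟨m, rfl⟩
  exact h m

open Polynomial in
lemma real_poly [FiniteDimensional ℝ V] {n : ℕ} (hV : Module.finrank ℝ V = n) (μ : ConvexBody V → ℂ)
    (hval : IsValuationC μ) (hcont : Continuous μ) (ht : IsTranslationInvariantC μ)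
    (K : ConvexBody V) :
    ∃ p : ℂ[X], p.natDegree ≤ n ∧ ∀ t : ℝ, 0 ≤ t → μ (t • K) = p.eval (t : ℂ) := by
  obtain ⟨p, hp, hpe⟩ := nat_poly hV μ hval hcont ht K
  refine ⟨p, hp, ?_⟩
  have rat : ∀ a q : ℕ, 1 ≤ q → μ (((a : ℝ) / q) • K) = p.eval ((a : ℂ) / q) := by
    intro a q hq
    have hq0 : (q : ℝ) ≠ 0 := by exact_mod_cast (by omega : q ≠ 0)
    have hq1 : (q : ℂ) ≠ 0 := by exact_mod_cast (by omega : q ≠ 0)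
    obtain ⟨r, _, hr⟩ := nat_poly hV μ hval hcont ht ((q : ℝ)⁻¹ • K)
    have e : r.comp (C (q : ℂ) * X) = p := by
      apply poly_eq_of_nat
      intro m
      have := hr (q * m)
      rw [smul_smul] at this
      rw [eval_comp, ← hpe]
      simp only [eval_mul, eval_C, eval_X]
      push_cast at this
      rw [← this]
      congr 2
      field_simp
    have := hr a
    rw [smul_smul] at this
    rw [div_eq_mul_inv, this, ← e, eval_comp]
    simp only [eval_mul, eval_C, eval_X]
    congr 1
    field_simp
  intro t ht0
  have l0 : Filter.Tendsto (fun q : ℕ => ((⌊t * (q : ℝ)⌋₊ : ℝ) / q)) Filter.atTop (nhds t) :=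
    (tendsto_nat_floor_mul_div_atTop ht0).comp tendsto_natCast_atTop_atTop
  have l1 := ((hcont.comp (continuous_smul_left K)).tendsto t).comp l0
  have l2 := ((p.continuous.comp Complex.continuous_ofReal).tendsto t).comp l0
  refine tendsto_nhds_unique (l1.congr' ?_) l2
  filter_upwards [Filter.eventually_ge_atTop 1] with q hq
  have := rat ⌊t * (q : ℝ)⌋₊ q hq
  simp only [Function.comp_apply]
  rw [this]
  push_cast
  rfl

/-- The degree `k` component of `μ`, obtained by Lagrange interpolation. -/
def compC (n : ℕ) (μ : ConvexBody V → ℂ) (k : ℕ) (K : ConvexBody V) : ℂ :=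
  ∑ j ∈ Finset.range (n + 1),
    (Lagrange.basis (Finset.range (n + 1)) (fun j : ℕ => (j : ℂ)) j).coeff k * μ ((j : ℝ) • K)

open Polynomial in
lemma compC_eq_coeff (n : ℕ) (μ : ConvexBody V → ℂ) (K : ConvexBody V) (p : ℂ[X])
    (hp : p.natDegree ≤ n) (h : ∀ j : ℕ, μ ((j : ℝ) • K) = p.eval (j : ℂ)) (k : ℕ) :
    compC n μ k K = p.coeff k := by
  have e := Lagrange.eq_interpolate (s := Finset.range (n + 1)) (v := fun j : ℕ => (j : ℂ)) (f := p)
    (fun a _ b _ hab => Nat.cast_injective hab) (by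
      rw [Finset.card_range]
      exact lt_of_le_of_lt degree_le_natDegree (by exact_mod_cast Nat.lt_succ_of_le hp))
  conv_rhs => rw [e, Lagrange.interpolate_apply, finsetSum_coeff]
  refine Finset.sum_congr rfl fun j _ => ?_
  rw [coeff_C_mul, h, mul_comm]

lemma coe_smul_body (a : ℝ) (K : ConvexBody V) : ((a • K : ConvexBody V) : Set V) = a • (K : Set V) :=
  rfl

lemma val_smul {μ : ConvexBody V → ℂ} (h : IsValuationC μ) (a : ℝ) :
    IsValuationC (fun K => μ (a • K)) := by
  intro K L M N hM hN
  apply h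
  · rw [coe_smul_body, hM, Set.smul_set_union]; rfl
  · rw [coe_smul_body, coe_smul_body, coe_smul_body]
    rcases eq_or_ne a 0 with rfl | ha
    · rw [Set.zero_smul_set K.nonempty, Set.zero_smul_set L.nonempty, Set.zero_smul_set N.nonempty,
        Set.inter_self]
    · rw [hN, Set.smul_set_inter₀ ha]

lemma trans_smul {μ : ConvexBody V → ℂ} (h : IsTranslationInvariantC μ) (a : ℝ) :
    IsTranslationInvariantC (fun K => μ (a • K)) := by
  intro x K L hL
  apply h (a • x)
  rw [coe_smul_body, hL, coe_smul_body]
  ext y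
  constructor
  · rintro ⟨_, ⟨z, hz, rfl⟩, rfl⟩
    exact ⟨_, ⟨z, hz, rfl⟩, by simp⟩
  · rintro ⟨_, ⟨z, hz, rfl⟩, rfl⟩
    exact ⟨_, ⟨z, hz, rfl⟩, by simp⟩

lemma cont_smul {μ : ConvexBody V → ℂ} (h : Continuous μ) (a : ℝ) :
    Continuous (fun K => μ (a • K)) := h.comp (continuous_smul_body a)

lemma compC_val {n : ℕ} {μ : ConvexBody V → ℂ} (h : IsValuationC μ) (k : ℕ) :
    IsValuationC (compC n μ k) := by
  intro K L M N hM hN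
  simp only [compC]
  rw [← Finset.sum_add_distrib, ← Finset.sum_add_distrib]
  refine Finset.sum_congr rfl fun j _ => ?_
  have := val_smul h (j : ℝ) K L M N hM hN
  simp only at this
  rw [← mul_add, ← mul_add, this]

lemma compC_trans {n : ℕ} {μ : ConvexBody V → ℂ} (h : IsTranslationInvariantC μ) (k : ℕ) :
    IsTranslationInvariantC (compC n μ k) := by
  intro x K L hL
  simp only [compC]
  refine Finset.sum_congr rfl fun j _ => ?_
  have := trans_smul h (j : ℝ) x K L hL
  simp only at this
  rw [this]

lemma compC_cont {n : ℕ} {μ : ConvexBody V → ℂ} (h : Continuous μ) (k : ℕ) :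
    Continuous (compC n μ k) :=
  continuous_finsetSum _ fun _ _ => continuous_const.mul (cont_smul h _)

open Polynomial in
lemma compC_hom [FiniteDimensional ℝ V] {n : ℕ} (hV : Module.finrank ℝ V = n) (μ : ConvexBody V → ℂ)
    (hval : IsValuationC μ) (hcont : Continuous μ) (ht : IsTranslationInvariantC μ)
    (K : ConvexBody V) (k : ℕ) (t : ℝ) (h0 : 0 ≤ t) :
    compC n μ k (t • K) = (t : ℂ) ^ k * compC n μ k K := by
  obtain ⟨p, hp, h⟩ := real_poly hV μ hval hcont ht K
  rw [compC_eq_coeff n μ K p hp (fun j => by simpa using h j (by positivity)),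
    compC_eq_coeff n μ (t • K) (p.comp (C (t : ℂ) * X)), comp_C_mul_X_coeff, mul_comm]
  · refine natDegree_comp_le.trans ?_
    calc p.natDegree * (C (t : ℂ) * X).natDegree ≤ p.natDegree * 1 := by
          gcongr; simpa using natDegree_C_mul_X_pow_le (t : ℂ) 1
      _ ≤ n := by simpa using hp
  · intro j
    rw [smul_smul, h _ (by positivity), eval_comp]
    simp only [eval_mul, eval_C, eval_X]
    push_cast
    rw [mul_comm]

open Polynomial in
lemma compC_sum [FiniteDimensional ℝ V] {n : ℕ} (hV : Module.finrank ℝ V = n) (μ : ConvexBody V → ℂ)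
    (hval : IsValuationC μ) (hcont : Continuous μ) (ht : IsTranslationInvariantC μ)
    (K : ConvexBody V) : μ K = ∑ k : Fin (n + 1), compC n μ k K := by
  obtain ⟨p, hp, h⟩ := real_poly hV μ hval hcont ht K
  have h1 := h 1 zero_le_one
  rw [one_smul] at h1
  rw [h1, eval_eq_sum_range' (Nat.lt_succ_of_le hp), Finset.sum_range]
  refine Finset.sum_congr rfl fun k _ => ?_
  rw [compC_eq_coeff n μ K p hp (fun j => by simpa using h j (by positivity))]
  simp

open Polynomial in
lemma compC_unique {n : ℕ} (μ : ConvexBody V → ℂ) (K : ConvexBody V) (G : Fin (n + 1) → ℂ)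
    (h : ∀ j : ℕ, μ ((j : ℝ) • K) = ∑ k : Fin (n + 1), (j : ℂ) ^ (k : ℕ) * G k) (k : Fin (n + 1)) :
    compC n μ k K = G k := by
  rw [compC_eq_coeff n μ K (∑ k : Fin (n + 1), C (G k) * X ^ (k : ℕ))]
  · simp only [finsetSum_coeff, coeff_C_mul, coeff_X_pow]
    rw [Finset.sum_eq_single k]
    · simp
    · intro b _ hb
      rw [if_neg, mul_zero]
      intro hc
      exact hb (Fin.ext hc.symm)
    · simp
  · apply natDegree_sum_le_of_forall_le
    intro i _
    exact (natDegree_C_mul_X_pow_le _ _).trans (by omega)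
  · intro j
    rw [h, eval_finsetSum]
    refine Finset.sum_congr rfl fun k _ => ?_
    simp only [eval_mul, eval_C, eval_X, eval_pow]
    rw [mul_comm]

lemma body_eq_smul {K L : ConvexBody V} {t : ℝ} (h : (L : Set V) = t • (K : Set V)) : L = t • K :=
  ConvexBody.ext h

lemma body_eq_neg {K L : ConvexBody V} (h : (L : Set V) = -(K : Set V)) : L = (-1 : ℝ) • K := by
  apply ConvexBody.ext
  rw [h, coe_smul_body]
  ext x
  constructor
  · intro hx
    exact ⟨-x, hx, by simp⟩
  · rintro ⟨y, hy, rfl⟩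
    simpa using hy

lemma coe_neg_body (K : ConvexBody V) : (((-1 : ℝ) • K : ConvexBody V) : Set V) = -(K : Set V) := by
  rw [coe_smul_body]
  ext x
  constructor
  · rintro ⟨y, hy, rfl⟩
    simpa using hy
  · intro hx
    exact ⟨-x, hx, by simp⟩

lemma neg_neg_body (K : ConvexBody V) : (-1 : ℝ) • ((-1 : ℝ) • K) = K := by
  rw [smul_smul]; simp

/-- Symmetrization with sign `e`. -/
def symC (e : ℂ) (ν : ConvexBody V → ℂ) (K : ConvexBody V) : ℂ :=
  (ν K + e * ν ((-1 : ℝ) • K)) / 2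

lemma symC_val {e : ℂ} {ν : ConvexBody V → ℂ} (h : IsValuationC ν) : IsValuationC (symC e ν) := by
  intro K L M N hM hN
  have h1 := h K L M N hM hN
  have h2 := val_smul h (-1) K L M N hM hN
  simp only [symC] at *
  linear_combination h1 / 2 + e * h2 / 2

lemma symC_trans {e : ℂ} {ν : ConvexBody V → ℂ} (h : IsTranslationInvariantC ν) :
    IsTranslationInvariantC (symC e ν) := by
  intro x K L hL
  have h1 := h x K L hL
  have h2 := trans_smul h (-1) x K L hL
  simp only [symC] at *
  rw [h1, h2]

lemma symC_cont {e : ℂ} {ν : ConvexBody V → ℂ} (h : Continuous ν) : Continuous (symC e ν) :=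
  (h.add (continuous_const.mul (cont_smul h (-1)))).div_const 2

/-- McMullen's decomposition of a continuous translation invariant valuation
into homogeneous even and odd parts. -/
theorem statement8 (n : ℕ) [FiniteDimensional ℝ V] (hV : Module.finrank ℝ V = n)
    (μ : ConvexBody V → ℂ) (hval : IsValuationC μ) (hcont : Continuous μ)
    (htrans : IsTranslationInvariantC μ) :
    ∃! F : (Fin (n+1) → ConvexBody V → ℂ) × (Fin (n+1) → ConvexBody V → ℂ),
      (∀ k : Fin (n+1),
        IsValuationC (F.1 k) ∧ Continuous (F.1 k) ∧ IsTranslationInvariantC (F.1 k) ∧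
          IsHomogeneousValC (k : ℕ) (F.1 k) ∧ IsEvenValC (F.1 k)) ∧
      (∀ k : Fin (n+1),
        IsValuationC (F.2 k) ∧ Continuous (F.2 k) ∧ IsTranslationInvariantC (F.2 k) ∧
          IsHomogeneousValC (k : ℕ) (F.2 k) ∧ IsOddValC (F.2 k)) ∧
      (∀ K : ConvexBody V, μ K = ∑ k : Fin (n+1), (F.1 k K + F.2 k K)) := by
  have hom : ∀ (e : ℂ) (k : ℕ), IsHomogeneousValC k (symC e (compC n μ k)) := by
    intro e k t h0 K L hL
    rw [body_eq_smul hL]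
    simp only [symC]
    rw [smul_comm, compC_hom hV μ hval hcont htrans _ k t h0,
      compC_hom hV μ hval hcont htrans _ k t h0]
    ring
  refine ⟨(fun k => symC 1 (compC n μ k), fun k => symC (-1) (compC n μ k)), ⟨?_, ?_, ?_⟩, ?_⟩
  · intro k
    refine ⟨symC_val (compC_val hval k), symC_cont (compC_cont hcont k),
      symC_trans (compC_trans htrans k), hom _ _, ?_⟩
    intro K L hL
    rw [body_eq_neg hL]
    simp only [symC, neg_neg_body]
    ring
  · intro k
    refine ⟨symC_val (compC_val hval k), symC_cont (compC_cont hcont k),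
      symC_trans (compC_trans htrans k), hom _ _, ?_⟩
    intro K L hL
    rw [body_eq_neg hL]
    simp only [symC, neg_neg_body]
    ring
  · intro K
    rw [compC_sum hV μ hval hcont htrans K]
    refine Finset.sum_congr rfl fun k _ => ?_
    simp only [symC]
    ring
  · rintro ⟨F, G⟩ ⟨hF, hG, hsum⟩
    simp only at hF hG hsum
    have key : ∀ (K : ConvexBody V) (k : Fin (n + 1)), compC n μ k K = F k K + G k K := by
      intro K k
      apply compC_unique μ K (fun k => F k K + G k K)
      intro j
      rw [hsum]
      refine Finset.sum_congr rfl fun k _ => ?_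
      rw [(hF k).2.2.2.1 (j : ℝ) (by positivity) K _ rfl,
        (hG k).2.2.2.1 (j : ℝ) (by positivity) K _ rfl]
      push_cast
      ring
    have key2 : ∀ (K : ConvexBody V) (k : Fin (n + 1)),
        compC n μ k ((-1 : ℝ) • K) = F k K - G k K := by
      intro K k
      rw [key, (hF k).2.2.2.2 K _ (coe_neg_body K), (hG k).2.2.2.2 K _ (coe_neg_body K)]
      ring
    ext k K
    · simp only [symC, key2, key]; ring
    · simp only [symC, key2, key]; ring

end
end
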